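/- Let u^{ε,R} ∈ C^∞(Ω̄_R^ε) be the k-convex solution of the approximating problem with α ≥ α₀. Then sup_{Ω_R^ε} |D²u^{ε,R}| ≤ C·C_ε·ε^{−1}, where C is a positive constant depending only on n, k, λ_max(A), λ_min(A), R₀ and α, independent of ε and R, and C_ε = C(n/k − 2)ε^{−1} if k < n/2, C_ε = Cε^{−1}|log ε|^{−1} if k = n/2, C_ε = C(2 − n/k)ε^{1−n/k} if k > n/2. -/

import Mathlib

open scoped Classical Topology
open Real Filter MeasureTheory

noncomputable section

/-- Euclidean space ℝⁿ. -/
abbrev Euc (n : ℕ) : Type := EuclideanSpace ℝ (Fin n)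

/-- The standard basis vector `e i`. -/
def ebasis (n : ℕ) (i : Fin n) : Euc n := EuclideanSpace.single i 1

/-- The Hessian matrix `D²u(x)`. -/
def hessMat (n : ℕ) (u : Euc n → ℝ) (x : Euc n) : Matrix (Fin n) (Fin n) ℝ :=
  Matrix.of fun i j => iteratedFDeriv ℝ 2 u x ![ebasis n i, ebasis n j]

/-- The Laplacian `Δu(x)` (trace of the Hessian). -/
def lapl (n : ℕ) (u : Euc n → ℝ) (x : Euc n) : ℝ := ∑ i, hessMat n u x i i

/-- The `k`-th elementary symmetric function of the eigenvalues of an `n × n` matrix,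
expressed through the coefficients of the characteristic polynomial. -/
def matSk (n k : ℕ) (M : Matrix (Fin n) (Fin n) ℝ) : ℝ :=
  (-1 : ℝ) ^ k * (Matrix.charpoly M).coeff (n - k)

/-- `S_k(D²u)(x)`. -/
def SkHess (n k : ℕ) (u : Euc n → ℝ) (x : Euc n) : ℝ := matSk n k (hessMat n u x)

/-- `u` is `k`-convex on `U`: the eigenvalues of the Hessian lie in the Gårding cone `Γ_k`. -/
def KConvexOn (n k : ℕ) (u : Euc n → ℝ) (U : Set (Euc n)) : Prop :=
  ∀ x ∈ U, ∀ j : ℕ, 1 ≤ j → j ≤ k → 0 < matSk n j (hessMat n u x)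

/-- Membership in the class `𝒜_k`: symmetric positive definite with `S_k(λ(A)) = 1`. -/
def MemA (n k : ℕ) (A : Matrix (Fin n) (Fin n) ℝ) : Prop :=
  A.IsSymm ∧ A.PosDef ∧ matSk n k A = 1

/-- The quadratic form `½ xᵀ A x`. -/
def quadA (n : ℕ) (A : Matrix (Fin n) (Fin n) ℝ) (x : Euc n) : ℝ :=
  (1 / 2) * ∑ i, ∑ j, x i * A i j * x j

/-- The linear form `b ⋅ x`. -/
def linB (n : ℕ) (b x : Euc n) : ℝ := ∑ i, b i * x i

/-- `λ_max(A) < c`, expressed through the quadratic form (for symmetric `A`). -/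
def lambdaMaxLT (n : ℕ) (A : Matrix (Fin n) (Fin n) ℝ) (c : ℝ) : Prop :=
  ∀ x : Euc n, x ≠ 0 → ∑ i, ∑ j, x i * A i j * x j < c * ‖x‖ ^ 2

/-- `u` is smooth on an open neighbourhood of the (closed) set `S`;
this is our rendering of `u ∈ C^∞(S)` for a closed set `S`. -/
def SmoothOnNhd (n : ℕ) (u : Euc n → ℝ) (S : Set (Euc n)) : Prop :=
  ∃ U : Set (Euc n), IsOpen U ∧ S ⊆ U ∧ ContDiffOn ℝ (⊤ : ℕ∞) u U

/-- A smooth bounded strictly convex domain in ℝⁿ. -/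
def SmoothStrictConvexDomain (n : ℕ) (Ω : Set (Euc n)) : Prop :=
  IsOpen Ω ∧ Bornology.IsBounded Ω ∧ Ω.Nonempty ∧ Convex ℝ Ω ∧ StrictConvex ℝ Ω ∧
    ∃ f : Euc n → ℝ, ContDiff ℝ (⊤ : ℕ∞) f ∧ Ω = {x | f x < 0} ∧
      ∀ x ∈ frontier Ω, fderiv ℝ f x ≠ 0

/-- Extension of `u` by the constant value `v` inside `Ω`. -/
def extBy (n : ℕ) (Ω : Set (Euc n)) (v : ℝ) (u : Euc n → ℝ) : Euc n → ℝ :=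
  fun x => if x ∈ Ω then v else u x

/-- `u` (vanishing on `∂Ω`) is quasiconvex: all sublevel sets of its zero-extension are convex. -/
def QuasiconvexSol (n : ℕ) (Ω : Set (Euc n)) (u : Euc n → ℝ) : Prop :=
  ∀ t : ℝ, Convex ℝ {x : Euc n | extBy n Ω 0 u x ≤ t}

/-- The `k`-th elementary symmetric polynomial of a vector `a ∈ ℝⁿ`. -/
def esymmVec (n k : ℕ) (a : Fin n → ℝ) : ℝ :=
  ∑ s ∈ Finset.powersetCard k (Finset.univ : Finset (Fin n)), ∏ i ∈ s, a i

/-- `h_k(a) = max_i S_{k-1}(a)|_{a_i = 0} · a_i`. -/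
def hkfun (n k : ℕ) (a : Fin n → ℝ) : ℝ :=
  ⨆ i : Fin n, esymmVec n (k - 1) (Function.update a i 0) * a i

/-- The exponent `-k / (2 h_k(a))`. -/
def genExp (n k : ℕ) (a : Fin n → ℝ) : ℝ := -(k : ℝ) / (2 * hkfun n k a)

/-- The integrand `(1 + α t^{-k/(2h_k(a))})^{1/k}`. -/
def genInt (n k : ℕ) (a : Fin n → ℝ) (α t : ℝ) : ℝ :=
  (1 + α * t ^ genExp n k a) ^ ((1 : ℝ) / (k : ℝ))

/-- The generalized symmetric function `ū`. -/
def ubar (n k : ℕ) (a : Fin n → ℝ) (R₀ α : ℝ) (x : Euc n) : ℝ :=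
  ∫ t in R₀..(quadA n (Matrix.diagonal a) x), genInt n k a α t

/-- `μ(α) = ∫_{R₀}^∞ ((1 + α t^{-k/(2h_k(a))})^{1/k} - 1) dt - R₀`. -/
def muA (n k : ℕ) (a : Fin n → ℝ) (R₀ α : ℝ) : ℝ :=
  (∫ t in Set.Ioi R₀, (genInt n k a α t - 1)) - R₀

/-- The ellipsoid `E_R(xb) = {x : ½ (x - xb)ᵀ A (x - xb) < R}`. -/
def ESet (n : ℕ) (A : Matrix (Fin n) (Fin n) ℝ) (xb : Euc n) (R : ℝ) : Set (Euc n) :=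
  {x : Euc n | quadA n A (x - xb) < R}

/-- The non-concentric convex ring `Ω_R^ε = E_R(0) ∖ B̄_ε(x₀)`. -/
def OmegaRe (n : ℕ) (a : Fin n → ℝ) (x₀ : Euc n) (ε R : ℝ) : Set (Euc n) :=
  ESet n (Matrix.diagonal a) 0 R \ closure (Metric.ball x₀ ε)

/-- `u` is a `k`-convex solution of the approximating problem
`S_k(D²u) = 1` in `Ω_R^ε`, `u = 0` on `∂B_ε(x₀)`, `u = ū` on `∂E_R(0)`. -/
def ApproxSol (n k : ℕ) (a : Fin n → ℝ) (x₀ : Euc n) (ε R R₀ α : ℝ)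
    (u : Euc n → ℝ) : Prop :=
  SmoothOnNhd n u (closure (OmegaRe n a x₀ ε R)) ∧
  KConvexOn n k u (OmegaRe n a x₀ ε R) ∧
  (∀ x ∈ OmegaRe n a x₀ ε R, SkHess n k u x = 1) ∧
  (∀ x ∈ Metric.sphere x₀ ε, u x = 0) ∧
  (∀ x : Euc n, quadA n (Matrix.diagonal a) x = R → u x = ubar n k a R₀ α x)

/-- The constant `C_ε` of the boundary gradient estimate. -/
def Ceps (n k : ℕ) (C ε : ℝ) : ℝ :=
  if 2 * k < n then C * ((n : ℝ) / (k : ℝ) - 2) * ε⁻¹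
  else if 2 * k = n then C * ε⁻¹ * |Real.log ε|⁻¹
  else C * (2 - (n : ℝ) / (k : ℝ)) * ε ^ (1 - (n : ℝ) / (k : ℝ))

/-- `u` is a `k`-convex solution of the exterior Dirichlet problem
`S_k(D²u) = 1` in `ℝⁿ ∖ B̄_ε(x₀)`, `u = 0` on `∂B_ε(x₀)`, with quadratic asymptotics
`½ xᵀAx + c` at infinity (`A = diag a`). -/
def ExtBallSol (n k : ℕ) (a : Fin n → ℝ) (x₀ : Euc n) (ε c : ℝ) (u : Euc n → ℝ) : Prop :=
  SmoothOnNhd n u (Metric.ball x₀ ε)ᶜ ∧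
  KConvexOn n k u (closure (Metric.ball x₀ ε))ᶜ ∧
  (∀ x ∈ (closure (Metric.ball x₀ ε))ᶜ, SkHess n k u x = 1) ∧
  (∀ x ∈ Metric.sphere x₀ ε, u x = 0) ∧
  Tendsto (fun x : Euc n => u x - (quadA n (Matrix.diagonal a) x + c))
    (cocompact (Euc n)) (𝓝 0)

/-- `u` is a `k`-convex solution of the exterior Dirichlet problem on `ℝⁿ ∖ Ω₀` with
asymptotics `½ xᵀAx + b·x + c` at infinity. -/
def ExtDomSol (n k : ℕ) (Ω₀ : Set (Euc n)) (A : Matrix (Fin n) (Fin n) ℝ) (b : Euc n)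
    (c : ℝ) (u : Euc n → ℝ) : Prop :=
  SmoothOnNhd n u Ω₀ᶜ ∧
  KConvexOn n k u (closure Ω₀)ᶜ ∧
  (∀ x ∈ (closure Ω₀)ᶜ, SkHess n k u x = 1) ∧
  (∀ x ∈ frontier Ω₀, u x = 0) ∧
  Tendsto (fun x : Euc n => u x - (quadA n A x + linB n b x + c))
    (cocompact (Euc n)) (𝓝 0)

/-- `u` is a solution of the exterior Dirichlet problem for the Laplace equation
`Δu = 1` on `ℝⁿ ∖ Ω₀` with asymptotics `½ xᵀAx + b·x + c` at infinity. -/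
def ExtDomSolLap (n : ℕ) (Ω₀ : Set (Euc n)) (A : Matrix (Fin n) (Fin n) ℝ) (b : Euc n)
    (c : ℝ) (u : Euc n → ℝ) : Prop :=
  SmoothOnNhd n u Ω₀ᶜ ∧
  (∀ x ∈ (closure Ω₀)ᶜ, lapl n u x = 1) ∧
  (∀ x ∈ frontier Ω₀, u x = 0) ∧
  Tendsto (fun x : Euc n => u x - (quadA n A x + linB n b x + c))
    (cocompact (Euc n)) (𝓝 0)

/-- `u` solves the exterior problem `Δu = 0` in `ℝⁿ ∖ Ω̄`, `u = 1` on `∂Ω`,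
`u → 0` at infinity. -/
def HarmExtSol (n : ℕ) (Ω : Set (Euc n)) (u : Euc n → ℝ) : Prop :=
  SmoothOnNhd n u Ωᶜ ∧
  (∀ x ∈ (closure Ω)ᶜ, lapl n u x = 0) ∧
  (∀ x ∈ frontier Ω, u x = 1) ∧
  Tendsto u (cocompact (Euc n)) (𝓝 0)

end


open scoped Classical Topology
open Real Filter MeasureTheory

section VecAlg

/-- elementary symmetric function over a finset -/
noncomputable def sg {ι : Type*} (s : Finset ι) (k : ℕ) (x : ι → ℝ) : ℝ :=
  ∑ t ∈ Finset.powersetCard k s, ∏ i ∈ t, x i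

variable {ι : Type*} [DecidableEq ι]

lemma sg_zero (s : Finset ι) (x : ι → ℝ) : sg s 0 x = 1 := by
  simp [sg]

lemma sg_empty_succ {ι : Type*} (k : ℕ) (x : ι → ℝ) : sg (∅ : Finset ι) (k+1) x = 0 := by
  unfold sg
  rw [Finset.powersetCard_eq_empty.2 (by simp)]; simp

lemma sg_insert {s : Finset ι} {i : ι} (hi : i ∉ s) (k : ℕ) (x : ι → ℝ) :
    sg (insert i s) (k+1) x = x i * sg s k x + sg s (k+1) x := by
  unfold sg
  rw [Finset.powersetCard_succ_insert hi, Finset.sum_union, add_comm]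
  · congr 1
    rw [Finset.sum_image, Finset.mul_sum]
    · apply Finset.sum_congr rfl
      intro t ht
      rw [Finset.prod_insert]
      intro h
      exact hi ((Finset.mem_powersetCard.1 ht).1 h)
    · intro t ht t' ht' h
      have h1 : i ∉ t := fun h => hi ((Finset.mem_powersetCard.1 ht).1 h)
      have h2 : i ∉ t' := fun h => hi ((Finset.mem_powersetCard.1 ht').1 h)
      rw [← Finset.erase_insert h1, ← Finset.erase_insert h2, h]
  · rw [Finset.disjoint_left]
    intro t ht h
    obtain ⟨t', _, rfl⟩ := Finset.mem_image.1 h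
    exact hi ((Finset.mem_powersetCard.1 ht).1 (Finset.mem_insert_self _ _))

lemma sg_erase {s : Finset ι} {i : ι} (hi : i ∈ s) (k : ℕ) (x : ι → ℝ) :
    sg s (k+1) x = x i * sg (s.erase i) k x + sg (s.erase i) (k+1) x := by
  conv_lhs => rw [← Finset.insert_erase hi]
  exact sg_insert (Finset.notMem_erase i s) k x

lemma sg_sum (s : Finset ι) (x : ι → ℝ) : ∀ k : ℕ,
    ∑ i ∈ s, x i * sg (s.erase i) k x = (k+1) * sg s (k+1) x := by
  induction s using Finset.induction_on with
  | empty => intro k; rw [sg_empty_succ]; simp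
  | insert j s hj ih =>
    intro k
    rw [Finset.sum_insert hj, Finset.erase_insert hj, sg_insert hj]
    have h1 : ∀ i ∈ s, (insert j s).erase i = insert j (s.erase i) := by
      intro i hi
      rw [Finset.erase_insert_of_ne]
      rintro rfl; exact hj hi
    have h2 : ∀ i ∈ s, j ∉ s.erase i := fun i hi h => hj (Finset.mem_of_mem_erase h)
    cases k with
    | zero =>
      have : ∑ i ∈ s, x i * sg ((insert j s).erase i) 0 x = ∑ i ∈ s, x i * sg (s.erase i) 0 x := by
        simp [sg_zero]
      rw [this, ih]; simp [sg_zero]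
    | succ k =>
      have : ∑ i ∈ s, x i * sg ((insert j s).erase i) (k+1) x
          = x j * ∑ i ∈ s, x i * sg (s.erase i) k x + ∑ i ∈ s, x i * sg (s.erase i) (k+1) x := by
        rw [Finset.mul_sum, ← Finset.sum_add_distrib]
        apply Finset.sum_congr rfl
        intro i hi
        rw [h1 i hi, sg_insert (h2 i hi)]; ring
      rw [this, ih, ih]; push_cast; ring

/-- generating polynomial -/
noncomputable def gp {ι : Type*} (s : Finset ι) (x : ι → ℝ) : Polynomial ℝ :=
  ∏ i ∈ s, (1 + Polynomial.C (x i) * Polynomial.X)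

lemma gp_coeff (s : Finset ι) (x : ι → ℝ) : ∀ k, (gp s x).coeff k = sg s k x := by
  induction s using Finset.induction_on with
  | empty =>
    intro k
    cases k with
    | zero => simp [gp, sg]
    | succ k => rw [sg_empty_succ]; simp [gp, Polynomial.coeff_one]
  | insert j s hj ih =>
    intro k
    have : gp (insert j s) x = (1 + Polynomial.C (x j) * Polynomial.X) * gp s x := by
      simp [gp, Finset.prod_insert hj]
    rw [this, add_mul, one_mul, Polynomial.coeff_add, mul_assoc, Polynomial.coeff_C_mul]
    cases k with
    | zero => simp [ih, sg_zero]
    | succ k => rw [Polynomial.coeff_X_mul, ih, ih, sg_insert hj]; ring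

lemma gp_splits (s : Finset ι) (x : ι → ℝ) : (gp s x).Splits := by
  unfold gp
  apply Polynomial.Splits.prod
  intro i _
  apply Polynomial.Splits.of_degree_le_one
  compute_degree

lemma splits_derivative {p : Polynomial ℝ} (hp : p.Splits) : (Polynomial.derivative p).Splits := by
  rw [Polynomial.splits_iff_card_roots] at hp ⊢
  have h1 := Polynomial.card_roots_le_derivative p
  have h2 := Polynomial.natDegree_derivative_le p
  have h3 := Polynomial.card_roots' (Polynomial.derivative p)
  omega

lemma splits_iter {p : Polynomial ℝ} (hp : p.Splits) (m : ℕ) :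
    (Polynomial.derivative^[m] p).Splits := by
  induction m with
  | zero => simpa
  | succ m ih => rw [Function.iterate_succ_apply']; exact splits_derivative ih

def Lag (p : Polynomial ℝ) : Prop := ∀ t : ℝ,
  p.eval t * (Polynomial.derivative (Polynomial.derivative p)).eval t
    ≤ ((Polynomial.derivative p).eval t)^2

lemma lag_mul (a : ℝ) {q : Polynomial ℝ} (hq : Lag q) :
    Lag ((Polynomial.X - Polynomial.C a) * q) := by
  intro t
  have := hq t
  simp only [Polynomial.derivative_mul, Polynomial.derivative_sub, Polynomial.derivative_X,
    Polynomial.derivative_C, Polynomial.derivative_add, Polynomial.eval_add, Polynomial.eval_mul,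
    Polynomial.eval_sub, Polynomial.eval_X, Polynomial.eval_C, sub_zero, one_mul]
  nlinarith [mul_le_mul_of_nonneg_left this (sq_nonneg (t-a)), sq_nonneg (q.eval t)]

lemma lag_splits {p : Polynomial ℝ} (hp : p.Splits) : Lag p := by
  have key : ∀ m : Multiset ℝ,
      Lag (m.map (fun a => Polynomial.X - Polynomial.C a)).prod := by
    intro m
    induction m using Multiset.induction_on with
    | empty => intro t; simp
    | cons a m ih => rw [Multiset.map_cons, Multiset.prod_cons]; exact lag_mul a ih
  have h := Polynomial.Splits.eq_prod_roots hp
  intro t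
  have hk := key p.roots t
  rw [h]
  simp only [Polynomial.derivative_C_mul, Polynomial.eval_mul, Polynomial.eval_C]
  nlinarith [mul_le_mul_of_nonneg_left hk (sq_nonneg p.leadingCoeff)]

lemma newton (s : Finset ι) (x : ι → ℝ) (m : ℕ) :
    sg s m x * sg s (m+2) x ≤ (sg s (m+1) x)^2 := by
  have h := lag_splits (splits_iter (gp_splits s x) m) 0
  rw [← Function.iterate_succ_apply' Polynomial.derivative m,
    ← Function.iterate_succ_apply' Polynomial.derivative (m+1)] at h
  simp only [← Polynomial.coeff_zero_eq_eval_zero, Polynomial.coeff_iterate_derivative, zero_add,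
    gp_coeff, Nat.descFactorial_self, nsmul_eq_mul] at h
  have h1 : ((m+1).succ.factorial : ℝ) = (m+2) * ((m+1) * m.factorial) := by
    push_cast [Nat.factorial]; ring
  have h2 : ((m.succ).factorial : ℝ) = (m+1) * m.factorial := by
    push_cast [Nat.factorial]; ring
  rw [h1, h2] at h
  have hf : (0:ℝ) < m.factorial := by positivity
  have hm : (0:ℝ) ≤ m := by positivity
  have h3 : ((m:ℝ)+2) * (sg s m x * sg s (m+2) x) ≤ (m+1) * (sg s (m+1) x)^2 := by
    have : ((m.factorial:ℝ)^2 * (m+1)) * (((m:ℝ)+2) * (sg s m x * sg s (m+2) x))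
       ≤ ((m.factorial:ℝ)^2 * (m+1)) * ((m+1) * (sg s (m+1) x)^2) := by
      have e : m.succ.succ = m + 2 := rfl
      have e' : m.succ = m + 1 := rfl
      simp only [Nat.succ_eq_add_one] at h
      nlinarith [h]
    exact le_of_mul_le_mul_left this (by positivity)
  by_contra hc
  push Not at hc
  nlinarith [sq_nonneg (sg s (m+1) x)]

/-- Garding cone for vectors -/
def Gam {ι : Type*} (s : Finset ι) (k : ℕ) (x : ι → ℝ) : Prop := ∀ j ≤ k, 0 < sg s j x

lemma Gam.erase {s : Finset ι} {k : ℕ} {x : ι → ℝ} (h : Gam s (k+1) x) {i : ι} (hi : i ∈ s) :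
    Gam (s.erase i) k x := by
  intro j
  induction j with
  | zero => intro _; rw [sg_zero]; norm_num
  | succ m ih =>
    intro hm
    have hm1 := ih (by omega)
    have h1 := h (m+1) (by omega)
    have h2 := h (m+2) (by omega)
    rw [sg_erase hi] at h1 h2
    have hN := newton (s.erase i) x m
    by_contra hc
    push Not at hc
    have hx : 0 < x i := by
      by_contra hx; push Not at hx
      nlinarith
    nlinarith [mul_pos hm1 h2, mul_nonneg (neg_nonneg.2 hc) h1.le]

lemma par_superadd {x y q r w : ℝ} (h1 : 0 < x + q) (h2 : 0 < y + r) (hw : q + r ≤ w) :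
    x*q/(x+q) + y*r/(y+r) ≤ (x+y)*w/(x+y+w) := by
  have h3 : 0 < x + y + w := by linarith
  have e1 : x*q/(x+q) = x - x^2/(x+q) := by field_simp; ring
  have e2 : y*r/(y+r) = y - y^2/(y+r) := by field_simp; ring
  have e3 : (x+y)*w/(x+y+w) = (x+y) - (x+y)^2/(x+y+w) := by field_simp; ring
  rw [e1,e2,e3]
  have : (x+y)^2/(x+y+w) ≤ x^2/(x+q) + y^2/(y+r) := by
    calc (x+y)^2/(x+y+w) ≤ (x+y)^2/((x+q)+(y+r)) := by
          apply div_le_div_of_nonneg_left (sq_nonneg _) (by linarith) (by linarith)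
      _ ≤ _ := by
          rw [div_add_div _ _ h1.ne' h2.ne', div_le_div_iff₀ (by linarith) (by positivity)]
          nlinarith [sq_nonneg (x*(y+r) - y*(x+q)), mul_pos h1 h2]
  linarith

lemma q_superadd (k : ℕ) : ∀ (s : Finset ι) (x y : ι → ℝ), Gam s (k+1) x → Gam s (k+1) y →
    Gam s (k+1) (x+y) ∧
    sg s (k+1) x / sg s k x + sg s (k+1) y / sg s k y ≤ sg s (k+1) (x+y) / sg s k (x+y) := by
  induction k with
  | zero =>
    intro s x y hx hy
    have h1 := hx 1 le_rfl
    have h2 := hy 1 le_rfl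
    have e : sg s 1 (x+y) = sg s 1 x + sg s 1 y := by
      have := sg_sum s (x+y) 0
      have hx := sg_sum s x 0
      have hy := sg_sum s y 0
      simp [sg_zero, Finset.sum_add_distrib] at this hx hy
      linarith
    refine ⟨?_, ?_⟩
    · intro j hj
      interval_cases j
      · rw [sg_zero]; norm_num
      · rw [e]; linarith
    · simp [sg_zero, e]
  | succ k ih =>
    intro s x y hx hy
    have hx' : Gam s (k+1) x := fun j hj => hx j (by omega)
    have hy' : Gam s (k+1) y := fun j hj => hy j (by omega)
    obtain ⟨hG, -⟩ := ih s x y hx' hy'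
    have repr : ∀ z : ι → ℝ, Gam s (k+1) z → (∀ i ∈ s, Gam (s.erase i) (k+1) z) →
        sg s (k+2) z / sg s (k+1) z = (1/((k:ℝ)+2)) * ∑ i ∈ s,
          z i * (sg (s.erase i) (k+1) z / sg (s.erase i) k z)
            / (z i + sg (s.erase i) (k+1) z / sg (s.erase i) k z) := by
      intro z hz hzi
      have h0 := hz (k+1) le_rfl
      have hs := sg_sum s z (k+1)
      have : ∀ i ∈ s, z i * (sg (s.erase i) (k+1) z / sg (s.erase i) k z)
            / (z i + sg (s.erase i) (k+1) z / sg (s.erase i) k z)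
            = z i * sg (s.erase i) (k+1) z / sg s (k+1) z := by
        intro i hi
        have a := hzi i hi k (by omega)
        have b := sg_erase hi k z
        have : z i + sg (s.erase i) (k+1) z / sg (s.erase i) k z = sg s (k+1) z / sg (s.erase i) k z := by
          rw [b]; field_simp
        rw [this]; field_simp
      rw [Finset.sum_congr rfl this, ← Finset.sum_div, hs]
      push_cast
      field_simp
      ring
    have hxi : ∀ i ∈ s, Gam (s.erase i) (k+1) x := fun i hi => hx.erase hi
    have hyi : ∀ i ∈ s, Gam (s.erase i) (k+1) y := fun i hi => hy.erase hi
    have hxyi : ∀ i ∈ s, Gam (s.erase i) (k+1) (x+y) := fun i hi =>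
      (ih _ x y (hxi i hi) (hyi i hi)).1
    have pos : ∀ z : ι → ℝ, Gam s (k+1) z → ∀ i ∈ s, Gam (s.erase i) (k+1) z →
        0 < z i + sg (s.erase i) (k+1) z / sg (s.erase i) k z := by
      intro z hz i hi hzi
      have a := hzi k (by omega)
      have b := sg_erase hi k z
      have h0 := hz (k+1) le_rfl
      have : z i + sg (s.erase i) (k+1) z / sg (s.erase i) k z = sg s (k+1) z / sg (s.erase i) k z := by
        rw [b]; field_simp
      rw [this]; positivity
    have main : sg s (k+2) x / sg s (k+1) x + sg s (k+2) y / sg s (k+1) y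
        ≤ sg s (k+2) (x+y) / sg s (k+1) (x+y) := by
      rw [repr x hx' hxi, repr y hy' hyi, repr (x+y) hG hxyi, ← mul_add, ← Finset.sum_add_distrib]
      apply mul_le_mul_of_nonneg_left _ (by positivity)
      apply Finset.sum_le_sum
      intro i hi
      exact par_superadd (pos x hx' i hi (hxi i hi)) (pos y hy' i hi (hyi i hi))
        (ih _ x y (hxi i hi) (hyi i hi)).2
    refine ⟨?_, main⟩
    intro j hj
    rcases Nat.lt_or_ge j (k+2) with h | h
    · exact hG j (by omega)
    · have : j = k+2 := by omega
      subst this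
      have a := hG (k+1) le_rfl
      have b : 0 < sg s (k+2) x / sg s (k+1) x := div_pos (hx _ le_rfl) (hx _ (by omega))
      have c : 0 < sg s (k+2) y / sg s (k+1) y := div_pos (hy _ le_rfl) (hy _ (by omega))
      have d : 0 < sg s (k+2) (x+y) / sg s (k+1) (x+y) := by linarith
      by_contra hc
      push Not at hc
      have := div_nonpos_of_nonpos_of_nonneg hc a.le
      linarith

end VecAlg

open scoped Classical Topology
open Real Filter MeasureTheory

lemma deriv_nonneg_of_right {g : ℝ → ℝ} {g' : ℝ} (h : HasDerivAt g g' 0) (h0 : g 0 = 0)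
    {d : ℝ} (hd : 0 < d) (hg : ∀ t, 0 < t → t < d → 0 ≤ g t) : 0 ≤ g' := by
  have h1 := h.tendsto_slope_zero_right
  refine ge_of_tendsto h1 ?_
  filter_upwards [Ioo_mem_nhdsGT hd] with t ht
  simp only [zero_add, h0, sub_zero, smul_eq_mul]
  exact mul_nonneg (inv_nonneg.2 ht.1.le) (hg t ht.1 ht.2)

section VecAlg2
variable {ι : Type*} [DecidableEq ι]

lemma sg_hasDeriv (s : Finset ι) (x y : ι → ℝ) :
    (HasDerivAt (fun t : ℝ => sg s 0 (x + t • y)) 0 0) ∧ ∀ k, HasDerivAt (fun t : ℝ => sg s (k+1) (x + t • y))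
      (∑ i ∈ s, y i * sg (s.erase i) k x) 0 := by
  refine ⟨by simpa [sg_zero] using hasDerivAt_const (0:ℝ) (1:ℝ), ?_⟩
  induction s using Finset.induction_on with
  | empty => intro k; simpa [sg_empty_succ] using hasDerivAt_const (0:ℝ) (0:ℝ)
  | insert j s hj ih =>
    intro k
    have h1 : ∀ i ∈ s, (insert j s).erase i = insert j (s.erase i) := by
      intro i hi
      rw [Finset.erase_insert_of_ne]
      rintro rfl; exact hj hi
    have h2 : ∀ i ∈ s, j ∉ s.erase i := fun i hi h => hj (Finset.mem_of_mem_erase h)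
    have hl : HasDerivAt (fun t : ℝ => (x + t • y) j) (y j) 0 := by
      simpa using ((hasDerivAt_id (0:ℝ)).mul_const (y j)).const_add (x j)
    have hz : (x + (0:ℝ) • y) = x := by simp
    simp only [sg_insert hj]
    rw [Finset.sum_insert hj, Finset.erase_insert hj]
    cases k with
    | zero =>
      have := (hl.mul (hasDerivAt_const (0:ℝ) (1:ℝ))).add (ih 0)
      have e : (fun t : ℝ => (x + t • y) j * sg s 0 (x + t • y) + sg s (0+1) (x + t • y))
        = (fun t : ℝ => (x + t • y) j) * (fun _ => (1:ℝ)) + (fun t : ℝ => sg s (0+1) (x + t • y)) := by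
        funext t; simp [sg_zero]
      rw [e]
      refine this.congr_deriv ?_
      have : ∀ (s : Finset ι) , sg s 0 x = 1 := fun s => sg_zero s x
      simp [this]
    | succ k =>
      have := (hl.mul (ih k)).add (ih (k+1))
      refine this.congr_deriv ?_
      rw [hz]
      have : ∑ i ∈ s, y i * sg ((insert j s).erase i) (k+1) x
          = x j * ∑ i ∈ s, y i * sg (s.erase i) k x + ∑ i ∈ s, y i * sg (s.erase i) (k+1) x := by
        rw [Finset.mul_sum, ← Finset.sum_add_distrib]
        apply Finset.sum_congr rfl
        intro i hi
        rw [h1 i hi, sg_insert (h2 i hi)]; ring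
      rw [this]; ring

lemma sg_smul (s : Finset ι) (k : ℕ) (t : ℝ) (y : ι → ℝ) : sg s k (t • y) = t^k * sg s k y := by
  unfold sg
  rw [Finset.mul_sum]
  apply Finset.sum_congr rfl
  intro u hu
  simp [Finset.prod_mul_distrib, (Finset.mem_powersetCard.1 hu).2]

lemma one_add_sum_le_prod (m : ℕ) (r : ℕ → ℝ) (hr : ∀ j, j < m → 0 ≤ r j) :
    1 + ∑ j ∈ Finset.range m, r j ≤ ∏ j ∈ Finset.range m, (1 + r j) := by
  induction m with
  | zero => simp
  | succ m ih =>
    rw [Finset.sum_range_succ, Finset.prod_range_succ]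
    have := ih (fun j hj => hr j (by omega))
    have h1 := hr m (by omega)
    have h2 : 0 ≤ ∑ j ∈ Finset.range m, r j :=
      Finset.sum_nonneg (fun j hj => hr j (by have := Finset.mem_range.1 hj; omega))
    nlinarith [mul_nonneg h1 h2]

lemma sg_prod {s : Finset ι} {k : ℕ} {x : ι → ℝ} (h : Gam s k x) :
    ∏ j ∈ Finset.range k, sg s (j+1) x / sg s j x = sg s k x := by
  have : ∀ m ≤ k, ∏ j ∈ Finset.range m, sg s (j+1) x / sg s j x = sg s m x := by
    intro m
    induction m with
    | zero => intro _; simp [sg_zero]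
    | succ m ih =>
      intro hm
      rw [Finset.prod_range_succ, ih (by omega)]
      have := h m (by omega)
      field_simp
  exact this k le_rfl

lemma vec_ineq {s : Finset ι} {k : ℕ} {x y : ι → ℝ} (hx : Gam s (k+1) x) (hy : Gam s (k+1) y)
    (hxy : sg s (k+1) x ≤ sg s (k+1) y) :
    (k+1) * sg s (k+1) x ≤ ∑ i ∈ s, y i * sg (s.erase i) k x := by
  have hd := (sg_hasDeriv s x y).2 k
  have hx0 := hx (k+1) le_rfl
  have hd2 : HasDerivAt (fun t : ℝ => sg s (k+1) (x + t • y) - sg s (k+1) x * (1 + t * (k+1)))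
      ((∑ i ∈ s, y i * sg (s.erase i) k x) - sg s (k+1) x * (k+1)) 0 := by
    refine hd.sub ?_
    have := (((hasDerivAt_id (0:ℝ)).mul_const ((k:ℝ)+1)).const_add 1).const_mul (sg s (k+1) x)
    simpa using this
  have := deriv_nonneg_of_right hd2 (by simp) zero_lt_one ?_
  · linarith
  intro t ht _
  have hty : Gam s (k+1) (t • y) := by
    intro j hj
    rw [sg_smul]
    exact mul_pos (pow_pos ht j) (hy j hj)
  have hG : Gam s (k+1) (x + t • y) := (q_superadd k s x (t•y) hx hty).1
  set X : ℕ → ℝ := fun j => sg s (j+1) x / sg s j x with hX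
  set Y : ℕ → ℝ := fun j => sg s (j+1) y / sg s j y with hY
  have hXp : ∀ j, j < k+1 → 0 < X j := fun j hj => div_pos (hx _ (by omega)) (hx _ (by omega))
  have hYp : ∀ j, j < k+1 → 0 < Y j := fun j hj => div_pos (hy _ (by omega)) (hy _ (by omega))
  have h1 : ∏ j ∈ Finset.range (k+1), (X j * (1 + t * (Y j / X j))) ≤ sg s (k+1) (x + t•y) := by
    rw [← sg_prod hG]
    apply Finset.prod_le_prod
    · intro j hj
      have hj' := Finset.mem_range.1 hj
      have := hXp j hj'; have := hYp j hj'; positivity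
    · intro j hj
      have hj' := Finset.mem_range.1 hj
      have a := hXp j hj'
      have b := (q_superadd j s x (t•y) (fun i hi => hx i (by omega)) (fun i hi => hty i (by omega))).2
      have c : sg s (j+1) (t•y) / sg s j (t•y) = t * Y j := by
        rw [sg_smul, sg_smul, hY]
        have := hy j (by omega)
        field_simp
        ring
      rw [c] at b
      calc X j * (1 + t * (Y j / X j)) = X j + t * Y j := by field_simp
        _ ≤ _ := b
  rw [Finset.prod_mul_distrib, sg_prod hx] at h1
  have h2 := one_add_sum_le_prod (k+1) (fun j => t * (Y j / X j)) (fun j hj => by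
    have := hXp j hj; have := hYp j hj; positivity)
  have h3 : (k+1 : ℝ) ≤ ∑ j ∈ Finset.range (k+1), Y j / X j := by
    have hl : ∑ j ∈ Finset.range (k+1), Real.log (Y j / X j) = Real.log (sg s (k+1) y / sg s (k+1) x) := by
      rw [← Real.log_prod, Finset.prod_div_distrib, sg_prod hx, sg_prod hy]
      intro j hj
      have hj' := Finset.mem_range.1 hj
      exact (div_pos (hYp j hj') (hXp j hj')).ne'
    have hl2 : 0 ≤ Real.log (sg s (k+1) y / sg s (k+1) x) := by
      apply Real.log_nonneg
      rw [le_div_iff₀ hx0]; linarith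
    have : ∑ j ∈ Finset.range (k+1), Real.log (Y j / X j) ≤ ∑ j ∈ Finset.range (k+1), (Y j / X j - 1) := by
      apply Finset.sum_le_sum
      intro j hj
      have hj' := Finset.mem_range.1 hj
      exact Real.log_le_sub_one_of_pos (div_pos (hYp j hj') (hXp j hj'))
    rw [Finset.sum_sub_distrib] at this
    simp at this
    linarith
  rw [← Finset.mul_sum] at h2
  have h4 : 1 + t * (k+1) ≤ ∏ j ∈ Finset.range (k+1), (1 + t * (Y j / X j)) := by
    nlinarith
  have := mul_le_mul_of_nonneg_left h4 hx0.le
  linarith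

end VecAlg2

/-- bilinear form of a matrix -/
noncomputable def qf {n : ℕ} (N : Matrix (Fin n) (Fin n) ℝ) (v w : Euc n) : ℝ :=
  ∑ a, ∑ b, v a * N a b * w b

lemma prod_coeff_sg {ι : Type*} [DecidableEq ι] (s : Finset ι) (r : ι → ℝ) {j : ℕ} (hj : j ≤ s.card) :
    (∏ i ∈ s, (Polynomial.X - Polynomial.C (r i))).coeff (s.card - j) = (-1)^j * sg s j r := by
  have h := Finset.prod_X_add_C_coeff s (fun i => - r i) (k := s.card - j) (by omega)
  simp only [Polynomial.C_neg, ← sub_eq_add_neg] at h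
  rw [h, Nat.sub_sub_self hj]
  unfold sg
  rw [Finset.mul_sum]
  apply Finset.sum_congr rfl
  intro t ht
  rw [Finset.prod_neg, (Finset.mem_powersetCard.1 ht).2]

lemma matSk_eq_sg {n j : ℕ} (hj : j ≤ n) {M : Matrix (Fin n) (Fin n) ℝ} (hM : M.IsHermitian) :
    matSk n j M = sg Finset.univ j hM.eigenvalues := by
  unfold matSk
  rw [hM.charpoly_eq]
  have := prod_coeff_sg (Finset.univ : Finset (Fin n)) hM.eigenvalues (j := j) (by simpa)
  simp only [Finset.card_univ, Fintype.card_fin] at this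
  simp only [RCLike.ofReal_real_eq_id, id]
  rw [this, ← mul_assoc, ← mul_pow]; simp

lemma qf_eigen {n : ℕ} {M : Matrix (Fin n) (Fin n) ℝ} (hM : M.IsHermitian) (i : Fin n) (v : Euc n) :
    qf M v (hM.eigenvectorBasis i) = hM.eigenvalues i * inner ℝ v (hM.eigenvectorBasis i) := by
  have h := hM.mulVec_eigenvectorBasis i
  have h2 : ∀ a, ∑ b, M a b * hM.eigenvectorBasis i b = hM.eigenvalues i * hM.eigenvectorBasis i a := by
    intro a
    have := congrFun h a
    simpa [Matrix.mulVec, dotProduct] using this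
  unfold qf
  simp only [mul_assoc, ← Finset.mul_sum, h2]
  rw [PiLp.inner_apply, Finset.mul_sum]
  apply Finset.sum_congr rfl
  intro a _
  simp; ring

lemma qf_sum_right {n : ℕ} (N : Matrix (Fin n) (Fin n) ℝ) (v : Euc n) {ι : Type*} (s : Finset ι)
    (c : ι → ℝ) (w : ι → Euc n) : qf N v (∑ i ∈ s, c i • w i) = ∑ i ∈ s, c i * qf N v (w i) := by
  induction s using Finset.induction_on with
  | empty => simp [qf]
  | insert j s hj ih =>
    rw [Finset.sum_insert hj, Finset.sum_insert hj, ← ih]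
    unfold qf
    rw [Finset.mul_sum, ← Finset.sum_add_distrib]
    apply Finset.sum_congr rfl
    intro p _
    rw [Finset.mul_sum, ← Finset.sum_add_distrib]
    apply Finset.sum_congr rfl
    intro q _
    simp only [PiLp.add_apply, PiLp.smul_apply, smul_eq_mul]
    ring

lemma qf_diag {n : ℕ} {N : Matrix (Fin n) (Fin n) ℝ} (hN : N.IsHermitian) (v : Euc n) :
    qf N v v = ∑ j, (inner ℝ v (hN.eigenvectorBasis j))^2 * hN.eigenvalues j := by
  have h : qf N v v = qf N v (∑ j, inner ℝ (hN.eigenvectorBasis j) v • hN.eigenvectorBasis j) := by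
    rw [hN.eigenvectorBasis.sum_repr' v]
  rw [h, qf_sum_right]
  apply Finset.sum_congr rfl
  intro j _
  rw [qf_eigen, real_inner_comm]; ring

def MGam (n k : ℕ) (M : Matrix (Fin n) (Fin n) ℝ) : Prop := ∀ j, 1 ≤ j → j ≤ k → 0 < matSk n j M

lemma MGam.gam {n k : ℕ} (hkn : k ≤ n) {M : Matrix (Fin n) (Fin n) ℝ} (hM : M.IsHermitian)
    (h : MGam n k M) : Gam Finset.univ k hM.eigenvalues := by
  intro j hj
  rcases Nat.eq_zero_or_pos j with rfl | h0
  · rw [sg_zero]; norm_num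
  · rw [← matSk_eq_sg (by omega) hM]; exact h j h0 hj

lemma sg_perm {n : ℕ} (j : ℕ) (x : Fin n → ℝ) (e : Equiv.Perm (Fin n)) :
    sg Finset.univ j (x ∘ e) = sg Finset.univ j x := by
  have := gp_coeff Finset.univ (x ∘ e) j
  rw [← this, ← gp_coeff Finset.univ x j]
  congr 1
  unfold gp
  exact Equiv.prod_comp e (fun i => (1 + Polynomial.C (x i) * Polynomial.X))

theorem alg {n k : ℕ} (hkn : k + 1 ≤ n) {M : Matrix (Fin n) (Fin n) ℝ} (hM : M.IsHermitian)
    (hG : MGam n (k+1) M) :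
    ∃ (f : OrthonormalBasis (Fin n) ℝ (Euc n)) (w lam : Fin n → ℝ), (∀ i, 0 < w i) ∧
      (∀ i v, qf M v (f i) = lam i * inner ℝ v (f i)) ∧
      (∑ i, w i * lam i = (k+1) * matSk n (k+1) M) ∧
      ∀ N : Matrix (Fin n) (Fin n) ℝ, N.IsHermitian → MGam n (k+1) N →
        matSk n (k+1) M ≤ matSk n (k+1) N →
        (k+1) * matSk n (k+1) M ≤ ∑ i, w i * qf N (f i) (f i) := by
  have hGx := hG.gam hkn hM
  refine ⟨hM.eigenvectorBasis, fun i => sg (Finset.univ.erase i) k hM.eigenvalues, hM.eigenvalues,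
    ?_, ?_, ?_, ?_⟩
  · intro i
    exact hGx.erase (Finset.mem_univ i) k le_rfl
  · intro i v; exact qf_eigen hM i v
  · rw [matSk_eq_sg hkn hM, ← sg_sum]
    apply Finset.sum_congr rfl
    intro i _; ring
  · intro N hN hGN hle
    have hGy := hGN.gam hkn hN
    rw [matSk_eq_sg hkn hM, matSk_eq_sg hkn hN] at hle
    rw [matSk_eq_sg hkn hM]
    set D : Matrix (Fin n) (Fin n) ℝ := Matrix.of fun i j =>
      (inner ℝ (hM.eigenvectorBasis i) (hN.eigenvectorBasis j))^2 with hD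
    have hDS : D ∈ doublyStochastic ℝ (Fin n) := by
      rw [mem_doublyStochastic_iff_sum]
      refine ⟨fun i j => sq_nonneg _, ?_, ?_⟩
      · intro i
        have := hN.eigenvectorBasis.sum_sq_inner_left (hM.eigenvectorBasis i)
        simpa [hD] using this
      · intro i
        have := hM.eigenvectorBasis.sum_sq_inner_right (hN.eigenvectorBasis i)
        simpa [hD] using this
    obtain ⟨c, hc0, hc1, hcD⟩ := exists_eq_sum_perm_of_mem_doublyStochastic hDS
    have hq : ∀ i, qf N (hM.eigenvectorBasis i) (hM.eigenvectorBasis i)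
        = ∑ σ : Equiv.Perm (Fin n), c σ * hN.eigenvalues (σ i) := by
      intro i
      rw [qf_diag hN]
      have : ∀ j, (inner ℝ (hM.eigenvectorBasis i) (hN.eigenvectorBasis j))^2
          = ∑ σ : Equiv.Perm (Fin n), c σ * (if σ i = j then 1 else 0) := by
        intro j
        have := congrFun (congrFun hcD i) j
        rw [Matrix.sum_apply] at this
        simp only [hD, Matrix.of_apply] at this
        rw [← this]
        apply Finset.sum_congr rfl
        intro σ _
        simp [Equiv.Perm.permMatrix, PEquiv.toMatrix_apply, Equiv.toPEquiv_apply, eq_comm]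
      simp only [this, Finset.sum_mul]
      rw [Finset.sum_comm]
      apply Finset.sum_congr rfl
      intro σ _
      simp
    simp only [hq, Finset.mul_sum]
    rw [Finset.sum_comm]
    have key : ∀ σ : Equiv.Perm (Fin n), (k+1) * sg Finset.univ (k+1) hM.eigenvalues
        ≤ ∑ i, hN.eigenvalues (σ i) * sg (Finset.univ.erase i) k hM.eigenvalues := by
      intro σ
      have hp : Gam Finset.univ (k+1) (hN.eigenvalues ∘ σ) := by
        intro j hj
        rw [sg_perm]; exact hGy j hj
      exact vec_ineq hGx hp (hle.trans_eq (sg_perm _ _ σ).symm)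
    calc (k+1) * sg Finset.univ (k+1) hM.eigenvalues
        = ∑ σ : Equiv.Perm (Fin n), c σ * ((k+1) * sg Finset.univ (k+1) hM.eigenvalues) := by
          rw [← Finset.sum_mul, hc1, one_mul]
      _ ≤ ∑ σ : Equiv.Perm (Fin n), c σ * ∑ i, hN.eigenvalues (σ i) * sg (Finset.univ.erase i) k hM.eigenvalues :=
          Finset.sum_le_sum (fun σ _ => mul_le_mul_of_nonneg_left (key σ) (hc0 σ))
      _ = _ := by
          apply Finset.sum_congr rfl
          intro σ _
          rw [Finset.mul_sum]
          apply Finset.sum_congr rfl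
          intro i _
          ring

open scoped Classical Topology
open Real Filter MeasureTheory

/-- diagonal plus rank one -/
noncomputable def R1 {n : ℕ} (d : Fin n → ℝ) (β : ℝ) (v : Fin n → ℝ) : Matrix (Fin n) (Fin n) ℝ :=
  Matrix.of fun p q => (if p = q then d p else 0) + β * v p * v q

lemma R1_herm {n : ℕ} (d : Fin n → ℝ) (β : ℝ) (v : Fin n → ℝ) : (R1 d β v).IsHermitian := by
  ext p q
  simp only [R1, Matrix.conjTranspose_apply, Matrix.of_apply, star_trivial]
  by_cases h : p = q
  · subst h; simp
  · simp [h, Ne.symm h]; ring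

lemma det_R1 {n : ℕ} (d : Fin n → ℝ) (β : ℝ) (v : Fin n → ℝ) (hd : ∀ i, d i ≠ 0) :
    (R1 d β v).det = ∏ i, d i + β * ∑ i, v i ^ 2 * ∏ l ∈ Finset.univ.erase i, d l := by
  have h : R1 d β v = Matrix.diagonal d *
      (1 + Matrix.replicateCol Unit (fun i => β * v i / d i) * Matrix.replicateRow Unit v) := by
    ext p q
    rw [Matrix.diagonal_mul]
    simp only [R1, Matrix.of_apply, Matrix.add_apply, Matrix.one_apply, Matrix.mul_apply,
      Matrix.replicateCol_apply, Matrix.replicateRow_apply, Finset.univ_unique, Finset.sum_singleton]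
    have := hd p
    by_cases h : p = q
    · simp [h]; have := hd q; field_simp
    · simp [h]; field_simp
  rw [h, Matrix.det_mul, Matrix.det_diagonal, Matrix.det_one_add_replicateCol_mul_replicateRow, mul_add, mul_one]
  congr 1
  rw [dotProduct, Finset.mul_sum, Finset.mul_sum]
  apply Finset.sum_congr rfl
  intro i _
  rw [← Finset.mul_prod_erase Finset.univ d (Finset.mem_univ i)]
  have := hd i
  field_simp

lemma charpoly_R1 {n : ℕ} (d : Fin n → ℝ) (β : ℝ) (v : Fin n → ℝ) :
    (R1 d β v).charpoly = ∏ i, (Polynomial.X - Polynomial.C (d i)) -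
      Polynomial.C β * ∑ i, Polynomial.C (v i ^ 2) * ∏ l ∈ Finset.univ.erase i, (Polynomial.X - Polynomial.C (d l)) := by
  apply Polynomial.eq_of_infinite_eval_eq
  have hfin : (Set.range d)ᶜ.Infinite := (Set.finite_range d).infinite_compl
  apply hfin.mono
  intro t ht
  have ht' : ∀ i, t - d i ≠ 0 := by
    intro i h
    exact ht ⟨i, by linarith⟩
  simp only [Set.mem_setOf_eq]
  rw [Matrix.eval_charpoly]
  have : (Matrix.scalar (Fin n) t - R1 d β v) = R1 (fun i => t - d i) (-β) v := by
    ext p q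
    simp only [R1, Matrix.sub_apply, Matrix.of_apply, Matrix.scalar_apply, Matrix.diagonal_apply]
    by_cases h : p = q
    · simp [h]; ring
    · simp [h]
  rw [this, det_R1 _ _ _ ht']
  simp only [Polynomial.eval_sub, Polynomial.eval_mul, Polynomial.eval_C, Polynomial.eval_finset_sum,
    Polynomial.eval_prod, Polynomial.eval_X]
  ring

lemma matSk_R1 {n j : ℕ} (hj : j + 1 ≤ n) (d : Fin n → ℝ) (β : ℝ) (v : Fin n → ℝ) :
    matSk n (j+1) (R1 d β v) = sg Finset.univ (j+1) d + β * ∑ i, v i ^ 2 * sg (Finset.univ.erase i) j d := by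
  unfold matSk
  rw [charpoly_R1, Polynomial.coeff_sub, Polynomial.coeff_C_mul, Polynomial.finsetSum_coeff]
  have h1 := prod_coeff_sg (Finset.univ : Finset (Fin n)) d (j := j+1) (by simpa)
  simp only [Finset.card_univ, Fintype.card_fin] at h1
  rw [h1]
  have h2 : ∀ i : Fin n, (Polynomial.C (v i ^ 2) * ∏ l ∈ Finset.univ.erase i, (Polynomial.X - Polynomial.C (d l))).coeff (n - (j+1))
      = v i ^ 2 * ((-1)^j * sg (Finset.univ.erase i) j d) := by
    intro i
    rw [Polynomial.coeff_C_mul]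
    have hc : (Finset.univ.erase i : Finset (Fin n)).card = n - 1 := by
      rw [Finset.card_erase_of_mem (Finset.mem_univ i)]; simp
    have := prod_coeff_sg (Finset.univ.erase i : Finset (Fin n)) d (j := j) (by omega)
    rw [hc, show n - 1 - j = n - (j+1) by omega] at this
    rw [this]
  simp only [h2]
  have e : ((-1:ℝ)^(j+1)) * (-1)^(j+1) = 1 := by rw [← mul_pow]; simp
  have e2 : ((-1:ℝ)^j) * (-1)^j = 1 := by rw [← mul_pow]; simp
  rw [mul_sub, ← mul_assoc, e, one_mul, Finset.mul_sum, Finset.mul_sum, Finset.mul_sum, sub_eq_add_neg, ← Finset.sum_neg_distrib]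
  congr 1
  apply Finset.sum_congr rfl
  intro i _
  have : -((-1:ℝ) ^ (j + 1) * (β * (v i ^ 2 * ((-1) ^ j * sg (Finset.univ.erase i) j d)))) =
    ((-1)^j * (-1)^j) * (β * (v i ^ 2 * sg (Finset.univ.erase i) j d)) := by ring
  rw [this, e2, one_mul]

lemma sg_pos {ι : Type*} [DecidableEq ι] {s : Finset ι} {k : ℕ} {x : ι → ℝ} (hk : k ≤ s.card) (hx : ∀ i, 0 < x i) :
    0 < sg s k x := by
  unfold sg
  apply Finset.sum_pos
  · intro t _; exact Finset.prod_pos (fun i _ => hx i)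
  · exact Finset.powersetCard_nonempty.2 hk

lemma sg_nonneg {ι : Type*} {s : Finset ι} {k : ℕ} {x : ι → ℝ} (hx : ∀ i, 0 < x i) :
    0 ≤ sg s k x := by
  unfold sg
  apply Finset.sum_nonneg
  intro t _; exact Finset.prod_nonneg (fun i _ => (hx i).le)

lemma sg_ratio {ι : Type*} [DecidableEq ι] {s : Finset ι} {x : ι → ℝ} (hx : ∀ i, 0 < x i) (j : ℕ) :
    ∀ m, j + m ≤ s.card → sg s j x * sg s (j + m + 1) x ≤ sg s (j+1) x * sg s (j+m) x := by
  intro m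
  induction m with
  | zero => intro _; simp; linarith [mul_comm (sg s j x) (sg s (j+1) x)]
  | succ m ih =>
    intro h
    have h1 := ih (by omega)
    have h2 := newton s x (j+m)
    have p1 : 0 < sg s (j+m) x := sg_pos (by omega) hx
    have p2 : 0 < sg s (j+m+1) x := sg_pos (by omega) hx
    have p3 : 0 < sg s j x := sg_pos (by omega) hx
    rw [show j + (m+1) = j + m + 1 by omega, show j + m + 1 + 1 = j + m + 2 by omega]
    apply le_of_mul_le_mul_left _ p1
    calc sg s (j+m) x * (sg s j x * sg s (j+m+2) x) = sg s j x * (sg s (j+m) x * sg s (j+m+2) x) := by ring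
      _ ≤ sg s j x * (sg s (j+m+1) x)^2 := mul_le_mul_of_nonneg_left h2 p3.le
      _ = (sg s j x * sg s (j+m+1) x) * sg s (j+m+1) x := by ring
      _ ≤ (sg s (j+1) x * sg s (j+m) x) * sg s (j+m+1) x := mul_le_mul_of_nonneg_right h1 p2.le
      _ = _ := by ring

lemma sg_cmp {n k j : ℕ} (hk : k + 1 ≤ n) (hj : j ≤ k) {a : Fin n → ℝ} (ha : ∀ i, 0 < a i) (i : Fin n) :
    sg (Finset.univ.erase i) j a * sg Finset.univ (k+1) a ≤ sg Finset.univ (j+1) a * sg (Finset.univ.erase i) k a := by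
  have hc : (Finset.univ.erase i : Finset (Fin n)).card = n - 1 := by
    rw [Finset.card_erase_of_mem (Finset.mem_univ i)]; simp
  have := sg_ratio (s := Finset.univ.erase i) ha j (k - j) (by omega)
  rw [show j + (k-j) = k by omega] at this
  rw [sg_erase (Finset.mem_univ i) k, sg_erase (Finset.mem_univ i) j]
  linarith

lemma matSk_bar {n j : ℕ} (hj : j + 1 ≤ n) (a X : Fin n → ℝ) (g g' : ℝ) :
    matSk n (j+1) (R1 (g • a) g' (fun i => a i * X i)) =
      g^j * (g * sg Finset.univ (j+1) a + g' * ∑ i, a i * X i ^2 * (a i * sg (Finset.univ.erase i) j a)) := by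
  rw [matSk_R1 hj]
  simp only [sg_smul]
  rw [mul_add]
  congr 1
  · ring
  · rw [mul_left_comm]
    congr 1
    rw [Finset.mul_sum]
    apply Finset.sum_congr rfl
    intro i _; ring

theorem barrier {n k : ℕ} (hk : k + 1 ≤ n) {a X : Fin n → ℝ} (ha : ∀ i, 0 < a i) {g g' h t : ℝ}
    (hg : 0 < g) (hg' : g' ≤ 0) (hh : ∀ i, a i * sg (Finset.univ.erase i) k a ≤ h)
    (ht : ∑ i, a i * X i ^ 2 = 2 * t)
    (hpos : 0 < g * sg Finset.univ (k+1) a + 2 * t * g' * h) :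
    MGam n (k+1) (R1 (g • a) g' (fun i => a i * X i)) ∧
      g^k * (g * sg Finset.univ (k+1) a + 2 * t * g' * h) ≤ matSk n (k+1) (R1 (g • a) g' (fun i => a i * X i)) := by
  have hσ : 0 < sg Finset.univ (k+1) a := sg_pos (by simpa) ha
  have key : ∀ j ≤ k, g^j * (sg Finset.univ (j+1) a / sg Finset.univ (k+1) a * (g * sg Finset.univ (k+1) a + 2 * t * g' * h))
      ≤ matSk n (j+1) (R1 (g • a) g' (fun i => a i * X i)) := by
    intro j hj
    rw [matSk_bar (by omega)]
    apply mul_le_mul_of_nonneg_left _ (pow_nonneg hg.le j)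
    have hσj : 0 < sg Finset.univ (j+1) a := sg_pos (by simp; omega) ha
    have h1 : ∑ i, a i * X i ^2 * (a i * sg (Finset.univ.erase i) j a) ≤
        ∑ i, a i * X i ^2 * (sg Finset.univ (j+1) a / sg Finset.univ (k+1) a * h) := by
      apply Finset.sum_le_sum
      intro i _
      apply mul_le_mul_of_nonneg_left
      · rw [div_mul_eq_mul_div, le_div_iff₀ hσ]
        have := sg_cmp hk hj ha i
        calc a i * sg (Finset.univ.erase i) j a * sg Finset.univ (k+1) a
            = a i * (sg (Finset.univ.erase i) j a * sg Finset.univ (k+1) a) := by ring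
          _ ≤ a i * (sg Finset.univ (j+1) a * sg (Finset.univ.erase i) k a) :=
              mul_le_mul_of_nonneg_left this (ha i).le
          _ = sg Finset.univ (j+1) a * (a i * sg (Finset.univ.erase i) k a) := by ring
          _ ≤ _ := mul_le_mul_of_nonneg_left (hh i) hσj.le
      · have := ha i; positivity
    rw [← Finset.sum_mul, ht] at h1
    have h2 := mul_le_mul_of_nonpos_left h1 hg'
    have h3 : sg Finset.univ (j+1) a / sg Finset.univ (k+1) a * (g * sg Finset.univ (k+1) a + 2 * t * g' * h)
      = g * sg Finset.univ (j+1) a + g' * (2 * t * (sg Finset.univ (j+1) a / sg Finset.univ (k+1) a * h)) := by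
      field_simp
    rw [h3]; linarith
  constructor
  · intro j h1 h2
    obtain ⟨i, rfl⟩ : ∃ i, j = i + 1 := ⟨j - 1, by omega⟩
    refine lt_of_lt_of_le ?_ (key i (by omega))
    have hσj : 0 < sg Finset.univ (i+1) a := sg_pos (by simp; omega) ha
    positivity
  · have := key k le_rfl
    rwa [div_self hσ.ne', one_mul] at this

lemma sg_ones {ι : Type*} (s : Finset ι) (k : ℕ) : sg s k (fun _ => (1:ℝ)) = (s.card.choose k : ℝ) := by
  unfold sg; simp

/-- monotone bound used for the double normal estimate -/
lemma R1_upper {n k : ℕ} (hk : k + 1 ≤ n) {a X : Fin n → ℝ} (ha : ∀ i, 0 < a i) {g β m t : ℝ}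
    (hg : 0 < g) (hβ : 0 ≤ β) (hm : ∀ i, m ≤ a i * sg (Finset.univ.erase i) k a)
    (ht : ∑ i, a i * X i ^ 2 = 2 * t) :
    MGam n (k+1) (R1 (g • a) β (fun i => a i * X i)) ∧
     g^k * (β * (2 * t * m)) ≤ matSk n (k+1) (R1 (g • a) β (fun i => a i * X i)) := by
  constructor
  · intro j h1 h2
    obtain ⟨i, rfl⟩ : ∃ i, j = i + 1 := ⟨j - 1, by omega⟩
    rw [matSk_bar (by omega)]
    have hσj : 0 < sg Finset.univ (i+1) a := sg_pos (by simp; omega) ha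
    have : 0 ≤ ∑ p, a p * X p ^2 * (a p * sg (Finset.univ.erase p) i a) := by
      apply Finset.sum_nonneg
      intro p _
      have := ha p; have := sg_nonneg (s := Finset.univ.erase p) (k := i) ha
      positivity
    positivity
  · rw [matSk_bar hk]
    apply mul_le_mul_of_nonneg_left _ (pow_nonneg hg.le k)
    have hσj : 0 < sg Finset.univ (k+1) a := sg_pos (by simpa) ha
    have : ∑ i, a i * X i ^2 * m ≤ ∑ p, a p * X p ^2 * (a p * sg (Finset.univ.erase p) k a) := by
      apply Finset.sum_le_sum
      intro p _
      apply mul_le_mul_of_nonneg_left (hm p)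
      have := ha p; positivity
    rw [← Finset.sum_mul, ht] at this
    have := mul_le_mul_of_nonneg_left this hβ
    have : 0 < g * sg Finset.univ (k+1) a := by positivity
    linarith

open scoped Classical Topology
open Real Filter MeasureTheory

section PD
variable {n : ℕ}

noncomputable def pd (v : Euc n) (f : Euc n → ℝ) (x : Euc n) : ℝ := fderiv ℝ f x v

abbrev Sm (f : Euc n → ℝ) (U : Set (Euc n)) : Prop := ContDiffOn ℝ (⊤ : ℕ∞) f U

lemma Sm.fd {f : Euc n → ℝ} {U : Set (Euc n)} (h : Sm f U) (hU : IsOpen U) :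
    ContDiffOn ℝ (⊤ : ℕ∞) (fderiv ℝ f) U :=
  h.fderiv_of_isOpen hU (by norm_cast)

lemma Sm.pdd {f : Euc n → ℝ} {U : Set (Euc n)} (h : Sm f U) (hU : IsOpen U) (v : Euc n) :
    Sm (pd v f) U :=
  (h.fd hU).clm_apply contDiffOn_const

lemma Sm.diff {f : Euc n → ℝ} {U : Set (Euc n)} (h : Sm f U) (hU : IsOpen U) {x : Euc n} (hx : x ∈ U) :
    DifferentiableAt ℝ f x :=
  (h.contDiffAt (hU.mem_nhds hx)).differentiableAt (by simp)

lemma Sm.fdiff {f : Euc n → ℝ} {U : Set (Euc n)} (h : Sm f U) (hU : IsOpen U) {x : Euc n} (hx : x ∈ U) :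
    DifferentiableAt ℝ (fderiv ℝ f) x :=
  ((h.fd hU).contDiffAt (hU.mem_nhds hx)).differentiableAt (by simp)

lemma pd_pd {f : Euc n → ℝ} {U : Set (Euc n)} (h : Sm f U) (hU : IsOpen U) {x : Euc n} (hx : x ∈ U)
    (v w : Euc n) : pd v (pd w f) x = fderiv ℝ (fderiv ℝ f) x v w := by
  unfold pd
  have := (h.fdiff hU hx).hasFDerivAt
  have h2 := this.clm_apply (hasFDerivAt_const w x)
  rw [h2.fderiv]; simp

lemma pd_comm {f : Euc n → ℝ} {U : Set (Euc n)} (h : Sm f U) (hU : IsOpen U) {x : Euc n} (hx : x ∈ U)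
    (v w : Euc n) : pd v (pd w f) x = pd w (pd v f) x := by
  rw [pd_pd h hU hx, pd_pd h hU hx]
  exact (h.contDiffAt (hU.mem_nhds hx)).isSymmSndFDerivAt (by simp; norm_cast) v w

lemma pd_congr {f g : Euc n → ℝ} {U : Set (Euc n)} (hU : IsOpen U) (h : ∀ x ∈ U, f x = g x) (v : Euc n) :
    ∀ x ∈ U, pd v f x = pd v g x := by
  intro x hx
  unfold pd
  rw [Filter.EventuallyEq.fderiv_eq (f₁ := f) (f := g)]
  filter_upwards [hU.mem_nhds hx] with y hy using h y hy

lemma pd_comm3 {f : Euc n → ℝ} {U : Set (Euc n)} (h : Sm f U) (hU : IsOpen U) {x : Euc n} (hx : x ∈ U)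
    (e v : Euc n) : pd e (pd v (pd v f)) x = pd v (pd v (pd e f)) x := by
  rw [pd_comm (h.pdd hU v) hU hx e v]
  exact pd_congr hU (fun y hy => pd_comm h hU hy e v) v x hx

lemma pd_comm4 {f : Euc n → ℝ} {U : Set (Euc n)} (h : Sm f U) (hU : IsOpen U) {x : Euc n} (hx : x ∈ U)
    (e v : Euc n) : pd e (pd e (pd v (pd v f))) x = pd v (pd v (pd e (pd e f))) x := by
  rw [pd_congr hU (fun y hy => pd_comm3 h hU hy e v) e x hx]
  exact pd_comm3 (h.pdd hU e) hU hx e v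

lemma pd_add_left (f : Euc n → ℝ) (x v w : Euc n) : pd (v + w) f x = pd v f x + pd w f x := by
  simp [pd]
lemma pd_smul_left (f : Euc n → ℝ) (x v : Euc n) (c : ℝ) : pd (c • v) f x = c * pd v f x := by
  simp [pd]

lemma line_mem {U : Set (Euc n)} (hU : IsOpen U) {x : Euc n} (hx : x ∈ U) (v : Euc n) :
    ∀ᶠ t in 𝓝 (0:ℝ), x + t • v ∈ U := by
  have hc : Continuous (fun t : ℝ => x + t • v) := by fun_prop
  have : Tendsto (fun t : ℝ => x + t • v) (𝓝 0) (𝓝 x) := by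
    have := hc.tendsto 0; simpa using this
  exact this (hU.mem_nhds hx)

lemma line_deriv {f : Euc n → ℝ} {U : Set (Euc n)} (h : Sm f U) (hU : IsOpen U) {x v : Euc n} {t : ℝ}
    (hx : x + t • v ∈ U) : HasDerivAt (fun s : ℝ => f (x + s • v)) (pd v f (x + t • v)) t := by
  have h1 := (h.diff hU hx).hasFDerivAt
  have h2 : HasDerivAt (fun s : ℝ => x + s • v) v t := by
    simpa using ((hasDerivAt_id t).smul_const v).const_add x
  exact h1.comp_hasDerivAt t h2

/-- One dimensional second order jet of `φ` at `x` in the direction `v`. -/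
def Jet (φ : Euc n → ℝ) (x v : Euc n) (d1 d2 : ℝ) : Prop :=
  ∃ p : ℝ → ℝ, (∀ᶠ t in 𝓝 (0:ℝ), HasDerivAt (fun s : ℝ => φ (x + s • v)) (p t) t) ∧ p 0 = d1 ∧
    HasDerivAt p d2 0

lemma Sm.jet {f : Euc n → ℝ} {U : Set (Euc n)} (h : Sm f U) (hU : IsOpen U) {x : Euc n} (hx : x ∈ U)
    (v : Euc n) : Jet f x v (pd v f x) (pd v (pd v f) x) := by
  refine ⟨fun t => pd v f (x + t • v), ?_, by simp, ?_⟩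
  · filter_upwards [line_mem hU hx v] with t ht
    exact line_deriv h hU ht
  · have := line_deriv (x := x) (v := v) (t := 0) (h.pdd hU v) hU (by simpa using hx)
    simpa using this

lemma Jet.add {φ ψ : Euc n → ℝ} {x v : Euc n} {a b c d : ℝ} (h1 : Jet φ x v a b) (h2 : Jet ψ x v c d) :
    Jet (fun y => φ y + ψ y) x v (a + c) (b + d) := by
  obtain ⟨p, hp, hp0, hpd⟩ := h1
  obtain ⟨q, hq, hq0, hqd⟩ := h2
  refine ⟨fun t => p t + q t, ?_, by simp [hp0, hq0], hpd.add hqd⟩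
  filter_upwards [hp, hq] with t h1 h2
  exact h1.add h2

lemma Jet.cmul {φ : Euc n → ℝ} {x v : Euc n} {a b : ℝ} (c : ℝ) (h1 : Jet φ x v a b) :
    Jet (fun y => c * φ y) x v (c * a) (c * b) := by
  obtain ⟨p, hp, hp0, hpd⟩ := h1
  refine ⟨fun t => c * p t, ?_, by simp [hp0], hpd.const_mul c⟩
  filter_upwards [hp] with t h1
  exact h1.const_mul c

lemma Jet.const (x v : Euc n) (c : ℝ) : Jet (fun _ => c) x v 0 0 :=
  ⟨fun _ => 0, Eventually.of_forall (fun t => hasDerivAt_const t c), rfl, hasDerivAt_const _ _⟩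

lemma Jet.sub {φ ψ : Euc n → ℝ} {x v : Euc n} {a b c d : ℝ} (h1 : Jet φ x v a b) (h2 : Jet ψ x v c d) :
    Jet (fun y => φ y - ψ y) x v (a - c) (b - d) := by
  have := h1.add (h2.cmul (-1))
  simpa [sub_eq_add_neg] using this

lemma Jet.mul {φ ψ : Euc n → ℝ} {x v : Euc n} {a b c d : ℝ} (h1 : Jet φ x v a b) (h2 : Jet ψ x v c d) :
    Jet (fun y => φ y * ψ y) x v (a * ψ x + φ x * c) (b * ψ x + 2 * a * c + φ x * d) := by
  obtain ⟨p, hp, hp0, hpd⟩ := h1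
  obtain ⟨q, hq, hq0, hqd⟩ := h2
  refine ⟨fun t => p t * ψ (x + t • v) + φ (x + t • v) * q t, ?_, by simp [hp0, hq0], ?_⟩
  · filter_upwards [hp, hq] with t h1 h2
    exact h1.mul h2
  · have := (hpd.mul hq.self_of_nhds).add (hp.self_of_nhds.mul hqd)
    refine this.congr_deriv ?_
    simp [hp0, hq0]; ring

lemma Jet.lin (p y x v : Euc n) : Jet (fun z => inner ℝ p (z - y)) x v (inner ℝ p v) 0 := by
  refine ⟨fun _ => inner ℝ p v, Eventually.of_forall (fun t => ?_), rfl, hasDerivAt_const _ _⟩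
  have : (fun s : ℝ => inner ℝ p (x + s • v - y)) = fun s : ℝ => inner ℝ p (x - y) + s * inner ℝ p v := by
    funext s
    rw [show x + s • v - y = (x - y) + s • v by abel, inner_add_right, inner_smul_right]
  rw [this]
  simpa using ((hasDerivAt_id t).mul_const (inner ℝ p v)).const_add (inner ℝ p (x - y))

/-- weighted bilinear form -/
def bl (a : Fin n → ℝ) (x y : Euc n) : ℝ := ∑ i, a i * x i * y i

lemma bl_add_left (a : Fin n → ℝ) (x y z : Euc n) : bl a (x + y) z = bl a x z + bl a y z := by
  simp [bl, ← Finset.sum_add_distrib, mul_add, add_mul]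
lemma bl_smul_left (a : Fin n → ℝ) (c : ℝ) (x z : Euc n) : bl a (c • x) z = c * bl a x z := by
  simp only [bl, Finset.mul_sum, PiLp.smul_apply, smul_eq_mul]
  apply Finset.sum_congr rfl; intro i _; ring
lemma bl_comm (a : Fin n → ℝ) (x z : Euc n) : bl a x z = bl a z x := by
  simp only [bl]
  apply Finset.sum_congr rfl; intro i _; ring
lemma bl_add_right (a : Fin n → ℝ) (x y z : Euc n) : bl a z (x + y) = bl a z x + bl a z y := by
  rw [bl_comm, bl_add_left, bl_comm a x, bl_comm a y]
lemma bl_smul_right (a : Fin n → ℝ) (c : ℝ) (x z : Euc n) : bl a z (c • x) = c * bl a z x := by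
  rw [bl_comm, bl_smul_left, bl_comm]
lemma bl_neg_left (a : Fin n → ℝ) (x z : Euc n) : bl a (-x) z = - bl a x z := by
  simpa using bl_smul_left a (-1) x z
lemma bl_neg_right (a : Fin n → ℝ) (x z : Euc n) : bl a z (-x) = - bl a z x := by
  simpa using bl_smul_right a (-1) x z
lemma bl_sub_left (a : Fin n → ℝ) (x y z : Euc n) : bl a (x - y) z = bl a x z - bl a y z := by
  rw [sub_eq_add_neg, bl_add_left, bl_neg_left]; ring
lemma bl_sub_right (a : Fin n → ℝ) (x y z : Euc n) : bl a z (x - y) = bl a z x - bl a z y := by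
  rw [sub_eq_add_neg, bl_add_right, bl_neg_right]; ring

/-- the quadratic `½ (x-c)ᵀ diag(a) (x-c)` -/
noncomputable def Qd (a : Fin n → ℝ) (c x : Euc n) : ℝ := bl a (x - c) (x - c) / 2

lemma Qd_line (a : Fin n → ℝ) (c x v : Euc n) (t : ℝ) :
    Qd a c (x + t • v) = Qd a c x + t * bl a (x - c) v + t^2 / 2 * bl a v v := by
  unfold Qd
  rw [show x + t • v - c = (x - c) + t • v by abel]
  simp only [bl_add_left, bl_add_right, bl_smul_left, bl_smul_right]
  rw [bl_comm a v (x - c)]; ring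

lemma Qd_deriv (a : Fin n → ℝ) (c x v : Euc n) (t : ℝ) :
    HasDerivAt (fun s : ℝ => Qd a c (x + s • v)) (bl a (x - c) v + t * bl a v v) t := by
  simp only [Qd_line]
  have h1 := (((hasDerivAt_id t).mul_const (bl a (x - c) v)).const_add (Qd a c x)).add
    ((((hasDerivAt_id t).pow 2).div_const 2).mul_const (bl a v v))
  refine h1.congr_deriv ?_
  simp

lemma Jet.quad (a : Fin n → ℝ) (c x v : Euc n) : Jet (Qd a c) x v (bl a (x - c) v) (bl a v v) := by
  refine ⟨fun t => bl a (x - c) v + t * bl a v v, Eventually.of_forall (fun t => Qd_deriv a c x v t), by simp, ?_⟩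
  simpa using ((hasDerivAt_id (0:ℝ)).mul_const (bl a v v)).const_add (bl a (x - c) v)

lemma Jet.compQ (a : Fin n → ℝ) (c x v : Euc n) {G g : ℝ → ℝ} {g' : ℝ}
    (hG : ∀ᶠ t in 𝓝 (Qd a c x), HasDerivAt G (g t) t) (hg : HasDerivAt g g' (Qd a c x)) :
    Jet (fun y => G (Qd a c y)) x v (g (Qd a c x) * bl a (x - c) v)
      (g' * (bl a (x - c) v)^2 + g (Qd a c x) * bl a v v) := by
  obtain ⟨p, hp, hp0, hpd⟩ := Jet.quad a c x v
  refine ⟨fun t => g (Qd a c (x + t • v)) * p t, ?_, by simp [hp0], ?_⟩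
  · have hc : Tendsto (fun t : ℝ => Qd a c (x + t • v)) (𝓝 0) (𝓝 (Qd a c x)) := by
      have := (Qd_deriv a c x v 0).continuousAt.tendsto
      simpa using this
    filter_upwards [hp, hc.eventually hG] with t h1 h2
    exact h2.comp t h1
  · have hg2 : HasDerivAt g g' (Qd a c (x + (0:ℝ) • v)) := by simpa using hg
    have h1 := (HasDerivAt.comp (0:ℝ) hg2 (Qd_deriv a c x v 0)).mul hpd
    refine h1.congr_deriv ?_
    simp [hp0]; ring

lemma qf_R1 (a : Fin n → ℝ) (X v : Euc n) (g g' : ℝ) :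
    qf (R1 (g • a) g' (fun i => a i * X i)) v v = g' * (bl a X v)^2 + g * bl a v v := by
  unfold qf R1
  have : ∀ p q : Fin n, v p * (Matrix.of fun p q => (if p = q then (g • a) p else 0) + g' * (a p * X p) * (a q * X q)) p q * v q
     = (if p = q then g * (a p * v p * v p) else 0) + g' * ((a p * X p * v p) * (a q * X q * v q)) := by
    intro p q
    simp only [Matrix.of_apply]
    by_cases h : p = q
    · subst h; simp; ring
    · simp [h]; ring
  simp only [this, Finset.sum_add_distrib]
  simp only [Finset.sum_ite_eq, Finset.mem_univ, if_true, ← Finset.mul_sum, ← Finset.sum_mul]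
  unfold bl; ring

lemma Jet.max {φ : Euc n → ℝ} {x v : Euc n} {d1 d2 : ℝ} (h : Jet φ x v d1 d2)
    (hm : IsLocalMax (fun t : ℝ => φ (x + t • v)) 0) : d1 = 0 ∧ d2 ≤ 0 := by
  obtain ⟨p, hp, hp0, hpd⟩ := h
  have h0 := hm.hasDerivAt_eq_zero hp.self_of_nhds
  refine ⟨hp0 ▸ h0, ?_⟩
  by_contra hpos
  push Not at hpos
  have hde : deriv (fun t : ℝ => φ (x + t • v)) =ᶠ[𝓝 0] p := by
    filter_upwards [hp] with t ht using ht.deriv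
  have hmin : IsLocalMin (fun t : ℝ => φ (x + t • v)) 0 := by
    apply isLocalMin_of_deriv_deriv_pos
    · rw [hde.deriv_eq, hpd.deriv]; exact hpos
    · rw [hp.self_of_nhds.deriv]; exact h0
    · exact hp.self_of_nhds.continuousAt
  have hconst : (fun t : ℝ => φ (x + t • v)) =ᶠ[𝓝 0] fun _ => φ (x + (0:ℝ) • v) := by
    filter_upwards [hm, hmin] with t h1 h2 using le_antisymm h1 h2
  have : p =ᶠ[𝓝 0] fun _ => 0 := by
    filter_upwards [hde, hconst.eventuallyEq_nhds] with t h1 h2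
    rw [← h1, h2.deriv_eq]; simp
  have h3 := this.deriv_eq
  rw [hpd.deriv] at h3
  simp at h3
  linarith

lemma Jet.normsq (x v : Euc n) : Jet (fun y => ‖y‖^2) x v (2 * inner ℝ x v) (2 * ‖v‖^2) := by
  have hf : (fun y : Euc n => ‖y‖^2) = fun y => 2 * Qd (fun _ => 1) 0 y := by
    funext y
    simp [Qd, bl, EuclideanSpace.norm_sq_eq]
    rw [← Finset.sum_congr rfl (fun i _ => pow_two (y i))]; ring
  rw [hf]
  have := (Jet.quad (fun _ => 1) 0 x v).cmul 2
  convert this using 1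
  · simp [bl, PiLp.inner_apply]
    apply Finset.sum_congr rfl; intro i _; ring
  · simp [bl, EuclideanSpace.norm_sq_eq]
    apply Finset.sum_congr rfl; intro i _; ring

/-- Maximum principle. -/
theorem MP (hn : 0 < n) {K D : Set (Euc n)} (hK : IsCompact K) (hD : IsOpen D) (hDK : D ⊆ K)
    {φ : Euc n → ℝ} (hc : ContinuousOn φ K) (hb : ∀ x ∈ K, x ∉ D → φ x ≤ 0)
    (hL : ∀ x ∈ D, ∃ (f : OrthonormalBasis (Fin n) ℝ (Euc n)) (w d1 d2 : Fin n → ℝ), (∀ i, 0 < w i) ∧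
      (∀ i, Jet φ x (f i) (d1 i) (d2 i)) ∧ 0 ≤ ∑ i, w i * d2 i) :
    ∀ x ∈ K, φ x ≤ 0 := by
  intro x1 hx1
  by_contra hpos
  push Not at hpos
  obtain ⟨B, hB⟩ := hK.exists_bound_of_continuousOn (f := fun y : Euc n => ‖y‖^2) (by fun_prop)
  have hB0 : 0 ≤ B := (norm_nonneg _).trans (hB x1 hx1)
  set δ := φ x1 / (2 * (B + 1)) with hδ
  have hδ0 : 0 < δ := by positivity
  have hδB : δ * B < φ x1 := by
    rw [hδ, div_mul_eq_mul_div, div_lt_iff₀ (by positivity)]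
    nlinarith
  obtain ⟨z, hzK, hz⟩ := hK.exists_isMaxOn ⟨x1, hx1⟩
    (f := fun y => φ y + δ * ‖y‖^2) (hc.add (by fun_prop))
  have hz1 : φ x1 ≤ φ z + δ * ‖z‖^2 := by
    have : φ x1 + δ * ‖x1‖^2 ≤ φ z + δ * ‖z‖^2 := hz hx1
    have : 0 ≤ δ * ‖x1‖^2 := by positivity
    linarith
  have hzD : z ∈ D := by
    by_contra h
    have h1 := hb z hzK h
    have h2 := hB z hzK
    rw [Real.norm_of_nonneg (by positivity)] at h2
    have := mul_le_mul_of_nonneg_left h2 hδ0.le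
    linarith
  obtain ⟨f, w, d1, d2, hw, hJ, hs⟩ := hL z hzD
  have h2 : ∀ i, d2 i + δ * 2 ≤ 0 := by
    intro i
    have hj := (hJ i).add ((Jet.normsq z (f i)).cmul δ)
    have := (hj.max ?_).2
    · simpa using this
    · filter_upwards [line_mem hD hzD (f i)] with t ht
      have := hz (hDK ht)
      simpa using this
  have : ∑ i, w i * d2 i < 0 := by
    apply Finset.sum_neg
    · intro i _
      have := h2 i; have := hw i
      nlinarith
    · exact ⟨⟨0, hn⟩, Finset.mem_univ _⟩
  linarith

end PD

open scoped Classical Topology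
open Real Filter MeasureTheory

section PK
variable {n : ℕ}

lemma euc_expand (v : Euc n) : v = ∑ i, v i • ebasis n i := by
  ext j
  simp [ebasis, WithLp.ofLp_sum, Finset.sum_apply, Pi.single_apply]

lemma qf_hess {u : Euc n → ℝ} {U : Set (Euc n)} (h : Sm u U) (hU : IsOpen U) {x : Euc n} (hx : x ∈ U)
    (v w : Euc n) : qf (hessMat n u x) v w = pd v (pd w u) x := by
  rw [pd_pd h hU hx]
  conv_rhs => rw [euc_expand v, euc_expand w]
  simp only [map_sum, map_smul, _root_.sum_apply, _root_.smul_apply, smul_eq_mul]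
  unfold qf
  simp only [hessMat, Matrix.of_apply, iteratedFDeriv_two_apply]
  rw [Finset.sum_comm]
  apply Finset.sum_congr rfl
  intro i _
  rw [Finset.mul_sum]
  apply Finset.sum_congr rfl
  intro j _
  simp; ring

lemma hess_herm {u : Euc n → ℝ} {U : Set (Euc n)} (h : Sm u U) (hU : IsOpen U) {x : Euc n} (hx : x ∈ U) :
    (hessMat n u x).IsHermitian := by
  ext i j
  simp only [Matrix.conjTranspose_apply, star_trivial, hessMat, Matrix.of_apply, iteratedFDeriv_two_apply]
  have := pd_comm h hU hx (ebasis n i) (ebasis n j)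
  rw [pd_pd h hU hx, pd_pd h hU hx] at this
  simpa using this.symm

/-- data of a solution on an open set -/
structure Sol (n k : ℕ) (u : Euc n → ℝ) (U Ω : Set (Euc n)) : Prop where
  hU : IsOpen U
  hO : IsOpen Ω
  hOU : closure Ω ⊆ U
  sm : Sm u U
  kc : ∀ x ∈ Ω, MGam n (k+1) (hessMat n u x)
  eq : ∀ x ∈ Ω, matSk n (k+1) (hessMat n u x) = 1

lemma Sol.mem {k : ℕ} {u : Euc n → ℝ} {U Ω : Set (Euc n)} (h : Sol n k u U Ω) {x : Euc n} (hx : x ∈ Ω) : x ∈ U :=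
  h.hOU (subset_closure hx)

/-- the linearised operator at `x`: weights and an orthonormal frame -/
structure LinP (n k : ℕ) (u : Euc n → ℝ) (x : Euc n) (f : OrthonormalBasis (Fin n) ℝ (Euc n)) (w : Fin n → ℝ) : Prop where
  wpos : ∀ i, 0 < w i
  tr : ∑ i, w i * pd (f i) (pd (f i) u) x = (k:ℝ) + 1
  cone : ∀ N : Matrix (Fin n) (Fin n) ℝ, N.IsHermitian → MGam n (k+1) N → 1 ≤ matSk n (k+1) N →
    (k:ℝ) + 1 ≤ ∑ i, w i * qf N (f i) (f i)
  d1 : ∀ e, ∑ i, w i * pd (f i) (pd (f i) (pd e u)) x = 0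
  d2 : ∀ e, 0 ≤ ∑ i, w i * pd (f i) (pd (f i) (pd e (pd e u))) x
  rot : ∀ p q : Euc n, ∑ i, w i * (inner ℝ p (f i) * pd (f i) (pd q u) x) =
    ∑ i, w i * (inner ℝ q (f i) * pd (f i) (pd p u) x)

theorem pack {k : ℕ} (hkn : k + 1 ≤ n) {u : Euc n → ℝ} {U Ω : Set (Euc n)} (h : Sol n k u U Ω)
    {x : Euc n} (hx : x ∈ Ω) : ∃ f w, LinP n k u x f w := by
  have hU := h.hU
  have hxU := h.mem hx
  obtain ⟨f, w, lam, hw, hl, htr, hc⟩ := alg hkn (hess_herm h.sm hU hxU) (h.kc x hx)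
  rw [h.eq x hx, mul_one] at htr hc
  have hpd : ∀ i v, pd v (pd (f i) u) x = lam i * inner ℝ v (f i) := by
    intro i v
    rw [← qf_hess h.sm hU hxU, hl]
  have htr' : ∑ i, w i * pd (f i) (pd (f i) u) x = (k:ℝ) + 1 := by
    rw [← htr]
    apply Finset.sum_congr rfl
    intro i _
    rw [hpd]; simp
  -- the function along lines
  have hmin : ∀ y ∈ Ω, (k:ℝ) + 1 ≤ ∑ i, w i * pd (f i) (pd (f i) u) y := by
    intro y hy
    have := hc _ (hess_herm h.sm hU (h.mem hy)) (h.kc y hy) (h.eq y hy).ge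
    refine this.trans_eq ?_
    apply Finset.sum_congr rfl
    intro i _
    rw [qf_hess h.sm hU (h.mem hy)]
  have hS : Sm (fun y => -∑ i, w i * pd (f i) (pd (f i) u) y) U := by
    apply ContDiffOn.neg
    apply ContDiffOn.sum
    intro i _
    exact contDiffOn_const.mul ((h.sm.pdd hU _).pdd hU _)
  have hJ : ∀ e, Jet (fun y => -∑ i, w i * pd (f i) (pd (f i) u) y) x e
      (-∑ i, w i * pd e (pd (f i) (pd (f i) u)) x) (-∑ i, w i * pd e (pd e (pd (f i) (pd (f i) u))) x) := by
    intro e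
    have hone : ∀ i, Jet (pd (f i) (pd (f i) u)) x e (pd e (pd (f i) (pd (f i) u)) x) (pd e (pd e (pd (f i) (pd (f i) u))) x) :=
      fun i => ((h.sm.pdd hU (f i)).pdd hU (f i)).jet hU hxU e
    have hsum : ∀ s : Finset (Fin n), Jet (fun y => ∑ i ∈ s, w i * pd (f i) (pd (f i) u) y) x e
      (∑ i ∈ s, w i * pd e (pd (f i) (pd (f i) u)) x) (∑ i ∈ s, w i * pd e (pd e (pd (f i) (pd (f i) u))) x) := by
      intro s
      induction s using Finset.induction_on with
      | empty => simpa using Jet.const x e 0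
      | insert j s hj ih =>
        simp only [Finset.sum_insert hj]
        exact ((hone j).cmul (w j)).add ih
    have := (hsum Finset.univ).cmul (-1)
    simpa using this
  have hmax : ∀ e, IsLocalMax (fun t : ℝ => -∑ i, w i * pd (f i) (pd (f i) u) (x + t • e)) 0 := by
    intro e
    filter_upwards [line_mem h.hO hx e] with t ht
    have := hmin _ ht
    simp only [zero_smul, add_zero]
    linarith
  refine ⟨f, w, ⟨hw, htr', hc, ?_, ?_, ?_⟩⟩
  · intro e
    have := ((hJ e).max (hmax e)).1
    rw [neg_eq_zero] at this
    rw [← this]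
    apply Finset.sum_congr rfl
    intro i _
    rw [pd_comm3 h.sm hU hxU]
  · intro e
    have := ((hJ e).max (hmax e)).2
    rw [neg_nonpos] at this
    refine this.trans_eq ?_
    apply Finset.sum_congr rfl
    intro i _
    rw [pd_comm4 h.sm hU hxU]
  · intro p q
    apply Finset.sum_congr rfl
    intro i _
    rw [pd_comm h.sm hU hxU (f i) q, pd_comm h.sm hU hxU (f i) p, hpd, hpd]
    ring

lemma cont_aux {E F : Type*} [NormedAddCommGroup E] [NormedAddCommGroup F] {T : E → F} {y : E}
    (h : ContinuousAt T y) {c : ℝ} (hc : 0 < c) : ∀ᶠ x in 𝓝 y, ‖T x - T y‖ < c := by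
  have h1 : ContinuousAt (fun x => ‖T x - T y‖) y := (h.sub continuousAt_const).norm
  exact h1.eventually_lt continuousAt_const (by simpa using hc)

lemma Sol.slack {k : ℕ} (hkn : k + 1 ≤ n) {u : Euc n → ℝ} {U Ω : Set (Euc n)} (h : Sol n k u U Ω)
    {y : Euc n} (hy : y ∈ closure Ω) {N : Matrix (Fin n) (Fin n) ℝ} (hN : N.IsHermitian)
    (hG : MGam n (k+1) N) {c : ℝ} (hc : 0 < c) (hle : ∀ e, qf N e e + c * ‖e‖^2 ≤ pd e (pd e u) y) :
    matSk n (k+1) N < 1 := by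
  by_contra hge
  push Not at hge
  have hyU := h.hOU hy
  have hcont : ContinuousAt (fderiv ℝ (fderiv ℝ u)) y := by
    have := (h.sm.fd h.hU).fderiv_of_isOpen (m := 0) h.hU (by norm_cast)
    exact (this.contDiffAt (h.hU.mem_nhds hyU)).continuousAt
  have hev : ∀ᶠ x in 𝓝 y, ‖fderiv ℝ (fderiv ℝ u) x - fderiv ℝ (fderiv ℝ u) y‖ < c :=
    cont_aux (E := Euc n) (F := Euc n →L[ℝ] Euc n →L[ℝ] ℝ) (T := fderiv ℝ (fderiv ℝ u)) hcont hc
  obtain ⟨x, hx, hxO⟩ := (mem_closure_iff_frequently.1 hy).and_eventually hev |>.exists |>.imp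
    (fun x hx => (⟨hx.2, hx.1⟩ : _ ∧ _))
  obtain ⟨f, w, L⟩ := pack hkn h hxO
  have h1 := L.cone N hN hG hge
  have h2 := L.tr
  have h3 : ∑ i, w i * qf N (f i) (f i) < ∑ i, w i * pd (f i) (pd (f i) u) x := by
    apply Finset.sum_lt_sum_of_nonempty
    · exact ⟨⟨0, by omega⟩, Finset.mem_univ _⟩
    · intro i _
      apply mul_lt_mul_of_pos_left _ (L.wpos i)
      have h4 := hle (f i)
      rw [pd_pd h.sm h.hU hyU] at h4
      rw [pd_pd h.sm h.hU (h.mem hxO)]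
      have h5 : |(fderiv ℝ (fderiv ℝ u) x - fderiv ℝ (fderiv ℝ u) y) (f i) (f i)| ≤
        ‖fderiv ℝ (fderiv ℝ u) x - fderiv ℝ (fderiv ℝ u) y‖ := by
        have := (fderiv ℝ (fderiv ℝ u) x - fderiv ℝ (fderiv ℝ u) y).le_opNorm₂ (f i) (f i)
        simpa using this
      rw [_root_.sub_apply, _root_.sub_apply] at h5
      have h6 := (abs_le.1 h5).1
      simp at h4
      linarith
  linarith

lemma hess_bound {u : Euc n → ℝ} {U : Set (Euc n)} (h : Sm u U) (hU : IsOpen U) {x : Euc n} (hx : x ∈ U)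
    {C : ℝ} (hC : 0 ≤ C) (hb : ∀ e : Euc n, |pd e (pd e u) x| ≤ C * ‖e‖^2) :
    ‖iteratedFDeriv ℝ 2 u x‖ ≤ C := by
  have hun : ∀ v w : Euc n, ‖v‖ = 1 → ‖w‖ = 1 → |pd v (pd w u) x| ≤ C := by
    intro v w hv hw
    have h1 := hb (v + w)
    have h2 := hb (v - w)
    have hs := pd_comm h hU hx v w
    have hpar := parallelogram_law_with_norm ℝ v w
    rw [hv, hw] at hpar
    rw [pd_pd h hU hx] at h1 h2
    rw [pd_pd h hU hx, pd_pd h hU hx] at hs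
    rw [pd_pd h hU hx]
    simp only [map_add, map_sub, _root_.add_apply, _root_.sub_apply] at h1 h2
    rw [abs_le] at *
    constructor <;> nlinarith
  apply ContinuousMultilinearMap.opNorm_le_bound hC
  intro m
  rw [iteratedFDeriv_two_apply, Fin.prod_univ_two, Real.norm_eq_abs, ← pd_pd h hU hx]
  by_cases h0 : m 0 = 0
  · rw [h0, pd_pd h hU hx]; simp
  by_cases h1 : m 1 = 0
  · rw [h1, pd_pd h hU hx]; simp
  have n0 : 0 < ‖m 0‖ := norm_pos_iff.2 h0
  have n1 : 0 < ‖m 1‖ := norm_pos_iff.2 h1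
  have := hun (‖m 0‖⁻¹ • m 0) (‖m 1‖⁻¹ • m 1) (norm_smul_inv_norm h0) (norm_smul_inv_norm h1)
  rw [pd_pd h hU hx] at this ⊢
  simp only [map_smul, _root_.smul_apply, smul_eq_mul, abs_mul, abs_inv, abs_norm] at this
  have e : |fderiv ℝ (fderiv ℝ u) x (m 0) (m 1)| = (‖m 0‖ * ‖m 1‖) * (‖m 1‖⁻¹ * (‖m 0‖⁻¹ * |fderiv ℝ (fderiv ℝ u) x (m 0) (m 1)|)) := by
    field_simp
  rw [e]
  have h' : ‖m 1‖⁻¹ * (‖m 0‖⁻¹ * |fderiv ℝ (fderiv ℝ u) x (m 0) (m 1)|) ≤ C := by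
    refine le_trans (le_of_eq ?_) this
    ring
  calc _ ≤ (‖m 0‖ * ‖m 1‖) * C := mul_le_mul_of_nonneg_left h' (by positivity)
    _ = _ := by ring

end PK

open scoped Classical Topology
open Real Filter MeasureTheory

section GEO

/-- facts about the data and the radial profile -/
structure GF (n k : ℕ) (a : Fin n → ℝ) (lam R₀ : ℝ) (G g : ℝ → ℝ) (M₀ b h : ℝ) : Prop where
  hn : 3 ≤ n
  hk : k + 1 ≤ n
  lam0 : 0 < lam
  la : ∀ i, lam ≤ a i
  sig : sg Finset.univ (k+1) a = 1
  hR0 : 2 * ∑ i, a i + 2 ≤ R₀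
  hh : ∀ i, a i * sg (Finset.univ.erase i) k a ≤ h
  G0 : G R₀ = 0
  dG : ∀ t, 0 < t → HasDerivAt G (g t) t
  dg : ∀ t, 0 < t → ∃ g', HasDerivAt g g' t ∧ g' ≤ 0 ∧ 0 < g t + 2 * t * g' * h ∧
    1 ≤ g t ^ k * (g t + 2 * t * g' * h)
  g1 : ∀ t, 0 < t → 1 ≤ g t
  gb : ∀ t, R₀ ≤ t → (g t - 1) * t ≤ b
  G2 : 8 * R₀ / lam + 1 ≤ G (2 * R₀)
  GR : ∀ t, 2 * R₀ ≤ t → t ≤ G t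
  GM : ∀ t, 2 * R₀ ≤ t → G t ≤ t + M₀

def Om {n : ℕ} (a : Fin n → ℝ) (x₀ : Euc n) (ε R : ℝ) : Set (Euc n) := {x | Qd a 0 x < R ∧ ε < ‖x - x₀‖}
def Ks {n : ℕ} (a : Fin n → ℝ) (x₀ : Euc n) (ε R : ℝ) : Set (Euc n) := {x | Qd a 0 x ≤ R ∧ ε ≤ ‖x - x₀‖}

/-- full setup -/
structure St (n k : ℕ) (a : Fin n → ℝ) (lam R₀ : ℝ) (G g : ℝ → ℝ) (M₀ b h : ℝ) (x₀ : Euc n) (ε R : ℝ)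
    (u : Euc n → ℝ) (U : Set (Euc n)) : Prop where
  gf : GF n k a lam R₀ G g M₀ b h
  hx0 : ‖x₀‖ < 1 / 2
  e0 : 0 < ε
  e1 : ε < 1 / 2
  hR : 3 * R₀ < R
  sol : Sol n k u U (Om a x₀ ε R)
  u0 : ∀ x, ‖x - x₀‖ = ε → u x = 0
  uR : ∀ x, Qd a 0 x = R → u x = G R

variable {n k : ℕ} {a : Fin n → ℝ} {lam R₀ : ℝ} {G g : ℝ → ℝ} {M₀ b h : ℝ} {x₀ : Euc n} {ε R : ℝ}
    {u : Euc n → ℝ} {U : Set (Euc n)}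

lemma one_bl (x y : Euc n) : bl (fun _ => 1) x y = inner ℝ x y := by
  simp [bl, PiLp.inner_apply]
  apply Finset.sum_congr rfl; intro i _; ring

lemma one_blsq (x : Euc n) : bl (fun _ => 1) x x = ‖x‖^2 := by
  rw [one_bl, real_inner_self_eq_norm_sq]

lemma Qd_one (c x : Euc n) : Qd (fun _ => 1) c x = ‖x - c‖^2 / 2 := by
  rw [Qd, one_blsq]

lemma Qd_cont (a : Fin n → ℝ) (c : Euc n) : Continuous (Qd a c) := by
  unfold Qd bl; fun_prop

lemma bl_lower (hl : ∀ i, lam ≤ a i) (x : Euc n) : lam * ‖x‖^2 ≤ bl a x x := by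
  rw [← one_blsq, bl, bl, Finset.mul_sum]
  apply Finset.sum_le_sum
  intro i _
  have := hl i
  nlinarith [mul_self_nonneg (x i)]

lemma bl_upper (ha : ∀ i, 0 < a i) (x : Euc n) : bl a x x ≤ (∑ i, a i) * ‖x‖^2 := by
  rw [← one_blsq, bl, bl, Finset.mul_sum]
  apply Finset.sum_le_sum
  intro i _
  have := Finset.single_le_sum (f := a) (fun j _ => (ha j).le) (Finset.mem_univ i)
  nlinarith [mul_self_nonneg (x i)]

lemma bl_nonneg (ha : ∀ i, 0 < a i) (x : Euc n) : 0 ≤ bl a x x := by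
  unfold bl
  apply Finset.sum_nonneg
  intro i _
  have := (ha i).le
  nlinarith [mul_nonneg this (mul_self_nonneg (x i))]

lemma bl_cs (ha : ∀ i, 0 < a i) (x y : Euc n) : (bl a x y)^2 ≤ bl a x x * bl a y y := by
  have h : ∀ t : ℝ, 0 ≤ bl a y y * (t * t) + (2 * bl a x y) * t + bl a x x := by
    intro t
    have := bl_nonneg ha (x + t • y)
    simp only [bl_add_left, bl_add_right, bl_smul_left, bl_smul_right] at this
    rw [bl_comm a y x] at this
    linarith
  have := discrim_le_zero h
  unfold discrim at this
  nlinarith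

lemma bl_abs (ha : ∀ i, 0 < a i) (x y : Euc n) : |bl a x y| ≤ (∑ i, a i) * ‖x‖ * ‖y‖ := by
  have hs : 0 ≤ ∑ i, a i := Finset.sum_nonneg (fun i _ => (ha i).le)
  apply abs_le_of_sq_le_sq _ (by positivity)
  calc (bl a x y)^2 ≤ bl a x x * bl a y y := bl_cs ha x y
    _ ≤ ((∑ i, a i) * ‖x‖^2) * ((∑ i, a i) * ‖y‖^2) :=
      mul_le_mul (bl_upper ha x) (bl_upper ha y) (bl_nonneg ha y) (by positivity)
    _ = _ := by ring

lemma GF.ha (H : GF n k a lam R₀ G g M₀ b h) : ∀ i, 0 < a i := fun i => H.lam0.trans_le (H.la i)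
lemma GF.sa (H : GF n k a lam R₀ G g M₀ b h) : 0 ≤ ∑ i, a i := Finset.sum_nonneg (fun i _ => (H.ha i).le)
lemma GF.R2 (H : GF n k a lam R₀ G g M₀ b h) : 2 ≤ R₀ := by have := H.sa; have := H.hR0; linarith

lemma St.ha (S : St n k a lam R₀ G g M₀ b h x₀ ε R u U) : ∀ i, 0 < a i := S.gf.ha

/-- points close to the centre have small `s` -/
lemma St.near (S : St n k a lam R₀ G g M₀ b h x₀ ε R u U) {x : Euc n} (hx : ‖x - x₀‖ ≤ 1) :
    Qd a 0 x ≤ 2 * ∑ i, a i := by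
  have h1 : ‖x‖ ≤ 3/2 := by
    have := norm_add_le (x - x₀) x₀
    rw [sub_add_cancel] at this
    have := S.hx0
    linarith
  unfold Qd
  rw [sub_zero]
  have := bl_upper S.ha x
  have h2 : ‖x‖^2 ≤ 9/4 := by nlinarith [norm_nonneg x]
  have := mul_le_mul_of_nonneg_left h2 S.gf.sa
  have := S.gf.sa
  linarith

lemma St.far (S : St n k a lam R₀ G g M₀ b h x₀ ε R u U) {x : Euc n} (hx : R₀ ≤ Qd a 0 x) :
    1 < ‖x - x₀‖ := by
  by_contra hh
  push Not at hh
  have := S.near hh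
  have := S.gf.hR0
  linarith

lemma Ks_closed : IsClosed (Ks a x₀ ε R) :=
  (isClosed_le (Qd_cont a 0) continuous_const).inter
    (isClosed_le continuous_const (continuous_id.sub continuous_const).norm)

lemma Qd_norm (hl : ∀ i, lam ≤ a i) (x : Euc n) : lam * ‖x‖^2 ≤ 2 * Qd a 0 x := by
  have := bl_lower hl x
  unfold Qd; rw [sub_zero]; linarith

lemma cpt_of_le (hlam : 0 < lam) (hl : ∀ i, lam ≤ a i) {S : Set (Euc n)} (hS : IsClosed S) {T : ℝ}
    (hT : ∀ x ∈ S, Qd a 0 x ≤ T) : IsCompact S := by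
  apply Metric.isCompact_of_isClosed_isBounded hS
  rw [isBounded_iff_forall_norm_le]
  refine ⟨2 * T / lam + 1, ?_⟩
  intro x hx
  have h1 := Qd_norm hl x
  have h2 := hT x hx
  have : ‖x‖^2 ≤ 2 * T / lam := by
    rw [le_div_iff₀ hlam]; linarith
  nlinarith [norm_nonneg x, sq_nonneg (‖x‖ - 1)]

lemma Om_open : IsOpen (Om a x₀ ε R) :=
  (isOpen_lt (Qd_cont a 0) continuous_const).inter
    (isOpen_lt continuous_const (continuous_id.sub continuous_const).norm)

lemma Om_sub_Ks : Om a x₀ ε R ⊆ Ks a x₀ ε R := fun _ hx => ⟨hx.1.le, hx.2.le⟩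

/-- line into the domain from the inner boundary -/
lemma St.inner_line (S : St n k a lam R₀ G g M₀ b h x₀ ε R u U) {y : Euc n} (hy : ‖y - x₀‖ = ε) :
    ∃ d : ℝ, 0 < d ∧ ∀ t : ℝ, 0 < t → t < d → y + t • (y - x₀) ∈ Om a x₀ ε R ∧ ‖y + t • (y - x₀) - x₀‖ < 2 * ε := by
  refine ⟨1, one_pos, ?_⟩
  intro t ht0 ht1
  have h1 : ‖y + t • (y - x₀) - x₀‖ = (1 + t) * ε := by
    rw [show y + t • (y - x₀) - x₀ = (1 + t) • (y - x₀) by rw [add_smul, one_smul]; abel, norm_smul, hy,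
      Real.norm_of_nonneg (by linarith)]
  have := S.e0
  have := S.e1
  refine ⟨⟨?_, ?_⟩, ?_⟩
  · have := S.near (x := y + t • (y - x₀)) (by rw [h1]; nlinarith)
    have := S.gf.hR0; have := S.hR; have := S.gf.R2
    linarith
  · rw [h1]; nlinarith
  · rw [h1]; nlinarith

lemma Qd_zero (x : Euc n) : Qd a 0 x = bl a x x / 2 := by simp [Qd]

lemma Qd_scale (x : Euc n) (t : ℝ) : Qd a 0 (x + t • (-x)) = (1 - t)^2 * Qd a 0 x := by
  rw [Qd_line, sub_zero, Qd_zero]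
  simp only [bl_neg_left, bl_neg_right]; ring

/-- line into the domain from the outer boundary -/
lemma St.outer_line (S : St n k a lam R₀ G g M₀ b h x₀ ε R u U) {y : Euc n} (hy : Qd a 0 y = R) :
    ∃ d : ℝ, 0 < d ∧ ∀ t : ℝ, 0 < t → t < d → y + t • (-y) ∈ Om a x₀ ε R ∧ R / 3 < Qd a 0 (y + t • (-y)) := by
  refine ⟨1/4, by norm_num, ?_⟩
  intro t ht0 ht1
  have hR2 := S.gf.R2
  have hR3 := S.hR
  have h1 : R / 3 < Qd a 0 (y + t • (-y)) := by
    rw [Qd_scale, hy]; nlinarith [mul_pos ht0 ht0]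
  have h2 : Qd a 0 (y + t • (-y)) < R := by
    rw [Qd_scale, hy]
    have h5 : (1 - t)^2 < 1 := by nlinarith
    have := mul_lt_mul_of_pos_right h5 (show (0:ℝ) < R by linarith)
    linarith
  refine ⟨⟨h2, ?_⟩, h1⟩
  have := S.far (x := y + t • (-y)) (by linarith)
  have := S.e1
  linarith

lemma line_cl {D : Set (Euc n)} {y v : Euc n} {d : ℝ} (hd : 0 < d) (h : ∀ t : ℝ, 0 < t → t < d → y + t • v ∈ D) :
    y ∈ closure D := by
  have hc : Tendsto (fun t : ℝ => y + t • v) (𝓝[>] 0) (𝓝 y) := by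
    have : Continuous (fun t : ℝ => y + t • v) := by fun_prop
    have := this.tendsto 0
    simp only [zero_smul, add_zero] at this
    exact this.mono_left nhdsWithin_le_nhds
  apply mem_closure_of_tendsto hc
  filter_upwards [Ioo_mem_nhdsGT hd] with t ht using h t ht.1 ht.2

lemma St.Ks_cl (S : St n k a lam R₀ G g M₀ b h x₀ ε R u U) {x : Euc n} (hx : x ∈ Ks a x₀ ε R) :
    x ∈ closure (Om a x₀ ε R) := by
  rcases hx.1.lt_or_eq with h1 | h1
  · rcases hx.2.lt_or_eq with h2 | h2
    · exact subset_closure ⟨h1, h2⟩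
    · obtain ⟨d, hd, hl⟩ := S.inner_line h2.symm
      exact line_cl hd (fun t h1 h2 => (hl t h1 h2).1)
  · obtain ⟨d, hd, hl⟩ := S.outer_line h1
    exact line_cl hd (fun t h1 h2 => (hl t h1 h2).1)

lemma St.KU (S : St n k a lam R₀ G g M₀ b h x₀ ε R u U) {x : Euc n} (hx : x ∈ Ks a x₀ ε R) : x ∈ U :=
  S.sol.hOU (S.Ks_cl hx)

lemma St.inK (S : St n k a lam R₀ G g M₀ b h x₀ ε R u U) {y : Euc n} (hy : ‖y - x₀‖ = ε) :
    y ∈ Ks a x₀ ε R := by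
  refine ⟨?_, hy.ge⟩
  have := S.near (x := y) (by rw [hy]; linarith [S.e1])
  have := S.gf.hR0; have := S.hR; have := S.gf.R2
  linarith

lemma St.outK (S : St n k a lam R₀ G g M₀ b h x₀ ε R u U) {y : Euc n} (hy : Qd a 0 y = R) :
    y ∈ Ks a x₀ ε R := by
  refine ⟨hy.le, ?_⟩
  have := S.far (x := y) (by linarith [S.hR, S.gf.R2])
  linarith [S.e1]

lemma St.cont (S : St n k a lam R₀ G g M₀ b h x₀ ε R u U) : ContinuousOn u (Ks a x₀ ε R) :=
  S.sol.sm.continuousOn.mono (fun _ hx => S.KU hx)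

/-- lower comparison -/
theorem St.lc (S : St n k a lam R₀ G g M₀ b h x₀ ε R u U) {K D : Set (Euc n)} (hK : IsClosed K) (hD : IsOpen D)
    (hDK : D ⊆ K) (hKK : K ⊆ Ks a x₀ ε R) (hDO : D ⊆ Om a x₀ ε R) {v : Euc n → ℝ} (hv : ContinuousOn v K)
    (hb : ∀ x ∈ K, x ∉ D → v x ≤ u x)
    (hL : ∀ x ∈ D, ∃ N : Matrix (Fin n) (Fin n) ℝ, N.IsHermitian ∧ MGam n (k+1) N ∧ 1 ≤ matSk n (k+1) N ∧
      ∀ e, ∃ d1, Jet v x e d1 (qf N e e)) :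
    ∀ x ∈ K, v x ≤ u x := by
  have := MP (φ := fun x => v x - u x) (K := K) (D := D) (by have := S.gf.hn; omega)
    (cpt_of_le S.gf.lam0 S.gf.la hK (fun x hx => (hKK hx).1)) hD hDK (hv.sub (S.cont.mono hKK))
    (fun x h1 h2 => sub_nonpos.2 (hb x h1 h2)) ?_
  · intro x hx; exact sub_nonpos.1 (this x hx)
  intro x hx
  obtain ⟨N, h1, h2, h3, h4⟩ := hL x hx
  obtain ⟨f, w, L⟩ := pack S.gf.hk S.sol (hDO hx)
  choose d1 hd1 using h4
  refine ⟨f, w, fun i => d1 (f i) - pd (f i) u x, fun i => qf N (f i) (f i) - pd (f i) (pd (f i) u) x, L.wpos, ?_, ?_⟩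
  · intro i
    exact (hd1 (f i)).sub (S.sol.sm.jet S.sol.hU (S.sol.mem (hDO hx)) (f i))
  · have h5 := L.cone N h1 h2 h3
    simp only [mul_sub, Finset.sum_sub_distrib]
    rw [L.tr]; linarith

/-- upper comparison -/
theorem St.uc (S : St n k a lam R₀ G g M₀ b h x₀ ε R u U) {K D : Set (Euc n)} (hK : IsClosed K) (hD : IsOpen D)
    (hDK : D ⊆ K) (hKK : K ⊆ Ks a x₀ ε R) (hDO : D ⊆ Om a x₀ ε R) {v : Euc n → ℝ} (hv : ContinuousOn v K)
    (hb : ∀ x ∈ K, x ∉ D → u x ≤ v x)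
    (hL : ∀ x ∈ D, ∃ N : Matrix (Fin n) (Fin n) ℝ, N.IsHermitian ∧ MGam n (k+1) N ∧ matSk n (k+1) N ≤ 1 ∧
      ∀ e, ∃ d1, Jet v x e d1 (qf N e e)) :
    ∀ x ∈ K, u x ≤ v x := by
  have := MP (φ := fun x => u x - v x) (K := K) (D := D) (by have := S.gf.hn; omega)
    (cpt_of_le S.gf.lam0 S.gf.la hK (fun x hx => (hKK hx).1)) hD hDK ((S.cont.mono hKK).sub hv)
    (fun x h1 h2 => sub_nonpos.2 (hb x h1 h2)) ?_
  · intro x hx; exact sub_nonpos.1 (this x hx)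
  intro x hx
  obtain ⟨N, h1, h2, h3, h4⟩ := hL x hx
  obtain ⟨f, w, lm, hw, he, htr, hc⟩ := alg S.gf.hk h1 h2
  choose d1 hd1 using h4
  have hxU := S.sol.mem (hDO hx)
  refine ⟨f, w, fun i => pd (f i) u x - d1 (f i), fun i => pd (f i) (pd (f i) u) x - qf N (f i) (f i), hw, ?_, ?_⟩
  · intro i
    exact (S.sol.sm.jet S.sol.hU hxU (f i)).sub (hd1 (f i))
  · have h5 := hc _ (hess_herm S.sol.sm S.sol.hU hxU) (S.sol.kc x (hDO hx)) (by rw [S.sol.eq x (hDO hx)]; exact h3)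
    simp only [qf_hess S.sol.sm S.sol.hU hxU] at h5
    simp only [mul_sub, Finset.sum_sub_distrib]
    have h6 : ∑ i, w i * qf N (f i) (f i) = (k+1) * matSk n (k+1) N := by
      rw [← htr]
      apply Finset.sum_congr rfl
      intro i _
      rw [he]; simp
    rw [h6]; linarith

/-- quadratic matrices as constant-coefficient `R1` -/
lemma quadN (hk : k + 1 ≤ n) {c : Fin n → ℝ} (hc : ∀ i, 0 < c i) {m : ℝ} (hm : 0 < m) :
    MGam n (k+1) (R1 (m • c) 0 (fun i => c i * (0 : Euc n) i)) ∧
    matSk n (k+1) (R1 (m • c) 0 (fun i => c i * (0 : Euc n) i)) = m^(k+1) * sg Finset.univ (k+1) c := by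
  have hσ : 0 < sg Finset.univ (k+1) c := sg_pos (by simpa) hc
  refine ⟨(barrier (X := (0 : Euc n)) hk hc hm le_rfl (h := ∑ i, c i * sg (Finset.univ.erase i) k c) (t := 0) ?_ ?_ ?_).1, ?_⟩
  · intro i
    exact Finset.single_le_sum (f := fun i => c i * sg (Finset.univ.erase i) k c)
      (fun j _ => mul_nonneg (hc j).le (sg_nonneg hc)) (Finset.mem_univ i)
  · simp
  · simp; positivity
  · rw [matSk_bar hk]; ring

end GEO

open scoped Classical Topology
open Real Filter MeasureTheory

section CRUDE
variable {n k : ℕ} {a : Fin n → ℝ} {lam R₀ : ℝ} {G g : ℝ → ℝ} {M₀ b h : ℝ} {x₀ : Euc n} {ε R : ℝ}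
    {u : Euc n → ℝ} {U : Set (Euc n)}

lemma jetN (c : Fin n → ℝ) (p x e : Euc n) {G g : ℝ → ℝ} {g' : ℝ}
    (hG : ∀ᶠ t in 𝓝 (Qd c p x), HasDerivAt G (g t) t) (hg : HasDerivAt g g' (Qd c p x)) :
    Jet (fun y => G (Qd c p y)) x e (g (Qd c p x) * bl c (x - p) e)
      (qf (R1 (g (Qd c p x) • c) g' (fun i => c i * (x - p) i)) e e) := by
  rw [qf_R1]
  exact Jet.compQ c p x e hG hg

lemma jetQ (c : Fin n → ℝ) (p x e : Euc n) (m r : ℝ) :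
    Jet (fun y => m * Qd c p y + r) x e (m * bl c (x - p) e)
      (qf (R1 (m • c) 0 (fun i => c i * (0 : Euc n) i)) e e) := by
  rw [qf_R1]
  have := ((Jet.quad c p x e).cmul m).add (Jet.const x e r)
  simpa using this

lemma sum_Qd (c : Fin n → ℝ) (p x : Euc n) : ∑ i, c i * ((x - p) i) ^ 2 = 2 * Qd c p x := by
  unfold Qd bl
  rw [mul_div_cancel₀ _ two_ne_zero]
  apply Finset.sum_congr rfl; intro i _; ring

lemma St.low1 (S : St n k a lam R₀ G g M₀ b h x₀ ε R u U) {x : Euc n} (hx : x ∈ Ks a x₀ ε R) :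
    Qd a 0 x - 2 * ∑ i, a i ≤ u x := by
  have h1 := S.lc (v := fun x => 1 * Qd a 0 x + (- (2 * ∑ i, a i))) Ks_closed Om_open Om_sub_Ks subset_rfl subset_rfl
    (((Qd_cont a 0).const_smul (1:ℝ) |>.add continuous_const).continuousOn) ?_ ?_ x hx
  · simp only [one_mul] at h1; linarith
  · intro x hx hxn
    simp only [one_mul]
    by_cases h2 : ε < ‖x - x₀‖
    · have h3 : Qd a 0 x = R := le_antisymm hx.1 (not_lt.1 (fun h => hxn ⟨h, h2⟩))
      rw [S.uR x h3, h3]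
      have := S.gf.GR R (by linarith [S.hR, S.gf.R2])
      linarith [S.gf.sa]
    · have h3 : ‖x - x₀‖ = ε := le_antisymm (not_lt.1 h2) hx.2
      rw [S.u0 x h3]
      have := S.near (x := x) (by rw [h3]; linarith [S.e1])
      linarith
  · intro x _
    have := quadN S.gf.hk S.ha one_pos
    exact ⟨_, R1_herm _ _ _, this.1, by rw [this.2, S.gf.sig]; simp, fun e => ⟨_, jetQ a 0 x e 1 _⟩⟩

lemma St.up4 (S : St n k a lam R₀ G g M₀ b h x₀ ε R u U) {x : Euc n} (hx : x ∈ Ks a x₀ ε R) :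
    u x ≤ Qd a 0 x + (G R - R) := by
  have hGR := S.gf.GR R (by linarith [S.hR, S.gf.R2])
  have h1 := S.uc (v := fun x => 1 * Qd a 0 x + (G R - R)) Ks_closed Om_open Om_sub_Ks subset_rfl subset_rfl
    (((Qd_cont a 0).const_smul (1:ℝ) |>.add continuous_const).continuousOn) ?_ ?_ x hx
  · simp only [one_mul] at h1; linarith
  · intro x hx hxn
    simp only [one_mul]
    by_cases h2 : ε < ‖x - x₀‖
    · have h3 : Qd a 0 x = R := le_antisymm hx.1 (not_lt.1 (fun h => hxn ⟨h, h2⟩))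
      rw [S.uR x h3, h3]
      linarith
    · have h3 : ‖x - x₀‖ = ε := le_antisymm (not_lt.1 h2) hx.2
      rw [S.u0 x h3, Qd_zero]
      have := bl_nonneg S.ha x
      linarith
  · intro x _
    have := quadN S.gf.hk S.ha one_pos
    exact ⟨_, R1_herm _ _ _, this.1, by rw [this.2, S.gf.sig]; simp, fun e => ⟨_, jetQ a 0 x e 1 _⟩⟩

lemma St.low2 (S : St n k a lam R₀ G g M₀ b h x₀ ε R u U) {x : Euc n} (hx1 : R₀ ≤ Qd a 0 x) (hx2 : Qd a 0 x ≤ R) :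
    G (Qd a 0 x) ≤ u x := by
  have hR2 := S.gf.R2
  have hKs : ∀ x, R₀ ≤ Qd a 0 x → Qd a 0 x ≤ R → x ∈ Ks a x₀ ε R := fun x h1 h2 =>
    ⟨h2, by linarith [S.far h1, S.e1]⟩
  refine S.lc (v := fun x => G (Qd a 0 x)) (K := {x | R₀ ≤ Qd a 0 x ∧ Qd a 0 x ≤ R})
    (D := {x | R₀ < Qd a 0 x ∧ Qd a 0 x < R}) ?_ ?_ ?_ ?_ ?_ ?_ ?_ ?_ x ⟨hx1, hx2⟩
  · exact (isClosed_le continuous_const (Qd_cont a 0)).inter (isClosed_le (Qd_cont a 0) continuous_const)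
  · exact (isOpen_lt continuous_const (Qd_cont a 0)).inter (isOpen_lt (Qd_cont a 0) continuous_const)
  · exact fun x hx => ⟨hx.1.le, hx.2.le⟩
  · exact fun x hx => hKs x hx.1 hx.2
  · exact fun x hx => ⟨hx.2, by linarith [S.far hx.1.le, S.e1]⟩
  · intro x hx
    have h1 : 0 < Qd a 0 x := by have := hx.1; linarith
    exact ((S.gf.dG _ h1).continuousAt.comp (Qd_cont a 0).continuousAt).continuousWithinAt
  · intro x hx hxn
    by_cases h1 : R₀ < Qd a 0 x
    · have h3 : Qd a 0 x = R := le_antisymm hx.2 (not_lt.1 (fun h => hxn ⟨h1, h⟩))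
      rw [S.uR x h3, h3]
    · have h3 : Qd a 0 x = R₀ := le_antisymm (not_lt.1 h1) hx.1
      rw [h3, S.gf.G0]
      have := S.low1 (hKs x hx.1 hx.2)
      have := S.gf.hR0
      linarith
  · intro x hx
    have h1 : 0 < Qd a 0 x := by have := hx.1; linarith
    obtain ⟨g', hg', hneg, hpos, hge⟩ := S.gf.dg _ h1
    have hb := barrier (X := (x - 0 : Euc n)) (t := Qd a 0 x) (g := g (Qd a 0 x)) (h := h) S.gf.hk S.ha (by linarith [S.gf.g1 _ h1]) hneg S.gf.hh
      (sum_Qd a 0 x) (by rw [S.gf.sig, mul_one]; exact hpos)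
    rw [S.gf.sig, mul_one] at hb
    refine ⟨_, R1_herm _ _ _, hb.1, hge.trans hb.2, fun e => ⟨_, jetN a 0 x e (g := g) ?_ hg'⟩⟩
    filter_upwards [lt_mem_nhds h1] with t ht using S.gf.dG t ht

lemma sg_ones_ge (hk : k + 1 ≤ n) : 1 ≤ sg (Finset.univ : Finset (Fin n)) (k+1) (fun _ => (1:ℝ)) := by
  rw [sg_ones]
  have : 0 < (Finset.univ : Finset (Fin n)).card.choose (k+1) := Nat.choose_pos (by simpa)
  exact_mod_cast this

lemma St.low3 (S : St n k a lam R₀ G g M₀ b h x₀ ε R u U) {x : Euc n} (hx1 : ε ≤ ‖x - x₀‖) (hx2 : Qd a 0 x ≤ 2 * R₀) :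
    ‖x - x₀‖^2 - ε^2 ≤ u x := by
  have hR2 := S.gf.R2
  have hR3 := S.hR
  have h1 := S.lc (v := fun x => 2 * Qd (fun _ => 1) x₀ x + (-ε^2)) (K := {x | ε ≤ ‖x - x₀‖ ∧ Qd a 0 x ≤ 2 * R₀})
    (D := {x | ε < ‖x - x₀‖ ∧ Qd a 0 x < 2 * R₀}) ?_ ?_ ?_ ?_ ?_ ?_ ?_ ?_ x ⟨hx1, hx2⟩
  · rw [Qd_one] at h1; linarith
  · exact (isClosed_le continuous_const (continuous_id.sub continuous_const).norm).inter (isClosed_le (Qd_cont a 0) continuous_const)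
  · exact (isOpen_lt continuous_const (continuous_id.sub continuous_const).norm).inter (isOpen_lt (Qd_cont a 0) continuous_const)
  · exact fun x hx => ⟨hx.1.le, hx.2.le⟩
  · exact fun x hx => ⟨by have := hx.2; linarith, hx.1⟩
  · exact fun x hx => ⟨by have := hx.2; linarith, hx.1⟩
  · exact ((Qd_cont _ _).const_smul (2:ℝ) |>.add continuous_const).continuousOn
  · intro x hx hxn
    simp only [Qd_one]
    by_cases h2 : ε < ‖x - x₀‖
    · have h3 : Qd a 0 x = 2 * R₀ := le_antisymm hx.2 (not_lt.1 (fun h => hxn ⟨h2, h⟩))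
      have h4 := S.low2 (x := x) (by linarith) (by linarith)
      rw [h3] at h4
      have h5 := S.gf.G2
      have h6 := Qd_norm S.gf.la x
      rw [h3] at h6
      have h7 : ‖x‖^2 ≤ 4 * R₀ / lam := by
        rw [le_div_iff₀ S.gf.lam0]; linarith
      have h8 : ‖x - x₀‖ ≤ ‖x‖ + 1/2 := (norm_sub_le _ _).trans (by linarith [S.hx0])
      have h9 : ‖x - x₀‖^2 ≤ 2 * ‖x‖^2 + 1/2 := by
        nlinarith [norm_nonneg (x - x₀), sq_nonneg (‖x‖ - 1/2), norm_nonneg x]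
      have h10 : 8 * R₀ / lam = 2 * (4 * R₀ / lam) := by ring
      nlinarith [sq_nonneg ε]
    · have h3 : ‖x - x₀‖ = ε := le_antisymm (not_lt.1 h2) hx.1
      rw [S.u0 x h3, h3]; linarith
  · intro x _
    have := quadN (c := fun _ => 1) S.gf.hk (fun _ => one_pos) (m := 2) two_pos
    refine ⟨_, R1_herm _ _ _, this.1, ?_, fun e => ⟨_, jetQ (fun _ => 1) x₀ x e 2 _⟩⟩
    rw [this.2]
    have h2 := sg_ones_ge S.gf.hk
    have h3 : (1:ℝ) ≤ 2^(k+1) := one_le_pow₀ (by norm_num)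
    nlinarith

end CRUDE

open scoped Classical Topology
open Real Filter MeasureTheory

section RADIAL

/-- explicit antiderivative of `(2t)^(-κ)` -/
noncomputable def Pf (κ t : ℝ) : ℝ := if κ = 1 then Real.log (2 * t) / 2 else (2 * t) ^ (1 - κ) / (2 * (1 - κ))

lemma gx_deriv (κ : ℝ) {t : ℝ} (ht : 0 < t) :
    HasDerivAt (fun t : ℝ => (2 * t) ^ (-κ)) (-2 * κ * (2 * t) ^ (-κ) / (2 * t)) t := by
  have h1 : HasDerivAt (fun t : ℝ => 2 * t) 2 t := by simpa using (hasDerivAt_id t).const_mul 2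
  have := h1.rpow_const (p := -κ) (Or.inl (by positivity))
  convert this using 1
  rw [Real.rpow_sub_one (by positivity)]; ring

lemma Pf_deriv (κ : ℝ) {t : ℝ} (ht : 0 < t) : HasDerivAt (Pf κ) ((2 * t) ^ (-κ)) t := by
  have h1 : HasDerivAt (fun t : ℝ => 2 * t) 2 t := by simpa using (hasDerivAt_id t).const_mul 2
  unfold Pf
  by_cases h : κ = 1
  · simp only [h, if_true]
    have := (h1.log (by positivity)).div_const 2
    have he : (2 * t) ^ (-1 : ℝ) = 2 / (2 * t) / 2 := by rw [Real.rpow_neg_one]; field_simp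
    rw [he]; exact this
  · simp only [h, if_false]
    have h2 := h1.rpow_const (p := 1 - κ) (Or.inl (by positivity))
    have := h2.div_const (2 * (1 - κ))
    have hk : 1 - κ ≠ 0 := fun h' => h (by linarith)
    have he : (2 * t) ^ (-κ) = 2 * (1 - κ) * (2 * t) ^ (1 - κ - 1) / (2 * (1 - κ)) := by
      rw [show 1 - κ - 1 = -κ by ring]; field_simp
    rw [he]; exact this

lemma Pf_mvt (κ : ℝ) {s t : ℝ} (hs : 0 < s) (hst : s < t) :
    ∃ c, s < c ∧ c < t ∧ Pf κ t - Pf κ s = (2 * c) ^ (-κ) * (t - s) := by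
  obtain ⟨c, hc, h⟩ := exists_hasDerivAt_eq_slope (Pf κ) (fun t => (2 * t) ^ (-κ)) hst
    (fun x hx => (Pf_deriv κ (hs.trans_le hx.1)).continuousAt.continuousWithinAt)
    (fun x hx => Pf_deriv κ (hs.trans hx.1))
  refine ⟨c, hc.1, hc.2, ?_⟩
  rw [h]; field_simp [sub_ne_zero.2 hst.ne']

lemma Pf_upper {κ : ℝ} (hκ : 0 ≤ κ) {s t : ℝ} (hs : 0 < s) (hst : s ≤ t) :
    Pf κ t - Pf κ s ≤ (2 * s) ^ (-κ) * (t - s) := by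
  rcases hst.eq_or_lt with rfl | h
  · simp
  obtain ⟨c, h1, h2, h3⟩ := Pf_mvt κ hs h
  rw [h3]
  apply mul_le_mul_of_nonneg_right _ (by linarith)
  exact Real.rpow_le_rpow_of_nonpos (by positivity) (by linarith) (by linarith)

lemma Pf_lower {κ : ℝ} (hκ : 0 ≤ κ) {s t : ℝ} (hs : 0 < s) (hst : s ≤ t) :
    (2 * t) ^ (-κ) * (t - s) ≤ Pf κ t - Pf κ s := by
  rcases hst.eq_or_lt with rfl | h
  · simp
  obtain ⟨c, h1, h2, h3⟩ := Pf_mvt κ hs h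
  rw [h3]
  apply mul_le_mul_of_nonneg_right _ (by linarith)
  exact Real.rpow_le_rpow_of_nonpos (by linarith) (by linarith) (by linarith)

lemma Pf_mono {κ : ℝ} (hκ : 0 ≤ κ) {s t : ℝ} (hs : 0 < s) (hst : s ≤ t) : Pf κ s ≤ Pf κ t := by
  have := Pf_lower hκ hs hst
  have h2 : 0 ≤ (2 * t) ^ (-κ) * (t - s) := mul_nonneg (Real.rpow_nonneg (by linarith) _) (by linarith)
  linarith

noncomputable def Ph (κ ε t : ℝ) : ℝ := Pf κ t - Pf κ (ε^2/2)
noncomputable def Kf (κ ε : ℝ) : ℝ := (ε^2) ^ (-κ) / Ph κ ε (1/2)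

lemma Ph_nonneg {κ ε : ℝ} (hκ : 0 ≤ κ) (he : 0 < ε) {t : ℝ} (ht : ε^2/2 ≤ t) : 0 ≤ Ph κ ε t :=
  sub_nonneg.2 (Pf_mono hκ (by positivity) ht)

lemma Ph_pos {κ ε : ℝ} (hκ : 0 ≤ κ) (he : 0 < ε) {t : ℝ} (ht : ε^2/2 < t) : 0 < Ph κ ε t := by
  have := Pf_lower hκ (show 0 < ε^2/2 by positivity) ht.le
  have h2 : 0 < (2 * t) ^ (-κ) * (t - ε^2/2) :=
    mul_pos (Real.rpow_pos_of_pos (by nlinarith [sq_nonneg ε]) _) (by linarith)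
  unfold Ph; linarith

lemma Ph_half {κ ε : ℝ} (hκ : 0 ≤ κ) (he : 0 < ε) (he1 : ε < 1/2) : 0 < Ph κ ε (1/2) :=
  Ph_pos hκ he (by nlinarith)

lemma Kf_two {κ ε : ℝ} (hκ : 0 ≤ κ) (he : 0 < ε) (he1 : ε < 1/2) : 2 ≤ Kf κ ε := by
  have h0 := Ph_half hκ he he1
  have h1 := Pf_upper hκ (show 0 < ε^2/2 by positivity) (show ε^2/2 ≤ 1/2 by nlinarith)
  rw [Kf, le_div_iff₀ h0]
  rw [show 2 * (ε^2/2) = ε^2 by ring] at h1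
  have h2 : 0 < (ε^2) ^ (-κ) := Real.rpow_pos_of_pos (by positivity) _
  have h3 : (ε^2) ^ (-κ) * (1/2 - ε^2/2) ≤ (ε^2) ^ (-κ) * (1/2) :=
    mul_le_mul_of_nonneg_left (by nlinarith [sq_nonneg ε]) h2.le
  unfold Ph; linarith

lemma Kf_one {κ ε : ℝ} (hκ : 1/2 ≤ κ) (he : 0 < ε) (he1 : ε < 1/2) : 1 ≤ Kf κ ε * ε := by
  have h0 := Ph_half (by linarith : 0 ≤ κ) he he1
  rw [Kf, div_mul_eq_mul_div, le_div_iff₀ h0, one_mul]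
  have hm : AntitoneOn (fun t => Pf κ t - (ε^2)^(1/2-κ) * Real.sqrt (2 * t)) (Set.Icc (ε^2/2) (1/2)) := by
    apply antitoneOn_of_hasDerivWithinAt_nonpos (f' := fun t => (2*t)^(-κ) - (ε^2)^(1/2-κ) * (2 / (2 * Real.sqrt (2*t)))) (convex_Icc _ _)
    · intro t ht
      have ht0 : 0 < t := lt_of_lt_of_le (by positivity) ht.1
      apply ContinuousAt.continuousWithinAt
      exact (Pf_deriv κ ht0).continuousAt.sub (by fun_prop)
    · intro t ht
      rw [interior_Icc] at ht
      have ht0 : 0 < t := lt_trans (by positivity) ht.1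
      apply HasDerivAt.hasDerivWithinAt
      apply (Pf_deriv κ ht0).sub
      apply HasDerivAt.const_mul
      have h1 : HasDerivAt (fun t : ℝ => 2 * t) 2 t := by simpa using (hasDerivAt_id t).const_mul 2
      exact h1.sqrt (by positivity)
    · intro t ht
      rw [interior_Icc] at ht
      have ht0 : 0 < t := lt_trans (by positivity) ht.1
      have h1 : (2*t)^(-κ) = (2*t)^(1/2-κ) * (2*t)^(-(1/2):ℝ) := by
        rw [← Real.rpow_add (by positivity)]; congr 1; ring
      have h2 : 2 / (2 * Real.sqrt (2*t)) = (2*t)^(-(1/2):ℝ) := by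
        rw [Real.rpow_neg (by positivity), ← Real.sqrt_eq_rpow]; field_simp
      rw [h1, h2, ← sub_mul]
      apply mul_nonpos_of_nonpos_of_nonneg _ (by positivity)
      have : (2*t)^(1/2-κ) ≤ (ε^2)^(1/2-κ) :=
        Real.rpow_le_rpow_of_nonpos (by positivity) (by linarith [ht.1]) (by linarith)
      linarith
  have h1 := hm (Set.left_mem_Icc.2 (by nlinarith)) (Set.right_mem_Icc.2 (by nlinarith)) (show ε^2/2 ≤ 1/2 by nlinarith)
  simp only at h1
  rw [show (2:ℝ) * (1/2) = 1 by norm_num, Real.sqrt_one] at h1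
  have h2 : (ε^2)^(1/2-κ) = (ε^2)^(-κ) * ε := by
    rw [show 1/2 - κ = -κ + 1/2 by ring, Real.rpow_add (by positivity), ← Real.sqrt_eq_rpow, Real.sqrt_sq he.le]
  have h3 : 0 ≤ (ε^2)^(1/2-κ) * Real.sqrt (2 * (ε^2/2)) := by positivity
  unfold Ph; linarith

lemma Ph_two {κ ε : ℝ} (hκ : 0 ≤ κ) (he : 0 < ε) : (ε^2)^(-κ) * (4^(-κ) * ε^2) ≤ Ph κ ε (2 * ε^2) := by
  have h1 := Pf_lower hκ (show 0 < ε^2/2 by positivity) (show ε^2/2 ≤ 2 * ε^2 by nlinarith [sq_nonneg ε])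
  have h2 : (2 * (2 * ε^2))^(-κ) = 4^(-κ) * (ε^2)^(-κ) := by
    rw [← Real.mul_rpow (by norm_num) (by positivity)]; congr 1; ring
  rw [h2] at h1
  have h3 : 0 ≤ (4:ℝ)^(-κ) * (ε^2)^(-κ) * ε^2 := by positivity
  unfold Ph
  nlinarith

lemma Kf_sq {κ ε : ℝ} (hκ : 0 ≤ κ) (he : 0 < ε) (he1 : ε < 1/2) : Kf κ ε * ε^2 ≤ 4^κ := by
  have h0 := Ph_half hκ he he1
  rw [Kf, div_mul_eq_mul_div, div_le_iff₀ h0]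
  have h1 := Ph_two hκ he
  have h2 : Ph κ ε (2 * ε^2) ≤ Ph κ ε (1/2) := by
    have := Pf_mono hκ (show 0 < 2 * ε^2 by positivity) (show 2 * ε^2 ≤ 1/2 by nlinarith)
    unfold Ph; linarith
  have h3 : (4:ℝ)^κ * 4^(-κ) = 1 := by rw [← Real.rpow_add (by norm_num)]; simp
  have h4 : (4:ℝ)^κ * ((ε^2)^(-κ) * (4^(-κ) * ε^2)) ≤ 4^κ * Ph κ ε (1/2) :=
    mul_le_mul_of_nonneg_left (h1.trans h2) (by positivity)
  have h5 : (4:ℝ)^κ * ((ε^2)^(-κ) * (4^(-κ) * ε^2)) = (4^κ * 4^(-κ)) * ((ε^2)^(-κ) * ε^2) := by ring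
  rw [h5, h3, one_mul] at h4
  exact h4

/-- relation of `Kf` to the announced constant -/
lemma Kf_gt {κ ε : ℝ} (hκ : 1 < κ) (he : 0 < ε) (he1 : ε < 1/2) :
    Kf κ ε ≤ (2 * κ - 2) * ε⁻¹ * ε⁻¹ / (1 - (1/4)^(κ-1)) := by
  have h0 := Ph_half (by linarith : 0 ≤ κ) he he1
  have hne : κ ≠ 1 := hκ.ne'
  have h1 : Ph κ ε (1/2) = ((ε^2)^(1-κ) - 1) / (2 * (κ - 1)) := by
    unfold Ph Pf
    simp only [hne, if_false]
    rw [show (2:ℝ) * (1/2) = 1 by norm_num, Real.one_rpow, show 2 * (ε^2/2) = ε^2 by ring]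
    have : 1 - κ ≠ 0 := by intro h; apply hne; linarith
    have : κ - 1 ≠ 0 := by intro h; apply hne; linarith
    rw [show 1 - κ = -(κ - 1) by ring]; field_simp; ring
  have h2 : (ε^2)^(1-κ) = (ε^2)^(-κ) * ε^2 := by
    rw [show 1 - κ = -κ + 1 by ring, Real.rpow_add (by positivity), Real.rpow_one]
  have hq : (1/4:ℝ)^(κ-1) < 1 := Real.rpow_lt_one (by norm_num) (by norm_num) (by linarith)
  have h3 : (ε^2)^(1-κ) * (1/4:ℝ)^(κ-1) ≥ 1 := by
    have h4 : (ε^2)^(1-κ) = (1/(ε^2))^(κ-1) := by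
      rw [one_div, Real.inv_rpow (by positivity), ← Real.rpow_neg (by positivity)]; congr 1; ring
    rw [h4, ← Real.mul_rpow (by positivity) (by norm_num)]
    apply Real.one_le_rpow _ (by linarith)
    rw [one_div, inv_mul_eq_div, le_div_iff₀ (by positivity)]
    nlinarith
  rw [Kf, div_le_div_iff₀ h0 (by linarith), h1]
  have hk : 0 < κ - 1 := by linarith
  have h5 : (2 * κ - 2) * ε⁻¹ * ε⁻¹ * (((ε^2)^(1-κ) - 1) / (2 * (κ - 1))) = ((ε^2)^(1-κ) - 1) / ε^2 := by
    field_simp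
  rw [h5, le_div_iff₀ (by positivity)]
  calc (ε^2)^(-κ) * (1 - (1/4)^(κ-1)) * ε^2 = (ε^2)^(1-κ) - (ε^2)^(1-κ) * (1/4)^(κ-1) := by rw [h2]; ring
    _ ≤ _ := by linarith

lemma Kf_eq {ε : ℝ} (he : 0 < ε) (he1 : ε < 1/2) : Kf 1 ε = ε⁻¹ * |Real.log ε|⁻¹ * ε⁻¹ := by
  have hl : Real.log ε < 0 := Real.log_neg he (by linarith)
  have h1 : Ph 1 ε (1/2) = |Real.log ε| := by
    unfold Ph Pf
    simp only [if_true]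
    rw [show (2:ℝ) * (1/2) = 1 by norm_num, Real.log_one, show 2 * (ε^2/2) = ε^2 by ring, Real.log_pow, abs_of_neg hl]
    push_cast; ring
  rw [Kf, h1, Real.rpow_neg_one]
  field_simp

lemma Kf_lt {κ ε : ℝ} (hκ0 : 0 < κ) (hκ : κ < 1) (he : 0 < ε) (he1 : ε < 1/2) :
    Kf κ ε ≤ (2 - 2 * κ) * ε ^ (1 - 2 * κ) * ε⁻¹ / (1 - (1/4)^(1-κ)) := by
  have h0 := Ph_half hκ0.le he he1
  have hne : κ ≠ 1 := hκ.ne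
  have h1 : Ph κ ε (1/2) = (1 - (ε^2)^(1-κ)) / (2 * (1 - κ)) := by
    unfold Ph Pf
    simp only [hne, if_false]
    rw [show (2:ℝ) * (1/2) = 1 by norm_num, Real.one_rpow, show 2 * (ε^2/2) = ε^2 by ring]
    ring
  have h2 : (ε^2)^(-κ) = ε ^ (1 - 2 * κ) * ε⁻¹ := by
    rw [← Real.rpow_natCast, ← Real.rpow_mul he.le, ← Real.rpow_neg_one ε, ← Real.rpow_add he]
    congr 1; push_cast; ring
  have hq : (1/4:ℝ)^(1-κ) < 1 := Real.rpow_lt_one (by norm_num) (by norm_num) (by linarith)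
  have h3 : (ε^2)^(1-κ) ≤ (1/4:ℝ)^(1-κ) := Real.rpow_le_rpow (by positivity) (by nlinarith) (by linarith)
  have hp : 0 < (ε^2)^(-κ) := Real.rpow_pos_of_pos (by positivity) _
  rw [Kf, div_le_div_iff₀ h0 (by linarith), h1]
  have hk : 0 < 1 - κ := by linarith
  have h5 : (2 - 2 * κ) * ε ^ (1 - 2 * κ) * ε⁻¹ * ((1 - (ε^2)^(1-κ)) / (2 * (1 - κ))) = (ε^2)^(-κ) * (1 - (ε^2)^(1-κ)) := by
    rw [h2]; field_simp
  rw [h5]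
  exact mul_le_mul_of_nonneg_left (by linarith) hp.le

end RADIAL

open scoped Classical Topology
open Real Filter MeasureTheory

section RADB
variable {n k : ℕ} {a : Fin n → ℝ} {lam R₀ : ℝ} {G g : ℝ → ℝ} {M₀ b h : ℝ} {x₀ : Euc n} {ε R : ℝ}
    {u : Euc n → ℝ} {U : Set (Euc n)}

noncomputable def kap (n k : ℕ) : ℝ := n / (2 * (k + 1))

lemma kap_half (hk : k + 1 ≤ n) : 1/2 ≤ kap n k := by
  unfold kap
  rw [le_div_iff₀ (by positivity)]
  have : ((k + 1 : ℕ) : ℝ) ≤ n := by exact_mod_cast hk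
  push_cast at this; linarith

lemma kap_choose (hk : k + 1 ≤ n) : ((n-1).choose k : ℝ) * (2 * kap n k) = n.choose (k+1) := by
  obtain ⟨m, rfl⟩ : ∃ m, n = m + 1 := ⟨n - 1, by omega⟩
  have := Nat.add_one_mul_choose_eq m k
  have h2 : ((m + 1 : ℕ) : ℝ) * m.choose k = (m+1).choose (k+1) * ((k + 1 : ℕ) : ℝ) := by exact_mod_cast this
  push_cast at h2
  unfold kap
  rw [Nat.add_sub_cancel]
  push_cast
  field_simp
  linarith

noncomputable def radN (n k : ℕ) (x₀ : Euc n) (δ c : ℝ) (x : Euc n) : Matrix (Fin n) (Fin n) ℝ :=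
  R1 ((δ + c * (2 * Qd (fun _ => 1) x₀ x) ^ (-kap n k)) • (fun _ => (1:ℝ)))
    (c * (-2 * kap n k * (2 * Qd (fun _ => 1) x₀ x) ^ (-kap n k) / (2 * Qd (fun _ => 1) x₀ x)))
    (fun i => (fun _ => (1:ℝ)) i * (x - x₀) i)

lemma rad (hk : k + 1 ≤ n) {δ c : ℝ} (hδ : 0 < δ) (hc : 0 ≤ c) {x : Euc n} (ht : 0 < Qd (fun _ => 1) x₀ x) :
    (radN n k x₀ δ c x).IsHermitian ∧ MGam n (k+1) (radN n k x₀ δ c x) ∧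
    matSk n (k+1) (radN n k x₀ δ c x) = n.choose (k+1) * δ * (δ + c * (2 * Qd (fun _ => 1) x₀ x) ^ (-kap n k)) ^ k := by
  set t := Qd (fun _ => 1) x₀ x with htd
  have hκ := kap_half hk
  have hp : 0 < (2 * t) ^ (-kap n k) := Real.rpow_pos_of_pos (by positivity) _
  have hch : (0:ℝ) < n.choose (k+1) := by exact_mod_cast Nat.choose_pos hk
  have hcard : ∀ i : Fin n, (Finset.univ.erase i).card = n - 1 := by intro i; simp
  have hkey : (δ + c * (2 * t) ^ (-kap n k)) * n.choose (k+1) +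
      2 * t * (c * (-2 * kap n k * (2 * t) ^ (-kap n k) / (2 * t))) * (n-1).choose k = n.choose (k+1) * δ := by
    rw [← kap_choose hk]
    field_simp
    ring
  have hones : sg (Finset.univ : Finset (Fin n)) (k+1) (fun _ => (1:ℝ)) = n.choose (k+1) := by
    rw [sg_ones]; simp
  refine ⟨R1_herm _ _ _, ?_, ?_⟩
  · apply (barrier (X := (x - x₀ : Euc n)) (t := t) (h := (n-1).choose k) hk (fun _ => one_pos) (by positivity) ?_ ?_
      (sum_Qd (fun _ => 1) x₀ x) ?_).1
    · apply mul_nonpos_of_nonneg_of_nonpos hc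
      apply div_nonpos_of_nonpos_of_nonneg _ (by positivity)
      nlinarith
    · intro i; rw [sg_ones, hcard]; simp
    · rw [hones, ← htd, hkey]; positivity
  · unfold radN
    rw [matSk_bar hk, hones, ← htd]
    have : ∑ i, (1:ℝ) * (x - x₀) i ^ 2 * (1 * sg (Finset.univ.erase i) k (fun _ => (1:ℝ))) = 2 * t * (n-1).choose k := by
      rw [← sum_Qd (fun _ => 1) x₀ x, Finset.sum_mul]
      apply Finset.sum_congr rfl
      intro i _; rw [sg_ones, hcard]; ring
    rw [this, ← hkey]
    ring

lemma rad_jet (k : ℕ) (δ c d : ℝ) {x : Euc n} (ht : 0 < Qd (fun _ => 1) x₀ x) (e : Euc n) :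
    Jet (fun y => δ * (Qd (fun _ => 1) x₀ y - ε^2/2) + c * Ph (kap n k) ε (Qd (fun _ => 1) x₀ y)) x e
      ((δ + c * (2 * Qd (fun _ => 1) x₀ x) ^ (-kap n k)) * bl (fun _ => 1) (x - x₀) e)
      (qf (radN n k x₀ δ c x) e e) := by
  have h1 := jetN (fun _ => 1) x₀ x e (G := fun t => δ * (t - ε^2/2) + c * Ph (kap n k) ε t)
    (g := fun t => δ + c * (2 * t) ^ (-kap n k)) (g' := c * (-2 * kap n k * (2 * Qd (fun _ => 1) x₀ x) ^ (-kap n k) / (2 * Qd (fun _ => 1) x₀ x))) ?_ ?_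
  · exact h1
  · filter_upwards [lt_mem_nhds ht] with t ht
    have h1 : HasDerivAt (fun t => δ * (t - ε^2/2)) δ t := by
      simpa using ((hasDerivAt_id t).sub_const (ε^2/2)).const_mul δ
    exact h1.add (((Pf_deriv (kap n k) ht).sub_const _).const_mul c)
  · exact ((gx_deriv (kap n k) ht).const_mul c).const_add δ

lemma rad_cont (k : ℕ) (δ c : ℝ) {x : Euc n} (ht : 0 < Qd (fun _ => 1) x₀ x) :
    ContinuousAt (fun y => δ * (Qd (fun _ => 1) x₀ y - ε^2/2) + c * Ph (kap n k) ε (Qd (fun _ => 1) x₀ y)) x := by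
  have h1 := (Qd_cont (fun _ => (1:ℝ)) x₀).continuousAt (x := x)
  have h2 : ContinuousAt (fun y => Pf (kap n k) (Qd (fun _ => 1) x₀ y)) x :=
    ContinuousAt.comp (f := Qd (fun _ => 1) x₀) (Pf_deriv (kap n k) ht).continuousAt h1
  unfold Ph
  exact (continuousAt_const.mul (h1.sub continuousAt_const)).add (continuousAt_const.mul (h2.sub continuousAt_const))

lemma Qd_pos_of {x : Euc n} (he : 0 < ε) (hx : ε ≤ ‖x - x₀‖) : ε^2/2 ≤ Qd (fun _ => 1) x₀ x := by
  rw [Qd_one]; nlinarith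

lemma St.annK (S : St n k a lam R₀ G g M₀ b h x₀ ε R u U) {x : Euc n} (h1 : ε ≤ ‖x - x₀‖) (h2 : ‖x - x₀‖ ≤ 1) :
    x ∈ Ks a x₀ ε R :=
  ⟨by have := S.near h2; have := S.gf.hR0; have := S.hR; have := S.gf.R2; linarith, h1⟩

lemma St.annO (S : St n k a lam R₀ G g M₀ b h x₀ ε R u U) {x : Euc n} (h1 : ε < ‖x - x₀‖) (h2 : ‖x - x₀‖ ≤ 1) :
    x ∈ Om a x₀ ε R :=
  ⟨by have := S.near h2; have := S.gf.hR0; have := S.hR; have := S.gf.R2; linarith, h1⟩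

lemma St.hκ (S : St n k a lam R₀ G g M₀ b h x₀ ε R u U) : 0 ≤ kap n k := by
  have := kap_half S.gf.hk; linarith

lemma ann_closed {r s : ℝ} : IsClosed {x : Euc n | r ≤ ‖x - x₀‖ ∧ ‖x - x₀‖ ≤ s} :=
  (isClosed_le continuous_const (continuous_id.sub continuous_const).norm).inter
    (isClosed_le (continuous_id.sub continuous_const).norm continuous_const)

lemma ann_open {r s : ℝ} : IsOpen {x : Euc n | r < ‖x - x₀‖ ∧ ‖x - x₀‖ < s} :=
  (isOpen_lt continuous_const (continuous_id.sub continuous_const).norm).inter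
    (isOpen_lt (continuous_id.sub continuous_const).norm continuous_const)

/-- lower radial barrier -/
lemma St.low5 (S : St n k a lam R₀ G g M₀ b h x₀ ε R u U) {x : Euc n} (h1 : ε ≤ ‖x - x₀‖) (h2 : ‖x - x₀‖ ≤ 1) :
    1 * (Qd (fun _ => 1) x₀ x - ε^2/2) + (1 / (4 * Ph (kap n k) ε (1/2))) * Ph (kap n k) ε (Qd (fun _ => 1) x₀ x) ≤ u x := by
  have hκ := S.hκ
  have he := S.e0
  have hP := Ph_half hκ S.e0 S.e1
  have ht : ∀ x : Euc n, ε ≤ ‖x - x₀‖ → 0 < Qd (fun _ => 1) x₀ x := fun x hx =>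
    lt_of_lt_of_le (by positivity) (Qd_pos_of S.e0 hx)
  refine S.lc (v := fun x => 1 * (Qd (fun _ => 1) x₀ x - ε^2/2) + (1 / (4 * Ph (kap n k) ε (1/2))) * Ph (kap n k) ε (Qd (fun _ => 1) x₀ x))
    ann_closed ann_open (fun x hx => ⟨hx.1.le, hx.2.le⟩) (fun x hx => S.annK hx.1 hx.2) (fun x hx => S.annO hx.1 hx.2.le)
    ?_ ?_ ?_ x ⟨h1, h2⟩
  · intro x hx
    exact (rad_cont k 1 _ (ht x hx.1)).continuousWithinAt
  · intro x hx hxn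
    by_cases h3 : ε < ‖x - x₀‖
    · have h4 : ‖x - x₀‖ = 1 := le_antisymm hx.2 (not_lt.1 (fun h => hxn ⟨h3, h⟩))
      have h5 := S.low3 hx.1 (by have := S.near hx.2; have := S.gf.hR0; have := S.gf.R2; linarith)
      rw [h4] at h5
      have h6 : Qd (fun _ => 1) x₀ x = 1/2 := by rw [Qd_one, h4]; norm_num
      rw [h6]
      have h7 : 1 / (4 * Ph (kap n k) ε (1/2)) * Ph (kap n k) ε (1/2) = 1/4 := by field_simp
      rw [h7]
      have : ε^2 < 1/4 := by nlinarith [S.e1]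
      linarith
    · have h4 : ‖x - x₀‖ = ε := le_antisymm (not_lt.1 h3) hx.1
      have h6 : Qd (fun _ => 1) x₀ x = ε^2/2 := by rw [Qd_one, h4]
      rw [h6, S.u0 x h4]
      simp [Ph]
  · intro x hx
    have h3 := ht x hx.1.le
    have hr := rad S.gf.hk (δ := 1) (c := 1 / (4 * Ph (kap n k) ε (1/2))) one_pos (by positivity) h3
    refine ⟨_, hr.1, hr.2.1, ?_, fun e => ⟨_, rad_jet k 1 _ 0 h3 e⟩⟩
    rw [hr.2.2]
    have hch : (1:ℝ) ≤ n.choose (k+1) := by exact_mod_cast Nat.choose_pos S.gf.hk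
    have h5 : 1 ≤ (1 + 1 / (4 * Ph (kap n k) ε (1/2)) * (2 * Qd (fun _ => 1) x₀ x) ^ (-kap n k)) ^ k := by
      apply one_le_pow₀
      have : 0 ≤ 1 / (4 * Ph (kap n k) ε (1/2)) * (2 * Qd (fun _ => 1) x₀ x) ^ (-kap n k) := by positivity
      linarith
    nlinarith

lemma GF.M0 (H : GF n k a lam R₀ G g M₀ b h) : 0 ≤ M₀ := by
  have h1 := H.GR (2 * R₀) le_rfl
  have h2 := H.GM (2 * R₀) le_rfl
  linarith

/-- upper radial barrier -/
lemma St.up6 (S : St n k a lam R₀ G g M₀ b h x₀ ε R u U) {x : Euc n} (h1 : ε ≤ ‖x - x₀‖) (h2 : ‖x - x₀‖ ≤ 1) :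
    u x ≤ 1 * (Qd (fun _ => 1) x₀ x - ε^2/2) + ((R₀ + M₀) / Ph (kap n k) ε (1/2)) * Ph (kap n k) ε (Qd (fun _ => 1) x₀ x) := by
  have hκ := S.hκ
  have he := S.e0
  have hP := Ph_half hκ S.e0 S.e1
  have hMb : 0 ≤ R₀ + M₀ := by have := S.gf.M0; have := S.gf.R2; linarith
  have ht : ∀ x : Euc n, ε ≤ ‖x - x₀‖ → 0 < Qd (fun _ => 1) x₀ x := fun x hx =>
    lt_of_lt_of_le (by positivity) (Qd_pos_of S.e0 hx)
  have hch : (1:ℝ) ≤ n.choose (k+1) := by exact_mod_cast Nat.choose_pos S.gf.hk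
  set c := (R₀ + M₀) / Ph (kap n k) ε (1/2) with hcd
  have hc : 0 ≤ c := by positivity
  set Z := (n.choose (k+1) : ℝ) * (1 + c * (ε^2) ^ (-kap n k)) ^ k with hZ
  have hq : 0 ≤ c * (ε^2) ^ (-kap n k) := by positivity
  have hZ1 : 1 ≤ Z := by
    have : 1 ≤ (1 + c * (ε^2) ^ (-kap n k)) ^ k := one_le_pow₀ (by linarith)
    nlinarith
  have hδ : 0 < 1 / Z := by positivity
  have hδ1 : 1 / Z ≤ 1 := by rw [div_le_one (by positivity)]; exact hZ1
  have key := S.uc (v := fun x => (1/Z) * (Qd (fun _ => 1) x₀ x - ε^2/2) + c * Ph (kap n k) ε (Qd (fun _ => 1) x₀ x))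
    ann_closed ann_open (fun x hx => ⟨hx.1.le, hx.2.le⟩) (fun x hx => S.annK hx.1 hx.2) (fun x hx => S.annO hx.1 hx.2.le)
    ?_ ?_ ?_ x ⟨h1, h2⟩
  · have h3 := Qd_pos_of S.e0 h1
    have h4 : (1/Z) * (Qd (fun _ => 1) x₀ x - ε^2/2) ≤ 1 * (Qd (fun _ => 1) x₀ x - ε^2/2) :=
      mul_le_mul_of_nonneg_right hδ1 (by linarith)
    linarith
  · intro x hx
    exact (rad_cont k _ _ (ht x hx.1)).continuousWithinAt
  · intro x hx hxn
    by_cases h3 : ε < ‖x - x₀‖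
    · have h4 : ‖x - x₀‖ = 1 := le_antisymm hx.2 (not_lt.1 (fun h => hxn ⟨h3, h⟩))
      have h5 := S.up4 (S.annK hx.1 hx.2)
      have h6 : Qd (fun _ => 1) x₀ x = 1/2 := by rw [Qd_one, h4]; norm_num
      rw [h6]
      have h7 : c * Ph (kap n k) ε (1/2) = R₀ + M₀ := by rw [hcd]; field_simp
      rw [h7]
      have h8 : 0 ≤ 1/Z * (1/2 - ε^2/2) := mul_nonneg hδ.le (by nlinarith [S.e1])
      have h9 := S.near hx.2
      have h10 := S.gf.GM R (by linarith [S.hR, S.gf.R2])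
      have := S.gf.hR0
      linarith
    · have h4 : ‖x - x₀‖ = ε := le_antisymm (not_lt.1 h3) hx.1
      have h6 : Qd (fun _ => 1) x₀ x = ε^2/2 := by rw [Qd_one, h4]
      rw [h6, S.u0 x h4]
      simp [Ph]
  · intro x hx
    have h3 := ht x hx.1.le
    have hr := rad S.gf.hk (δ := 1/Z) (c := c) hδ hc h3
    refine ⟨_, hr.1, hr.2.1, ?_, fun e => ⟨_, rad_jet k _ _ 0 h3 e⟩⟩
    rw [hr.2.2]
    have h5 : (1/Z + c * (2 * Qd (fun _ => 1) x₀ x) ^ (-kap n k)) ^ k ≤ (1 + c * (ε^2) ^ (-kap n k)) ^ k := by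
      apply pow_le_pow_left₀ (by positivity)
      have h6 : (2 * Qd (fun _ => 1) x₀ x) ^ (-kap n k) ≤ (ε^2) ^ (-kap n k) :=
        Real.rpow_le_rpow_of_nonpos (by positivity) (by have := Qd_pos_of S.e0 hx.1.le; linarith) (by linarith)
      have := mul_le_mul_of_nonneg_left h6 hc
      linarith
    calc (n.choose (k+1) : ℝ) * (1/Z) * (1/Z + c * (2 * Qd (fun _ => 1) x₀ x) ^ (-kap n k)) ^ k
        ≤ (n.choose (k+1) : ℝ) * (1/Z) * (1 + c * (ε^2) ^ (-kap n k)) ^ k := by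
          apply mul_le_mul_of_nonneg_left h5; positivity
      _ = Z / Z := by rw [hZ]; ring
      _ = 1 := div_self (by positivity)

end RADB

open scoped Classical Topology
open Real Filter MeasureTheory

section BDRY
variable {n k : ℕ} {u : Euc n → ℝ} {U : Set (Euc n)}

/-- second-order information from constancy on an ellipsoid, normalised tangent vector -/
lemma bl_curve (h : Sm u U) (hU : IsOpen U) {y c : Euc n} (hy : y ∈ U) {b : Fin n → ℝ} {cst : ℝ}
    (hc : ∀ x, bl b (x - c) (x - c) = bl b (y - c) (y - c) → u x = cst) {z : Euc n}
    (hz : bl b (y - c) z = 0) (hzz : bl b z z = bl b (y - c) (y - c)) :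
    pd z u y = 0 ∧ pd z (pd z u) y = pd (y - c) u y := by
  set ζ := y - c with hζ
  have hγd : ∀ s : ℝ, HasDerivAt (fun s : ℝ => c + Real.cos s • ζ + Real.sin s • z) (-Real.sin s • ζ + Real.cos s • z) s := by
    intro s
    have h1 := (Real.hasDerivAt_cos s).smul_const ζ
    have h2 := (Real.hasDerivAt_sin s).smul_const z
    exact (h1.const_add c).add h2
  have hγd2 : HasDerivAt (fun s : ℝ => -Real.sin s • ζ + Real.cos s • z) (-ζ) 0 := by
    have h1 := ((Real.hasDerivAt_sin 0).neg).smul_const ζ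
    have h2 := (Real.hasDerivAt_cos 0).smul_const z
    have e : -Real.cos 0 • ζ + -Real.sin 0 • z = -ζ := by simp
    rw [← e]
    exact h1.add h2
  have hγ0 : c + Real.cos 0 • ζ + Real.sin 0 • z = y := by simp [hζ]
  have hγU : ∀ᶠ s in 𝓝 (0:ℝ), c + Real.cos s • ζ + Real.sin s • z ∈ U := by
    have := (hγd 0).continuousAt
    apply this.eventually_mem
    simp only [hγ0]
    exact hU.mem_nhds hy
  have hconst : ∀ s : ℝ, u (c + Real.cos s • ζ + Real.sin s • z) = cst := by
    intro s
    apply hc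
    rw [show c + Real.cos s • ζ + Real.sin s • z - c = Real.cos s • ζ + Real.sin s • z by abel]
    simp only [bl_add_left, bl_add_right, bl_smul_left, bl_smul_right]
    rw [bl_comm b z ζ, hz, hzz]
    have := Real.sin_sq_add_cos_sq s
    linear_combination (bl b ζ ζ) * this
  have hF : ∀ᶠ s in 𝓝 (0:ℝ), fderiv ℝ u (c + Real.cos s • ζ + Real.sin s • z) (-Real.sin s • ζ + Real.cos s • z) = 0 := by
    filter_upwards [hγU] with s hs
    have h1 := (h.diff hU hs).hasFDerivAt.comp_hasDerivAt s (hγd s)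
    have h2 : (u ∘ fun s : ℝ => c + Real.cos s • ζ + Real.sin s • z) = fun _ => cst := funext hconst
    rw [h2] at h1
    exact h1.unique (hasDerivAt_const s cst)
  have hF0 := hF.self_of_nhds
  simp only [hγ0] at hF0
  simp at hF0
  refine ⟨hF0, ?_⟩
  have hd : HasFDerivAt (fderiv ℝ u) (fderiv ℝ (fderiv ℝ u) y) (c + Real.cos 0 • ζ + Real.sin 0 • z) := by
    rw [hγ0]; exact (h.fdiff hU hy).hasFDerivAt
  have h0 : HasDerivAt (fun s : ℝ => fderiv ℝ u (c + Real.cos s • ζ + Real.sin s • z))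
      (fderiv ℝ (fderiv ℝ u) y (-Real.sin 0 • ζ + Real.cos 0 • z)) 0 :=
    HasFDerivAt.comp_hasDerivAt (f := fun s : ℝ => c + Real.cos s • ζ + Real.sin s • z) 0 hd (hγd 0)
  have h1 := h0.clm_apply hγd2
  have h2 : HasDerivAt (fun s : ℝ => fderiv ℝ u (c + Real.cos s • ζ + Real.sin s • z) (-Real.sin s • ζ + Real.cos s • z)) 0 0 :=
    (hasDerivAt_const (0:ℝ) (0:ℝ)).congr_of_eventuallyEq hF
  have h4 := h1.unique h2
  rw [hγ0] at h4
  simp only [Real.sin_zero, Real.cos_zero, neg_zero, zero_smul, one_smul, zero_add, map_neg] at h4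
  rw [pd_pd h hU hy]
  unfold pd
  linarith

lemma bl_pos {b : Fin n → ℝ} (hb : ∀ i, 0 < b i) {z : Euc n} (hz : z ≠ 0) : 0 < bl b z z := by
  rcases (bl_nonneg hb z).lt_or_eq with h | h
  · exact h
  · exfalso
    apply hz
    have h2 : ∀ i ∈ Finset.univ, b i * z i * z i = 0 := by
      apply (Finset.sum_eq_zero_iff_of_nonneg _).1 h.symm
      intro i _
      nlinarith [mul_nonneg (hb i).le (mul_self_nonneg (z i))]
    ext i
    have h3 := h2 i (Finset.mem_univ i)
    have h4 := (hb i).ne'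
    simpa [h4] using h3

lemma pd_zero (f : Euc n → ℝ) (x : Euc n) : pd 0 f x = 0 := by simp [pd]

lemma pd2_smul (h : Sm u U) (hU : IsOpen U) {y : Euc n} (hy : y ∈ U) (s t : ℝ) (v w : Euc n) :
    pd (s • v) (pd (t • w) u) y = s * t * pd v (pd w u) y := by
  rw [pd_pd h hU hy, pd_pd h hU hy]; simp; ring

lemma pd2_add (h : Sm u U) (hU : IsOpen U) {y : Euc n} (hy : y ∈ U) (v w : Euc n) :
    pd (v + w) (pd (v + w) u) y = pd v (pd v u) y + 2 * pd w (pd v u) y + pd w (pd w u) y := by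
  have := pd_comm h hU hy v w
  rw [pd_pd h hU hy, pd_pd h hU hy] at *
  rw [pd_pd h hU hy, pd_pd h hU hy]
  simp only [map_add, _root_.add_apply] at *
  rw [this]; ring

lemma bl_bdry (h : Sm u U) (hU : IsOpen U) {y c : Euc n} (hy : y ∈ U) {b : Fin n → ℝ} (hb : ∀ i, 0 < b i) {cst : ℝ}
    (hyc : y - c ≠ 0)
    (hc : ∀ x, bl b (x - c) (x - c) = bl b (y - c) (y - c) → u x = cst) :
    (∀ v, pd v u y = pd (y - c) u y / bl b (y - c) (y - c) * bl b (y - c) v) ∧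
    (∀ z, bl b (y - c) z = 0 → pd z (pd z u) y = pd (y - c) u y / bl b (y - c) (y - c) * bl b z z) := by
  have hβ := bl_pos hb hyc
  set β := bl b (y - c) (y - c) with hβd
  have key : ∀ z, bl b (y - c) z = 0 → pd z u y = 0 ∧ pd z (pd z u) y = pd (y - c) u y / β * bl b z z := by
    intro z hz
    by_cases hz0 : z = 0
    · subst hz0
      rw [pd_zero, pd_zero]; simp [bl]
    have hμ := bl_pos hb hz0
    set s := Real.sqrt (β / bl b z z) with hs
    have hs2 : s * s = β / bl b z z := Real.mul_self_sqrt (by positivity)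
    have hs0 : 0 < s := Real.sqrt_pos.2 (by positivity)
    have hcv := bl_curve h hU hy hc (z := s • z) (by rw [bl_smul_right, hz, mul_zero])
      (by rw [bl_smul_right, bl_smul_left, ← mul_assoc, hs2]; field_simp; exact hβd)
    rw [pd_smul_left, pd2_smul h hU hy, hs2] at hcv
    refine ⟨?_, ?_⟩
    · rcases mul_eq_zero.1 hcv.1 with h' | h'
      · exact absurd h' hs0.ne'
      · exact h'
    · rw [← hcv.2]; field_simp
  refine ⟨?_, fun z hz => (key z hz).2⟩
  intro v
  have h1 : v = (bl b (y - c) v / β) • (y - c) + (v - (bl b (y - c) v / β) • (y - c)) := by abel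
  have h2 := (key (v - (bl b (y - c) v / β) • (y - c)) (by
    rw [bl_sub_right, bl_smul_right, ← hβd]; field_simp; ring)).1
  conv_lhs => rw [h1, pd_add_left, pd_smul_left, h2]
  ring

/-- double normal derivative estimate -/
theorem dbl_normal {Ω : Set (Euc n)} (hkn : k + 1 ≤ n) (h : Sol n k u U Ω) {y : Euc n} (hy : y ∈ closure Ω)
    {b : Fin n → ℝ} {lam m θ Q : ℝ} (hl : 0 < lam) (hb : ∀ i, lam ≤ b i) (hm : 0 < m)
    (hmb : ∀ i, m ≤ b i * sg (Finset.univ.erase i) k b) {ζ : Euc n} (hζ : ζ ≠ 0) (hθ : 1 ≤ θ) (hQ : 0 ≤ Q)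
    (htan : ∀ z, bl b ζ z = 0 → pd z (pd z u) y = θ * bl b z z)
    (hmix : ∀ z, bl b ζ z = 0 → (pd z (pd ζ u) y)^2 ≤ Q^2 * (bl b ζ ζ * bl b z z)) (e : Euc n) :
    pd e (pd e u) y ≤ (2 * θ + Q + 2 * Q^2/θ + 4^k/m) * bl b e e := by
  have hb0 : ∀ i, 0 < b i := fun i => hl.trans_le (hb i)
  have hβ := bl_pos hb0 hζ
  set β := bl b ζ ζ with hβd
  have hyU := h.hOU hy
  set μ := pd ζ (pd ζ u) y / β with hμ
  have hμ' : pd ζ (pd ζ u) y = μ * β := by rw [hμ]; field_simp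
  have hdec : ∀ e, ∃ (p : ℝ) (z : Euc n), bl b ζ z = 0 ∧ bl b ζ e = p * β ∧ bl b e e = p^2 * β + bl b z z ∧
      pd e (pd e u) y = p^2 * (μ * β) + 2 * p * pd z (pd ζ u) y + θ * bl b z z := by
    intro e
    set p := bl b ζ e / β with hp
    have hp' : bl b ζ e = p * β := by rw [hp]; field_simp
    have hz : bl b ζ (e - p • ζ) = 0 := by
      rw [bl_sub_right, bl_smul_right, ← hβd, hp']; ring
    have he : e = p • ζ + (e - p • ζ) := by abel
    refine ⟨p, e - p • ζ, hz, hp', ?_, ?_⟩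
    · conv_lhs => rw [he]
      generalize e - p • ζ = z at *
      simp only [bl_add_left, bl_add_right, bl_smul_left, bl_smul_right]
      rw [bl_comm b z ζ, hz]; ring
    · rw [← htan _ hz]
      conv_lhs => rw [he]
      generalize e - p • ζ = z at *
      rw [pd2_add h.sm h.hU hyU, pd2_smul h.sm h.hU hyU, hμ']
      have := pd2_smul h.sm h.hU hyU 1 p z ζ
      rw [one_smul] at this
      rw [this]; ring
  have hmixb : ∀ (p : ℝ) z, bl b ζ z = 0 → |2 * p * pd z (pd ζ u) y| ≤ Q * (p^2 * β + bl b z z) := by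
    intro p z hz
    have h1 := hmix z hz
    have h2 := bl_nonneg hb0 z
    apply abs_le_of_sq_le_sq _ (by positivity)
    have h3 : (2 * p * pd z (pd ζ u) y)^2 ≤ 4 * p^2 * (Q^2 * (β * bl b z z)) := by
      have := mul_le_mul_of_nonneg_left h1 (show 0 ≤ 4 * p^2 by positivity)
      linarith
    have h4 : 0 ≤ Q^2 * (p^2 * β - bl b z z)^2 := by positivity
    linarith
  have hmixc : ∀ (p : ℝ) z, bl b ζ z = 0 → - (2 * Q^2/θ * (p^2 * β) + θ/2 * bl b z z) ≤ 2 * p * pd z (pd ζ u) y := by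
    intro p z hz
    have h1 := hmix z hz
    have h2 := bl_nonneg hb0 z
    have h3 : |2 * p * pd z (pd ζ u) y| ≤ 2 * Q^2/θ * (p^2 * β) + θ/2 * bl b z z := by
      apply abs_le_of_sq_le_sq _ (by positivity)
      have h3 : (2 * p * pd z (pd ζ u) y)^2 ≤ 4 * p^2 * (Q^2 * (β * bl b z z)) := by
        have := mul_le_mul_of_nonneg_left h1 (show 0 ≤ 4 * p^2 by positivity)
        linarith
      have h4 : (2 * Q^2/θ * (p^2 * β) + θ/2 * bl b z z)^2 = (2 * Q^2/θ * (p^2 * β) - θ/2 * bl b z z)^2 + 4 * p^2 * (Q^2 * (β * bl b z z)) := by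
        field_simp; ring
      rw [h4]
      nlinarith [sq_nonneg (2 * Q^2/θ * (p^2 * β) - θ/2 * bl b z z)]
    linarith [(abs_le.1 h3).1]
  have hμb : μ ≤ 2 * Q^2/θ + θ/2 + 4^k/m := by
    by_contra hcon
    push Not at hcon
    have h4m : 0 < 4^k/m := by positivity
    set B := (μ - 2 * Q^2/θ - θ/2) / β with hB
    have hBβ : B * β = μ - 2 * Q^2/θ - θ/2 := by rw [hB]; field_simp
    have hB0 : 0 ≤ B := by rw [hB]; apply div_nonneg _ hβ.le; linarith
    have hup := R1_upper (X := (ζ : Euc n)) (g := θ/4) (β := B) (t := β/2) hkn hb0 (by linarith) hB0 hmb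
      (by rw [hβd, bl, mul_div_cancel₀ _ two_ne_zero]; apply Finset.sum_congr rfl; intro i _; ring)
    have hs := h.slack hkn hy (R1_herm _ _ _) hup.1 (c := θ/4 * lam) (by positivity) (by
      intro e
      obtain ⟨p, z, hz, h1, h2, h3⟩ := hdec e
      rw [qf_R1, h1, h3]
      have h4 := bl_lower hb e
      have h5 : θ/4 * lam * ‖e‖^2 ≤ θ/4 * bl b e e := by nlinarith
      have h6 := hmixc p z hz
      have h7 : B * (p * β)^2 = p^2 * β * (μ - 2 * Q^2/θ - θ/2) := by rw [← hBβ]; ring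
      rw [h7]
      rw [h2] at *
      linarith)
    have h8 : (4:ℝ)^k * (θ/4)^k * (m * (B * β)) < 4^k := by
      have h9 : (4:ℝ)^k * ((θ/4)^k * (B * (2 * (β/2) * m))) < 4^k * 1 :=
        mul_lt_mul_of_pos_left (hup.2.trans_lt hs) (by positivity)
      linarith
    rw [← mul_pow, mul_div_cancel₀ _ (by norm_num : (4:ℝ) ≠ 0)] at h8
    have h10 : 1 ≤ θ^k := one_le_pow₀ hθ
    have h11 : m * (B * β) ≤ θ^k * (m * (B * β)) := le_mul_of_one_le_left (by positivity) h10
    have h12 : B * β < 4^k/m := by rw [lt_div_iff₀ hm]; linarith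
    linarith
  obtain ⟨p, z, hz, h1, h2, h3⟩ := hdec e
  rw [h2, h3]
  have h4 := (abs_le.1 (hmixb p z hz)).2
  have h5 := bl_nonneg hb0 z
  have h6 : p^2 * (μ * β) ≤ (2 * Q^2/θ + θ/2 + 4^k/m) * (p^2 * β) := by
    have := mul_le_mul_of_nonneg_right hμb (show 0 ≤ p^2 * β by positivity)
    linarith
  have h7 : 0 ≤ 2 * Q^2/θ * bl b z z := by positivity
  have h8 : 0 ≤ 4^k/m * bl b z z := by positivity
  have h9 : 0 ≤ θ * (p^2 * β) := by positivity
  have h10 : 0 ≤ θ * bl b z z := by positivity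
  linarith

end BDRY

open scoped Classical Topology
open Real Filter MeasureTheory

section GRAD
variable {n k : ℕ} {a : Fin n → ℝ} {lam R₀ : ℝ} {G g : ℝ → ℝ} {M₀ b h : ℝ} {x₀ : Euc n} {ε R : ℝ}
    {u : Euc n → ℝ} {U : Set (Euc n)}

lemma Jet.right {φ : Euc n → ℝ} {x v : Euc n} {d1 d2 d : ℝ} (hJ : Jet φ x v d1 d2) (h0 : φ x = 0) (hd : 0 < d)
    (hp : ∀ t : ℝ, 0 < t → t < d → 0 ≤ φ (x + t • v)) : 0 ≤ d1 := by
  obtain ⟨p, hp1, hp2, _⟩ := hJ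
  have h1 := hp1.self_of_nhds
  rw [hp2] at h1
  exact deriv_nonneg_of_right (g := fun t : ℝ => φ (x + t • v)) h1 (by simp [h0]) hd hp

/-- the matrix applied to a vector -/
noncomputable def av (a : Fin n → ℝ) (z : Euc n) : Euc n := WithLp.toLp 2 (fun i => a i * z i)

lemma inner_av (z x : Euc n) : inner ℝ (av a z) x = bl a z x := by
  simp [av, bl, PiLp.inner_apply]
  apply Finset.sum_congr rfl; intro i _; ring

lemma av_norm (ha : ∀ i, 0 < a i) (z : Euc n) : ‖av a z‖ ≤ (∑ i, a i) * ‖z‖ := by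
  have h1 : ‖av a z‖^2 = bl a z (av a z) := by rw [← inner_av, real_inner_self_eq_norm_sq]
  have h2 := (le_abs_self _).trans (bl_abs ha z (av a z))
  rw [← h1] at h2
  have hs : 0 ≤ ∑ i, a i := Finset.sum_nonneg (fun i _ => (ha i).le)
  rcases (norm_nonneg (av a z)).eq_or_lt with h | h
  · rw [← h]; positivity
  · have : ‖av a z‖ * ‖av a z‖ ≤ ((∑ i, a i) * ‖z‖) * ‖av a z‖ := by rw [← sq]; exact h2
    exact le_of_mul_le_mul_right this h

lemma bl_jet (a : Fin n → ℝ) (z x v : Euc n) : Jet (fun y => bl a y z) x v (bl a v z) 0 := by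
  have := Jet.lin (av a z) 0 x v
  simp only [sub_zero, inner_av] at this
  simpa only [bl_comm a z] using this

noncomputable abbrev KK (n k : ℕ) (ε : ℝ) : ℝ := Kf (kap n k) ε

lemma St.K2 (S : St n k a lam R₀ G g M₀ b h x₀ ε R u U) : 2 ≤ KK n k ε := Kf_two S.hκ S.e0 S.e1
lemma St.K1 (S : St n k a lam R₀ G g M₀ b h x₀ ε R u U) : 1 ≤ KK n k ε * ε := Kf_one (kap_half S.gf.hk) S.e0 S.e1
lemma St.Ksq (S : St n k a lam R₀ G g M₀ b h x₀ ε R u U) : KK n k ε * ε^2 ≤ 4^(kap n k) := Kf_sq S.hκ S.e0 S.e1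

lemma St.ne_in (S : St n k a lam R₀ G g M₀ b h x₀ ε R u U) {y : Euc n} (hy : ‖y - x₀‖ = ε) : y - x₀ ≠ 0 := by
  intro h; rw [h, norm_zero] at hy; linarith [S.e0]

lemma St.ne_out (S : St n k a lam R₀ G g M₀ b h x₀ ε R u U) {y : Euc n} (hy : Qd a 0 y = R) : y - 0 ≠ 0 := by
  intro h
  rw [sub_zero] at h
  rw [h] at hy
  have : Qd a (0 : Euc n) 0 = 0 := by simp [Qd, bl]
  linarith [S.hR, S.gf.R2]

/-- inner boundary structure -/
lemma St.inB (S : St n k a lam R₀ G g M₀ b h x₀ ε R u U) {y : Euc n} (hy : ‖y - x₀‖ = ε) :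
    ∃ θ : ℝ, 1 + KK n k ε / 4 ≤ θ ∧ θ ≤ 1 + (R₀ + M₀) * KK n k ε ∧ pd (y - x₀) u y = θ * ε^2 ∧
      (∀ v, pd v u y = θ * inner ℝ (y - x₀) v) ∧
      (∀ z, inner ℝ (y - x₀) z = 0 → pd z (pd z u) y = θ * ‖z‖^2) := by
  have he := S.e0
  have hyU := S.KU (S.inK hy)
  have hone : bl (fun _ => (1:ℝ)) (y - x₀) (y - x₀) = ε^2 := by rw [one_blsq, hy]
  have hB := bl_bdry S.sol.sm S.sol.hU hyU (b := fun _ => (1:ℝ)) (fun _ => one_pos) (cst := 0) (S.ne_in hy) (by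
    intro x hx
    apply S.u0
    rw [hone, one_blsq] at hx
    have : ‖x - x₀‖^2 = ε^2 := hx
    exact (sq_eq_sq₀ (norm_nonneg _) he.le).1 this)
  rw [hone] at hB
  simp only [one_bl, one_blsq, real_inner_self_eq_norm_sq] at hB
  obtain ⟨d, hd, hl⟩ := S.inner_line hy
  have hQ : Qd (fun _ => 1) x₀ y = ε^2/2 := by rw [Qd_one, hy]
  have hQ0 : 0 < Qd (fun _ => 1) x₀ y := by rw [hQ]; positivity
  have hJu := S.sol.sm.jet S.sol.hU hyU (y - x₀)
  have hP := Ph_half S.hκ S.e0 S.e1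
  have hval : ∀ δ c : ℝ, δ * (Qd (fun _ => 1) x₀ y - ε^2/2) + c * Ph (kap n k) ε (Qd (fun _ => 1) x₀ y) = 0 := by
    intro δ c; rw [hQ]; simp [Ph]
  have hmem : ∀ t : ℝ, 0 < t → t < d → ε ≤ ‖y + t • (y - x₀) - x₀‖ ∧ ‖y + t • (y - x₀) - x₀‖ ≤ 1 := by
    intro t h1 h2
    have := hl t h1 h2
    exact ⟨this.1.2.le, by linarith [this.2, S.e1]⟩
  have hlow := (hJu.sub (rad_jet (ε := ε) k 1 (1 / (4 * Ph (kap n k) ε (1/2))) 0 hQ0 (y - x₀))).right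
    (by rw [hval, S.u0 y hy, sub_zero]) hd (by
      intro t h1 h2
      have := hmem t h1 h2
      exact sub_nonneg.2 (S.low5 this.1 this.2))
  have hup := ((rad_jet (ε := ε) k 1 ((R₀ + M₀) / Ph (kap n k) ε (1/2)) 0 hQ0 (y - x₀)).sub hJu).right
    (by rw [hval, S.u0 y hy, sub_zero]) hd (by
      intro t h1 h2
      have := hmem t h1 h2
      exact sub_nonneg.2 (S.up6 this.1 this.2))
  rw [hone, hQ, show 2 * (ε^2/2) = ε^2 by ring] at hlow hup
  refine ⟨pd (y - x₀) u y / ε^2, ?_, ?_, by field_simp, hB.1, hB.2⟩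
  · rw [le_div_iff₀ (by positivity)]
    have : KK n k ε / 4 = 1 / (4 * Ph (kap n k) ε (1/2)) * (ε^2) ^ (-kap n k) := by
      unfold KK Kf; field_simp
    rw [this]; linarith
  · rw [div_le_iff₀ (by positivity)]
    have : (R₀ + M₀) * KK n k ε = (R₀ + M₀) / Ph (kap n k) ε (1/2) * (ε^2) ^ (-kap n k) := by
      unfold KK Kf; field_simp
    rw [this]; linarith

/-- outer boundary structure -/
lemma St.outB (S : St n k a lam R₀ G g M₀ b h x₀ ε R u U) {y : Euc n} (hy : Qd a 0 y = R) :
    ∃ θ : ℝ, 1 ≤ θ ∧ (θ - 1) * R ≤ b ∧ pd y u y = θ * (2 * R) ∧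
      (∀ v, pd v u y = θ * bl a y v) ∧
      (∀ z, bl a y z = 0 → pd z (pd z u) y = θ * bl a z z) := by
  have hR0 : 0 < R := by linarith [S.hR, S.gf.R2]
  have hyU := S.KU (S.outK hy)
  have hone : bl a (y - 0) (y - 0) = 2 * R := by unfold Qd at hy; linarith
  have hB := bl_bdry S.sol.sm S.sol.hU hyU S.ha (cst := G R) (S.ne_out hy) (by
    intro x hx
    apply S.uR
    unfold Qd at *; rw [hx]; exact hy)
  rw [hone] at hB
  simp only [sub_zero] at hB hone
  obtain ⟨d, hd, hl⟩ := S.outer_line hy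
  have hJu := S.sol.sm.jet S.sol.hU hyU (-y)
  obtain ⟨g', hg', -⟩ := S.gf.dg R hR0
  have hJG := jetN a 0 y (-y) (G := G) (g := g) (g' := g') (by
    rw [hy]; filter_upwards [lt_mem_nhds hR0] with t ht using S.gf.dG t ht) (by rw [hy]; exact hg')
  have hlow := (hJu.sub hJG).right (by rw [S.uR y hy, hy, sub_self]) hd (by
    intro t h1 h2
    have h3 := hl t h1 h2
    exact sub_nonneg.2 (S.low2 (by linarith [S.hR, h3.2]) h3.1.1.le))
  have hup := ((jetQ a 0 y (-y) 1 (G R - R)).sub hJu).right (by rw [S.uR y hy, hy]; ring) hd (by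
    intro t h1 h2
    have h3 := hl t h1 h2
    have := S.up4 (Om_sub_Ks h3.1)
    linarith)
  have hneg : pd (-y) u y = - pd y u y := by simp [pd]
  rw [hneg, hy, sub_zero, bl_neg_right, hone] at hlow
  rw [hneg, sub_zero, bl_neg_right, hone] at hup
  have hgb := S.gf.gb R (by linarith [S.hR, S.gf.R2])
  have hle : pd y u y / (2 * R) ≤ g R := by rw [div_le_iff₀ (by positivity)]; linarith
  refine ⟨pd y u y / (2 * R), ?_, ?_, by field_simp, hB.1, hB.2⟩
  · rw [le_div_iff₀ (by positivity)]; linarith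
  · nlinarith

noncomputable def C9 (a : Fin n → ℝ) (lam R₀ M₀ b : ℝ) : ℝ := (∑ i, a i) * (1 + b * (1 + 2/lam)) + 1 + (R₀ + M₀)

lemma GF.b0 (H : GF n k a lam R₀ G g M₀ b h) : 0 ≤ b := by
  have h1 := H.gb R₀ le_rfl
  have h2 := H.g1 R₀ (by linarith [H.R2])
  have h3 := H.R2
  nlinarith

lemma GF.C9pos (H : GF n k a lam R₀ G g M₀ b h) : 1 ≤ C9 a lam R₀ M₀ b := by
  have := H.sa; have := H.b0; have := H.R2; have := H.M0; have := H.lam0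
  have : 0 ≤ (∑ i, a i) * (1 + b * (1 + 2/lam)) := by positivity
  unfold C9; linarith

lemma St.outnorm (S : St n k a lam R₀ G g M₀ b h x₀ ε R u U) {y : Euc n} (hy : Qd a 0 y ≤ R) :
    ‖y‖ ≤ R * (1 + 2/lam) := by
  have h1 := Qd_norm S.gf.la y
  have hl := S.gf.lam0
  have h2 : ‖y‖^2 ≤ 2 * R / lam := by rw [le_div_iff₀ hl]; linarith
  have h3 : 1 ≤ R := by linarith [S.hR, S.gf.R2]
  have h4 : ‖y‖ ≤ 1 + ‖y‖^2 := by nlinarith [sq_nonneg (‖y‖ - 1/2)]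
  have h5 : R * (1 + 2/lam) = R + 2 * R / lam := by ring
  linarith

/-- a bound for L-harmonic functions by boundary values -/
lemma St.lharm (S : St n k a lam R₀ G g M₀ b h x₀ ε R u U) {φ : Euc n → ℝ} {B : ℝ} (hc : ContinuousOn φ (Ks a x₀ ε R))
    (h1 : ∀ y, ‖y - x₀‖ = ε → φ y ≤ B) (h2 : ∀ y, Qd a 0 y = R → φ y ≤ B)
    (hL : ∀ x ∈ Om a x₀ ε R, ∀ (f : OrthonormalBasis (Fin n) ℝ (Euc n)) w, LinP n k u x f w →
      ∃ d1 d2 : Fin n → ℝ, (∀ i, Jet φ x (f i) (d1 i) (d2 i)) ∧ 0 ≤ ∑ i, w i * d2 i) :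
    ∀ x ∈ Ks a x₀ ε R, φ x ≤ B := by
  have := MP (φ := fun x => φ x - B) (K := Ks a x₀ ε R) (D := Om a x₀ ε R) (by have := S.gf.hn; omega)
    (cpt_of_le S.gf.lam0 S.gf.la Ks_closed (fun x hx => hx.1)) Om_open Om_sub_Ks (hc.sub continuousOn_const) ?_ ?_
  · intro x hx; exact sub_nonpos.1 (this x hx)
  · intro x hx hxn
    apply sub_nonpos.2
    by_cases h3 : ε < ‖x - x₀‖
    · exact h2 x (le_antisymm hx.1 (not_lt.1 (fun h => hxn ⟨h, h3⟩)))
    · exact h1 x (le_antisymm (not_lt.1 h3) hx.2)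
  · intro x hx
    obtain ⟨f, w, L⟩ := pack S.gf.hk S.sol hx
    obtain ⟨d1, d2, h3, h4⟩ := hL x hx f w L
    refine ⟨f, w, d1, d2, L.wpos, ?_, h4⟩
    intro i
    simpa using (h3 i).sub (Jet.const x (f i) B)

lemma St.pdcont (S : St n k a lam R₀ G g M₀ b h x₀ ε R u U) (e : Euc n) : ContinuousOn (pd e u) (Ks a x₀ ε R) :=
  (S.sol.sm.pdd S.sol.hU e).continuousOn.mono (fun _ hx => S.KU hx)

lemma bl_cont (e : Euc n) : Continuous (fun x : Euc n => bl a x e) := by unfold bl; fun_prop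

/-- gradient estimate -/
lemma St.grad1 (S : St n k a lam R₀ G g M₀ b h x₀ ε R u U) {x : Euc n} (hx : x ∈ Ks a x₀ ε R) (e : Euc n) :
    pd e u x - bl a x e ≤ C9 a lam R₀ M₀ b * (KK n k ε * ε) * ‖e‖ := by
  have hsa := S.gf.sa
  have hb0 := S.gf.b0
  have hM := S.gf.M0
  have hR2 := S.gf.R2
  have hl := S.gf.lam0
  have hK1 := S.K1
  have he0 := norm_nonneg e
  have hbb : 0 ≤ b * (1 + 2/lam) := by positivity
  have hRM : 0 ≤ R₀ + M₀ := by linarith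
  refine S.lharm (φ := fun x => pd e u x - bl a x e) ((S.pdcont e).sub (bl_cont e).continuousOn) ?_ ?_ ?_ x hx
  · intro y hy
    obtain ⟨θ, h1, h2, -, h4, -⟩ := S.inB hy
    have h5 : ‖y‖ ≤ 1 := by
      have := norm_add_le (y - x₀) x₀
      rw [sub_add_cancel] at this
      linarith [S.hx0, S.e1]
    have h6 := bl_abs S.ha y e
    have h7 : -bl a y e ≤ (∑ i, a i) * ‖e‖ := by
      have := (abs_le.1 h6).1
      have h8 : (∑ i, a i) * ‖y‖ * ‖e‖ ≤ (∑ i, a i) * 1 * ‖e‖ := by gcongr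
      linarith
    have h8 : θ * inner ℝ (y - x₀) e ≤ (1 + (R₀ + M₀) * KK n k ε) * (ε * ‖e‖) := by
      have h9 : inner ℝ (y - x₀) e ≤ ε * ‖e‖ := by rw [← hy]; exact real_inner_le_norm _ _
      have h10 : 0 ≤ θ := by linarith [S.K2]
      calc θ * inner ℝ (y - x₀) e ≤ θ * (ε * ‖e‖) := by gcongr
        _ ≤ _ := by gcongr; exact mul_nonneg S.e0.le he0
    rw [h4]
    have h9 : 1 * ((∑ i, a i) * (1 + b * (1 + 2/lam)) * ‖e‖ + ‖e‖) ≤ (KK n k ε * ε) * ((∑ i, a i) * (1 + b * (1 + 2/lam)) * ‖e‖ + ‖e‖) := by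
      apply mul_le_mul_of_nonneg_right hK1; positivity
    have h10 : ε * ‖e‖ ≤ ‖e‖ := by nlinarith [S.e1]
    have h11 : 0 ≤ (∑ i, a i) * (b * (1 + 2/lam)) * ‖e‖ := by positivity
    unfold C9
    linarith
  · intro y hy
    obtain ⟨θ, h1, h2, -, h4, -⟩ := S.outB hy
    rw [h4]
    have h5 := S.outnorm hy.le
    have h6 := (abs_le.1 (bl_abs S.ha y e)).2
    have hR1 : 0 < R := by linarith [S.hR]
    calc θ * bl a y e - bl a y e = (θ - 1) * bl a y e := by ring
      _ ≤ (θ - 1) * ((∑ i, a i) * ‖y‖ * ‖e‖) := mul_le_mul_of_nonneg_left h6 (by linarith)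
      _ ≤ (θ - 1) * ((∑ i, a i) * (R * (1 + 2/lam)) * ‖e‖) := by
        apply mul_le_mul_of_nonneg_left _ (by linarith); gcongr
      _ = ((θ - 1) * R) * ((∑ i, a i) * (1 + 2/lam) * ‖e‖) := by ring
      _ ≤ b * ((∑ i, a i) * (1 + 2/lam) * ‖e‖) := by gcongr
      _ = 1 * ((∑ i, a i) * (b * (1 + 2/lam)) * ‖e‖) := by ring
      _ ≤ (KK n k ε * ε) * (C9 a lam R₀ M₀ b * ‖e‖) := by
        apply mul_le_mul hK1 _ (by positivity) (by linarith)
        apply mul_le_mul_of_nonneg_right _ he0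
        unfold C9; linarith
      _ = _ := by ring
  · intro x hx f w L
    have hxU := S.sol.mem hx
    refine ⟨fun i => pd (f i) (pd e u) x - bl a (f i) e, fun i => pd (f i) (pd (f i) (pd e u)) x - 0, ?_, ?_⟩
    · intro i
      exact ((S.sol.sm.pdd S.sol.hU e).jet S.sol.hU hxU (f i)).sub (bl_jet a e x (f i))
    · simp only [sub_zero]; exact (L.d1 e).ge

lemma St.grad (S : St n k a lam R₀ G g M₀ b h x₀ ε R u U) {x : Euc n} (hx : x ∈ Ks a x₀ ε R) (e : Euc n) :
    |pd e u x - bl a x e| ≤ C9 a lam R₀ M₀ b * (KK n k ε * ε) * ‖e‖ := by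
  rw [abs_le]
  refine ⟨?_, S.grad1 hx e⟩
  have := S.grad1 hx (-e)
  rw [norm_neg, bl_neg_right] at this
  have h2 : pd (-e) u x = - pd e u x := by simp [pd]
  rw [h2] at this
  linarith

end GRAD

open scoped Classical Topology
open Real Filter MeasureTheory

section INMIX
variable {n k : ℕ} {a : Fin n → ℝ} {lam R₀ : ℝ} {G g : ℝ → ℝ} {M₀ b h : ℝ} {x₀ : Euc n} {ε R : ℝ}
    {u : Euc n → ℝ} {U : Set (Euc n)}

noncomputable def C10 (n k : ℕ) (a : Fin n → ℝ) (lam R₀ M₀ b : ℝ) : ℝ :=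
  32 * 4^(kap n k) * (C9 a lam R₀ M₀ b + 2 * ∑ i, a i) * (1 + (R₀ + M₀))

lemma GF.C10pos (H : GF n k a lam R₀ G g M₀ b h) : 0 ≤ C10 n k a lam R₀ M₀ b := by
  have := H.C9pos; have := H.sa; have := H.M0; have := H.R2
  unfold C10
  have h1 : 0 ≤ C9 a lam R₀ M₀ b + 2 * ∑ i, a i := by linarith
  have h2 : 0 ≤ 1 + (R₀ + M₀) := by linarith
  positivity

lemma St.gradnear (S : St n k a lam R₀ G g M₀ b h x₀ ε R u U) {x : Euc n} (hx : x ∈ Ks a x₀ ε R) (hx1 : ‖x - x₀‖ ≤ 1) (e : Euc n) :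
    |pd e u x| ≤ (C9 a lam R₀ M₀ b + 2 * ∑ i, a i) * (KK n k ε * ε) * ‖e‖ := by
  have h1 := S.grad hx e
  have h2 := bl_abs S.ha x e
  have h3 : ‖x‖ ≤ 3/2 := by
    have := norm_add_le (x - x₀) x₀
    rw [sub_add_cancel] at this
    linarith [S.hx0]
  have h4 : (∑ i, a i) * ‖x‖ * ‖e‖ ≤ (∑ i, a i) * 2 * (KK n k ε * ε) * ‖e‖ := by
    apply mul_le_mul_of_nonneg_right _ (norm_nonneg e)
    rw [mul_assoc]
    apply mul_le_mul_of_nonneg_left _ S.gf.sa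
    linarith [S.K1]
  calc |pd e u x| = |(pd e u x - bl a x e) + bl a x e| := by ring_nf
    _ ≤ _ := abs_add_le _ _
    _ ≤ _ := by linarith

lemma St.mix_in0 (S : St n k a lam R₀ G g M₀ b h x₀ ε R u U) {y z : Euc n} (hy : ‖y - x₀‖ = ε)
    (hz : inner ℝ (y - x₀) z = 0) (hzn : ‖z‖ = ε) {σ : ℝ} (hσ : |σ| = 1) :
    σ * pd (y - x₀) (pd z u) y ≤ C10 n k a lam R₀ M₀ b * KK n k ε * ε^2 := by
  have he := S.e0
  have he1 := S.e1
  have hsm := S.sol.sm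
  have hU := S.sol.hU
  have hyU := S.KU (S.inK hy)
  have hκ := S.hκ
  have hP := Ph_half hκ S.e0 S.e1
  have hK2 := S.K2
  have hC9 := S.gf.C9pos
  have hsa := S.gf.sa
  set ζ := y - x₀ with hζ
  set E := C9 a lam R₀ M₀ b + 2 * ∑ i, a i with hE
  have hE0 : 0 ≤ E := by rw [hE]; linarith
  set B := 32 * 4^(kap n k) * E * ε^2 with hB
  have hB0 : 0 ≤ B := by positivity
  set c := 1 / (8 * Ph (kap n k) ε (1/2)) with hc
  have hc0 : 0 ≤ c := by positivity
  set v : Euc n → ℝ := fun x => 1 * (Qd (fun _ => 1) x₀ x - ε^2/2) + c * Ph (kap n k) ε (Qd (fun _ => 1) x₀ x) with hv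
  set T : Euc n → ℝ := fun x => inner ℝ ζ (x - x₀) * pd z u x - inner ℝ z (x - x₀) * pd ζ u x with hT
  have ht : ∀ x : Euc n, ε ≤ ‖x - x₀‖ → 0 < Qd (fun _ => 1) x₀ x := fun x hx =>
    lt_of_lt_of_le (by positivity) (Qd_pos_of S.e0 hx)
  have hKK : ∀ x : Euc n, ε ≤ ‖x - x₀‖ ∧ ‖x - x₀‖ ≤ 2 * ε → x ∈ Ks a x₀ ε R := fun x hx => S.annK hx.1 (by linarith [hx.2])
  have hTc : ContinuousOn T {x : Euc n | ε ≤ ‖x - x₀‖ ∧ ‖x - x₀‖ ≤ 2 * ε} := by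
    apply ContinuousOn.sub
    · exact ContinuousOn.mul (by fun_prop) ((S.pdcont z).mono (fun x hx => hKK x hx))
    · exact ContinuousOn.mul (by fun_prop) ((S.pdcont ζ).mono (fun x hx => hKK x hx))
  have hvc : ContinuousOn v {x : Euc n | ε ≤ ‖x - x₀‖ ∧ ‖x - x₀‖ ≤ 2 * ε} := fun x hx =>
    (rad_cont k 1 _ (ht x hx.1)).continuousWithinAt
  have hTJ : ∀ x ∈ U, ∀ e, Jet T x e ((inner ℝ ζ e * pd z u x + inner ℝ ζ (x - x₀) * pd e (pd z u) x) -
      (inner ℝ z e * pd ζ u x + inner ℝ z (x - x₀) * pd e (pd ζ u) x))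
      ((0 * pd z u x + 2 * inner ℝ ζ e * pd e (pd z u) x + inner ℝ ζ (x - x₀) * pd e (pd e (pd z u)) x) -
      (0 * pd ζ u x + 2 * inner ℝ z e * pd e (pd ζ u) x + inner ℝ z (x - x₀) * pd e (pd e (pd ζ u)) x)) := by
    intro x hx e
    exact ((Jet.lin ζ x₀ x e).mul ((hsm.pdd hU z).jet hU hx e)).sub ((Jet.lin z x₀ x e).mul ((hsm.pdd hU ζ).jet hU hx e))
  have hin : ∀ x : Euc n, ‖x - x₀‖ = ε → T x = 0 ∧ u x = 0 ∧ v x = 0 := by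
    intro x hx
    refine ⟨?_, S.u0 x hx, ?_⟩
    · obtain ⟨θ, -, -, -, h4, -⟩ := S.inB hx
      simp only [hT]
      rw [h4, h4, real_inner_comm ζ, real_inner_comm z]; ring
    · have : Qd (fun _ => 1) x₀ x = ε^2/2 := by rw [Qd_one, hx]
      simp only [hv]; rw [this]; simp [Ph]
  have key : ∀ x ∈ {x : Euc n | ε ≤ ‖x - x₀‖ ∧ ‖x - x₀‖ ≤ 2 * ε}, σ * T x - B * (u x - v x) ≤ 0 := by
    apply MP (D := {x : Euc n | ε < ‖x - x₀‖ ∧ ‖x - x₀‖ < 2 * ε}) (by have := S.gf.hn; omega)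
      (cpt_of_le S.gf.lam0 S.gf.la ann_closed (fun x hx => (hKK x hx).1)) ann_open (fun x hx => ⟨hx.1.le, hx.2.le⟩)
    · exact (continuousOn_const.mul hTc).sub (continuousOn_const.mul ((S.cont.mono (fun x hx => hKK x hx)).sub hvc))
    · intro x hx hxn
      by_cases h3 : ε < ‖x - x₀‖
      · have h4 : ‖x - x₀‖ = 2 * ε := le_antisymm hx.2 (not_lt.1 (fun h => hxn ⟨h3, h⟩))
        have hg := S.gradnear (hKK x hx) (by linarith)
        have h5 : |T x| ≤ 4 * E * KK n k ε * ε^4 := by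
          have t1 : |inner ℝ ζ (x - x₀) * pd z u x| ≤ (ε * (2 * ε)) * (E * (KK n k ε * ε) * ε) := by
            rw [abs_mul]
            apply mul_le_mul _ _ (abs_nonneg _) (by positivity)
            · exact (abs_real_inner_le_norm _ _).trans (by rw [hy, h4])
            · exact (hg z).trans (by rw [hzn])
          have t2 : |inner ℝ z (x - x₀) * pd ζ u x| ≤ (ε * (2 * ε)) * (E * (KK n k ε * ε) * ε) := by
            rw [abs_mul]
            apply mul_le_mul _ _ (abs_nonneg _) (by positivity)
            · exact (abs_real_inner_le_norm _ _).trans (by rw [hzn, h4])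
            · exact (hg ζ).trans (by rw [hy])
          have t3 := abs_sub (inner ℝ ζ (x - x₀) * pd z u x) (inner ℝ z (x - x₀) * pd ζ u x)
          calc |T x| ≤ _ := t3
            _ ≤ _ := by linarith
        have h6 : σ * T x ≤ |T x| := by
          have := le_abs_self (σ * T x)
          rwa [abs_mul, hσ, one_mul] at this
        have h7 := S.low5 hx.1 (by linarith)
        have h8 : Qd (fun _ => 1) x₀ x = 2 * ε^2 := by rw [Qd_one, h4]; ring
        have h9 : KK n k ε * 4^(-kap n k) * ε^2 / 8 ≤ u x - v x := by
          have h10 := Ph_two hκ he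
          simp only [hv]
          rw [h8] at h7 ⊢
          have h11 : 1 / (4 * Ph (kap n k) ε (1/2)) = 2 * c := by rw [hc]; field_simp; norm_num
          rw [h11] at h7
          have h12 : c * ((ε^2)^(-kap n k) * (4^(-kap n k) * ε^2)) ≤ c * Ph (kap n k) ε (2 * ε^2) :=
            mul_le_mul_of_nonneg_left h10 hc0
          have h13 : KK n k ε * 4^(-kap n k) * ε^2 / 8 = c * ((ε^2)^(-kap n k) * (4^(-kap n k) * ε^2)) := by
            rw [hc]; unfold KK Kf; field_simp
          rw [h13]; linarith
        have h10 := mul_le_mul_of_nonneg_left h9 hB0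
        have h11 : B * (KK n k ε * 4^(-kap n k) * ε^2 / 8) = 4 * E * KK n k ε * ε^4 := by
          have : (4:ℝ)^(kap n k) * 4^(-kap n k) = 1 := by rw [← Real.rpow_add (by norm_num)]; simp
          rw [hB]
          calc _ = 4 * E * KK n k ε * ε^4 * ((4:ℝ)^(kap n k) * 4^(-kap n k)) := by ring
            _ = _ := by rw [this, mul_one]
        linarith
      · have h4 : ‖x - x₀‖ = ε := le_antisymm (not_lt.1 h3) hx.1
        obtain ⟨h5, h6, h7⟩ := hin x h4
        rw [h5, h6, h7]; simp
    · intro x hx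
      have hxO := S.annO hx.1 (by linarith [hx.2])
      have hxU := S.sol.mem hxO
      have hx0 := ht x hx.1.le
      obtain ⟨f, w, L⟩ := pack S.gf.hk S.sol hxO
      have hr := rad S.gf.hk (δ := 1) (c := c) one_pos hc0 hx0
      refine ⟨f, w, _, _, L.wpos, fun i => ((hTJ x hxU (f i)).cmul σ).sub
        (((hsm.jet hU hxU (f i)).sub (rad_jet k 1 c 0 hx0 (f i))).cmul B), ?_⟩
      have h1 : 1 ≤ matSk n (k+1) (radN n k x₀ 1 c x) := by
        rw [hr.2.2]
        have hch : (1:ℝ) ≤ n.choose (k+1) := by exact_mod_cast Nat.choose_pos S.gf.hk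
        have h5 : 1 ≤ (1 + c * (2 * Qd (fun _ => 1) x₀ x) ^ (-kap n k)) ^ k := by
          apply one_le_pow₀
          have : 0 ≤ c * (2 * Qd (fun _ => 1) x₀ x) ^ (-kap n k) := by positivity
          linarith
        nlinarith
      have h2 := L.cone _ hr.1 hr.2.1 h1
      have h3 := L.tr
      have h4 := L.rot ζ z
      have h5 := L.d1 z
      have h6 := L.d1 ζ
      have h7 : ∑ i, w i * (σ * ((0 * pd z u x + 2 * inner ℝ ζ (f i) * pd (f i) (pd z u) x + inner ℝ ζ (x - x₀) * pd (f i) (pd (f i) (pd z u)) x) -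
          (0 * pd ζ u x + 2 * inner ℝ z (f i) * pd (f i) (pd ζ u) x + inner ℝ z (x - x₀) * pd (f i) (pd (f i) (pd ζ u)) x)) -
          B * (pd (f i) (pd (f i) u) x - qf (radN n k x₀ 1 c x) (f i) (f i))) =
          σ * (2 * (∑ i, w i * (inner ℝ ζ (f i) * pd (f i) (pd z u) x)) + inner ℝ ζ (x - x₀) * (∑ i, w i * pd (f i) (pd (f i) (pd z u)) x)
            - 2 * (∑ i, w i * (inner ℝ z (f i) * pd (f i) (pd ζ u) x)) - inner ℝ z (x - x₀) * (∑ i, w i * pd (f i) (pd (f i) (pd ζ u)) x))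
          - B * ((∑ i, w i * pd (f i) (pd (f i) u) x) - ∑ i, w i * qf (radN n k x₀ 1 c x) (f i) (f i)) := by
        simp only [Finset.mul_sum, ← Finset.sum_sub_distrib, ← Finset.sum_add_distrib]
        apply Finset.sum_congr rfl; intro i _; ring
      rw [h7, h4, h5, h6, h3]
      have h8 := mul_le_mul_of_nonneg_left h2 hB0
      linarith
  obtain ⟨d, hd, hl⟩ := S.inner_line hy
  obtain ⟨hT0, hu0, hv0⟩ := hin y hy
  have hJ := ((((hsm.jet hU hyU ζ).sub (rad_jet (ε := ε) k 1 c 0 (ht y hy.ge) ζ)).cmul B).sub ((hTJ y hyU ζ).cmul σ)).right (by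
    simp only [hv] at hv0; rw [hT0, hu0, hv0]; simp) hd (by
    intro t h1 h2
    have h3 := hl t h1 h2
    have h4 := key _ ⟨h3.1.2.le, h3.2.le⟩
    simp only [hv] at h4
    linarith)
  obtain ⟨θ, h1, h2, h3, h4, -⟩ := S.inB hy
  rw [← hζ, one_blsq, real_inner_self_eq_norm_sq, hy, h3, h4 z, ← hζ, hz, real_inner_comm ζ z, hz] at hJ
  have h5 : 0 ≤ c * (2 * Qd (fun _ => 1) x₀ y) ^ (-kap n k) := by have := ht y hy.ge; positivity
  have h6 : 0 ≤ B * ((1 + c * (2 * Qd (fun _ => 1) x₀ y) ^ (-kap n k)) * ε^2) := by positivity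
  have h7 : ε^2 * (σ * pd ζ (pd z u) y) ≤ ε^2 * (B * θ) := by linarith
  have h8 : σ * pd ζ (pd z u) y ≤ B * θ := le_of_mul_le_mul_left h7 (by positivity)
  have h9 : θ ≤ (1 + (R₀ + M₀)) * KK n k ε := by linarith
  calc σ * pd ζ (pd z u) y ≤ B * θ := h8
    _ ≤ B * ((1 + (R₀ + M₀)) * KK n k ε) := mul_le_mul_of_nonneg_left h9 hB0
    _ = _ := by rw [hB, C10, hE]; ring

lemma St.mix_in (S : St n k a lam R₀ G g M₀ b h x₀ ε R u U) {y z : Euc n} (hy : ‖y - x₀‖ = ε)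
    (hz : inner ℝ (y - x₀) z = 0) :
    |pd z (pd (y - x₀) u) y| ≤ C10 n k a lam R₀ M₀ b * KK n k ε * (ε * ‖z‖) := by
  have he := S.e0
  have hyU := S.KU (S.inK hy)
  by_cases hz0 : z = 0
  · rw [hz0, pd_zero]; simp
  have hzn : 0 < ‖z‖ := norm_pos_iff.2 hz0
  have h1 : ∀ σ : ℝ, |σ| = 1 → σ * (ε / ‖z‖ * pd (y - x₀) (pd z u) y) ≤ C10 n k a lam R₀ M₀ b * KK n k ε * ε^2 := by
    intro σ hσ
    have h2 := S.mix_in0 (z := (ε / ‖z‖) • z) hy (by rw [real_inner_smul_right, hz, mul_zero])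
      (by rw [norm_smul, norm_div, norm_norm, Real.norm_of_nonneg he.le]; field_simp) hσ
    have h3 := pd2_smul S.sol.sm S.sol.hU hyU 1 (ε / ‖z‖) (y - x₀) z
    rw [one_smul, one_mul] at h3
    rwa [h3] at h2
  have h2 := h1 1 (by simp)
  have h3 := h1 (-1) (by simp)
  have h4 : |ε / ‖z‖ * pd (y - x₀) (pd z u) y| ≤ C10 n k a lam R₀ M₀ b * KK n k ε * ε^2 := by
    rw [abs_le]; constructor <;> linarith
  rw [pd_comm S.sol.sm S.sol.hU hyU]
  rw [abs_mul, abs_of_pos (by positivity), div_mul_eq_mul_div, div_le_iff₀ hzn] at h4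
  have h5 : ε * |pd (y - x₀) (pd z u) y| ≤ ε * (C10 n k a lam R₀ M₀ b * KK n k ε * (ε * ‖z‖)) := by linarith
  exact le_of_mul_le_mul_left h5 he

noncomputable def C11 (n k : ℕ) (a : Fin n → ℝ) (lam R₀ M₀ b : ℝ) : ℝ :=
  2 * (1 + (R₀ + M₀)) + C10 n k a lam R₀ M₀ b + 8 * C10 n k a lam R₀ M₀ b ^ 2 + 4^k

/-- full second derivative bound at the inner boundary -/
lemma St.in2 (S : St n k a lam R₀ G g M₀ b h x₀ ε R u U) {y : Euc n} (hy : ‖y - x₀‖ = ε) (e : Euc n) :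
    pd e (pd e u) y ≤ C11 n k a lam R₀ M₀ b * KK n k ε * ‖e‖^2 := by
  have he := S.e0
  have hK2 := S.K2
  have hC := S.gf.C10pos
  have hM := S.gf.M0
  have hR2 := S.gf.R2
  obtain ⟨θ, h1, h2, h3, h4, h5⟩ := S.inB hy
  have hQ0 : 0 ≤ C10 n k a lam R₀ M₀ b * KK n k ε := by positivity
  have hd := dbl_normal (b := fun _ => (1:ℝ)) (lam := 1) (m := 1) (θ := θ) (Q := C10 n k a lam R₀ M₀ b * KK n k ε)
    S.gf.hk S.sol (S.Ks_cl (S.inK hy)) one_pos (fun _ => le_rfl) one_pos ?_ (S.ne_in hy) (by linarith) hQ0 ?_ ?_ e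
  · rw [one_blsq] at hd
    refine hd.trans (mul_le_mul_of_nonneg_right ?_ (by positivity))
    have h6 : 2 * (C10 n k a lam R₀ M₀ b * KK n k ε)^2/θ ≤ 8 * C10 n k a lam R₀ M₀ b ^ 2 * KK n k ε := by
      rw [div_le_iff₀ (by linarith)]
      have h7 : KK n k ε / 4 ≤ θ := by linarith
      have h8 : 8 * C10 n k a lam R₀ M₀ b ^ 2 * KK n k ε * (KK n k ε / 4) ≤ 8 * C10 n k a lam R₀ M₀ b ^ 2 * KK n k ε * θ :=
        mul_le_mul_of_nonneg_left h7 (by positivity)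
      linarith
    have h7 : (4:ℝ)^k/1 ≤ 4^k * KK n k ε := by
      rw [div_one]
      exact le_mul_of_one_le_right (by positivity) (by linarith)
    unfold C11
    linarith
  · intro i
    rw [sg_ones, one_mul]
    have : 0 < ((Finset.univ : Finset (Fin n)).erase i).card.choose k := Nat.choose_pos (by simp; have := S.gf.hk; omega)
    exact_mod_cast this
  · intro z hz
    rw [one_bl] at hz
    rw [one_blsq]; exact h5 z hz
  · intro z hz
    rw [one_bl] at hz
    have h6 := S.mix_in hy hz
    rw [one_blsq, one_blsq, hy]
    have h7 : (C10 n k a lam R₀ M₀ b * KK n k ε)^2 * (ε^2 * ‖z‖^2) = (C10 n k a lam R₀ M₀ b * KK n k ε * (ε * ‖z‖))^2 := by ring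
    rw [h7, ← sq_abs]
    exact pow_le_pow_left₀ (abs_nonneg _) h6 2

end INMIX

open scoped Classical Topology
open Real Filter MeasureTheory

section OUTMIX
variable {n k : ℕ} {a : Fin n → ℝ} {lam R₀ : ℝ} {G g : ℝ → ℝ} {M₀ b h : ℝ} {x₀ : Euc n} {ε R : ℝ}
    {u : Euc n → ℝ} {U : Set (Euc n)}

noncomputable def C12 (a : Fin n → ℝ) (lam b : ℝ) : ℝ :=
  2 * (1 + b) * (∑ i, a i)^3 + 30 * (∑ i, a i)^3 * ((∑ i, a i) + 1) / lam

lemma GF.C12pos (H : GF n k a lam R₀ G g M₀ b h) : 0 ≤ C12 a lam b := by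
  have := H.sa; have := H.b0; have := H.lam0
  unfold C12; positivity

lemma St.rho (S : St n k a lam R₀ G g M₀ b h x₀ ε R u U) : ∃ ρ : ℝ, 1 ≤ ρ ∧ lam * ρ^2 = 2 * R ∧
    ∀ x, Qd a 0 x ≤ R → ‖x‖ ≤ ρ := by
  have hl := S.gf.lam0
  have hR := S.hR
  have hR2 := S.gf.R2
  have hi : 0 < n := by have := S.gf.hn; omega
  have h1 : lam ≤ ∑ i, a i := (S.gf.la ⟨0, hi⟩).trans
    (Finset.single_le_sum (f := a) (fun j _ => (S.ha j).le) (Finset.mem_univ _))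
  have h2 := S.gf.hR0
  have h3 : lam ≤ R := by linarith
  have h4 : 0 ≤ 2 * R / lam := div_nonneg (by linarith) hl.le
  refine ⟨Real.sqrt (2 * R / lam), ?_, ?_, ?_⟩
  · rw [Real.one_le_sqrt, le_div_iff₀ hl]; linarith
  · rw [Real.sq_sqrt h4]; field_simp
  · intro x hx
    apply Real.le_sqrt_of_sq_le
    have := Qd_norm S.gf.la x
    rw [le_div_iff₀ hl]; linarith

/-- the tangential rotation operator at an outer boundary point -/
noncomputable def Tf (a : Fin n → ℝ) (u : Euc n → ℝ) (y z : Euc n) : Euc n → ℝ := fun x =>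
  bl a y (av a y) * pd z u x - inner ℝ (av a z) (x - y) * pd (av a y) u x + inner ℝ (av a y) (x - y) * pd (av a z) u x

lemma St.Tout (S : St n k a lam R₀ G g M₀ b h x₀ ε R u U) {ρ : ℝ}
    (hρ : ∀ x, Qd a 0 x ≤ R → ‖x‖ ≤ ρ) {x y z : Euc n} (hx : Qd a 0 x = R) (hy : Qd a 0 y = R)
    (hz : bl a y z = 0) : |Tf a u y z x| ≤ 2 * (1 + b) * (∑ i, a i)^3 * ρ * ‖z‖ * ‖x - y‖^2 := by
  have hsa := S.gf.sa
  have hb := S.gf.b0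
  have hR1 : 1 ≤ R := by linarith [S.hR, S.gf.R2]
  obtain ⟨θ, h1, h2, -, h4, -⟩ := S.outB hx
  have hθ : θ ≤ 1 + b := by nlinarith
  set s := ∑ i, a i with hs
  have e1 : bl a x z = bl a z (x - y) := by rw [bl_sub_right, bl_comm a z y, hz, sub_zero, bl_comm]
  have e2 : bl a y (x - y) = - (bl a (x - y) (x - y) / 2) := by
    unfold Qd at hx hy
    rw [sub_zero] at hx hy
    simp only [bl_sub_left, bl_sub_right]
    rw [bl_comm a x y]
    linarith
  have e3 : bl a x (av a y) = bl a y (av a y) + bl a (x - y) (av a y) := by rw [bl_sub_left]; ring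
  have e4 : Tf a u y z x = θ * (-(bl a z (x - y) * bl a (x - y) (av a y)) - bl a (x - y) (x - y) / 2 * bl a x (av a z)) := by
    unfold Tf
    rw [h4, h4, h4, inner_av, inner_av, e2, e1, e3]; ring
  have hxn := hρ x hx.le
  have hyn := hρ y hy.le
  have hρ0 : 0 ≤ ρ := (norm_nonneg x).trans hxn
  have b1 : |bl a z (x - y)| ≤ s * ‖z‖ * ‖x - y‖ := bl_abs S.ha _ _
  have b2 : |bl a (x - y) (av a y)| ≤ s * ‖x - y‖ * (s * ρ) := (bl_abs S.ha _ _).trans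
    (mul_le_mul_of_nonneg_left ((av_norm S.ha y).trans (mul_le_mul_of_nonneg_left hyn hsa)) (by positivity))
  have b3 : |bl a (x - y) (x - y)| ≤ s * ‖x - y‖ * ‖x - y‖ := bl_abs S.ha _ _
  have b4 : |bl a x (av a z)| ≤ s * ρ * (s * ‖z‖) := (bl_abs S.ha _ _).trans
    (mul_le_mul (mul_le_mul_of_nonneg_left hxn hsa) (av_norm S.ha z) (norm_nonneg _) (by positivity))
  have b5 : |bl a z (x - y) * bl a (x - y) (av a y)| ≤ (s * ‖z‖ * ‖x - y‖) * (s * ‖x - y‖ * (s * ρ)) := by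
    rw [abs_mul]; exact mul_le_mul b1 b2 (abs_nonneg _) (by positivity)
  have b6 : |bl a (x - y) (x - y) * bl a x (av a z)| ≤ (s * ‖x - y‖ * ‖x - y‖) * (s * ρ * (s * ‖z‖)) := by
    rw [abs_mul]; exact mul_le_mul b3 b4 (abs_nonneg _) (by positivity)
  have b7 : |-(bl a z (x - y) * bl a (x - y) (av a y)) - bl a (x - y) (x - y) / 2 * bl a x (av a z)| ≤
      2 * s^3 * ρ * ‖z‖ * ‖x - y‖^2 := by
    rw [abs_le] at b5 b6 ⊢
    have : 0 ≤ s^3 * ρ * ‖z‖ * ‖x - y‖^2 := by positivity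
    constructor <;> nlinarith
  rw [e4, abs_mul, abs_of_nonneg (by linarith)]
  calc _ ≤ (1 + b) * (2 * s^3 * ρ * ‖z‖ * ‖x - y‖^2) := mul_le_mul hθ b7 (abs_nonneg _) (by linarith)
    _ = _ := by ring

lemma St.Tin (S : St n k a lam R₀ G g M₀ b h x₀ ε R u U) {ρ : ℝ} (hρ1 : 1 ≤ ρ) (hρ2 : lam * ρ^2 = 2 * R)
    (hρ : ∀ x, Qd a 0 x ≤ R → ‖x‖ ≤ ρ) {x y z : Euc n} (hx : Qd a 0 x = R/3) (hy : Qd a 0 y = R) :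
    |Tf a u y z x| ≤ 30 * (∑ i, a i)^3 * ((∑ i, a i) + 1) / lam * (ρ + C9 a lam R₀ M₀ b * (KK n k ε * ε)) * ‖z‖ * ‖x - y‖^2 := by
  have hsa := S.gf.sa
  have hl := S.gf.lam0
  have hR1 : 1 ≤ R := by linarith [S.hR, S.gf.R2]
  have hN : 0 ≤ C9 a lam R₀ M₀ b * (KK n k ε * ε) := by
    have := S.gf.C9pos; have := S.K1; have := S.K2; positivity
  set N := C9 a lam R₀ M₀ b * (KK n k ε * ε) with hNd
  have hxK : x ∈ Ks a x₀ ε R := ⟨by linarith, by linarith [S.far (x := x) (by linarith [S.hR]), S.e1]⟩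
  set s := ∑ i, a i with hs
  have hxn := hρ x (by linarith)
  have hyn := hρ y hy.le
  have hX : ‖x - y‖ ≤ 2 * ρ := (norm_sub_le _ _).trans (by linarith)
  have hg : ∀ e, |pd e u x| ≤ (s * ρ + N) * ‖e‖ := by
    intro e
    have h1 := S.grad hxK e
    have h2 := bl_abs S.ha x e
    have h4 : s * ‖x‖ * ‖e‖ ≤ s * ρ * ‖e‖ :=
      mul_le_mul_of_nonneg_right (mul_le_mul_of_nonneg_left hxn hsa) (norm_nonneg e)
    calc |pd e u x| = |(pd e u x - bl a x e) + bl a x e| := by ring_nf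
      _ ≤ _ := abs_add_le _ _
      _ ≤ _ := by linarith
  have hη : ‖av a y‖ ≤ s * ρ := (av_norm S.ha y).trans (mul_le_mul_of_nonneg_left hyn hsa)
  have hp : ‖av a z‖ ≤ s * ‖z‖ := av_norm S.ha z
  have hρ0 : 0 ≤ ρ := by linarith
  have c1 : |bl a y (av a y) * pd z u x| ≤ (s * ρ * (s * ρ)) * ((s * ρ + N) * ‖z‖) := by
    rw [abs_mul]
    refine mul_le_mul ((bl_abs S.ha _ _).trans ?_) (hg z) (abs_nonneg _) (by positivity)
    exact mul_le_mul (mul_le_mul_of_nonneg_left hyn hsa) hη (norm_nonneg _) (by positivity)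
  have c2 : |inner ℝ (av a z) (x - y) * pd (av a y) u x| ≤ (s * ‖z‖ * (2 * ρ)) * ((s * ρ + N) * (s * ρ)) := by
    rw [abs_mul]
    refine mul_le_mul ((abs_real_inner_le_norm _ _).trans ?_) ((hg _).trans ?_) (abs_nonneg _) (by positivity)
    · exact mul_le_mul hp hX (norm_nonneg _) (by positivity)
    · exact mul_le_mul_of_nonneg_left hη (by positivity)
  have c3 : |inner ℝ (av a y) (x - y) * pd (av a z) u x| ≤ (s * ρ * (2 * ρ)) * ((s * ρ + N) * (s * ‖z‖)) := by
    rw [abs_mul]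
    refine mul_le_mul ((abs_real_inner_le_norm _ _).trans ?_) ((hg _).trans ?_) (abs_nonneg _) (by positivity)
    · exact mul_le_mul hη hX (norm_nonneg _) (by positivity)
    · exact mul_le_mul_of_nonneg_left hp (by positivity)
  have c4 : |Tf a u y z x| ≤ 5 * s^2 * ρ^2 * (s * ρ + N) * ‖z‖ := by
    unfold Tf
    refine (abs_add_le _ _).trans ?_
    have := abs_sub (bl a y (av a y) * pd z u x) (inner ℝ (av a z) (x - y) * pd (av a y) u x)
    linarith
  have c5 : R / 3 ≤ s * ‖x - y‖^2 := by
    refine le_trans ?_ (bl_upper S.ha _)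
    have h1 := bl_nonneg S.ha (x - (3/5 : ℝ) • y)
    unfold Qd at hx hy
    rw [sub_zero] at hx hy
    simp only [bl_sub_left, bl_sub_right, bl_smul_left, bl_smul_right] at h1 ⊢
    rw [bl_comm a x y] at *
    linarith
  have c6 : lam * ρ^2 ≤ 6 * (s * ‖x - y‖^2) := by linarith
  have c7 : s * ρ + N ≤ (s + 1) * (ρ + N) := by nlinarith
  have c8 : ρ^2 ≤ 6 * (s * ‖x - y‖^2) / lam := by rw [le_div_iff₀ hl]; linarith
  calc |Tf a u y z x| ≤ 5 * s^2 * ρ^2 * (s * ρ + N) * ‖z‖ := c4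
    _ ≤ 5 * s^2 * (6 * (s * ‖x - y‖^2) / lam) * ((s + 1) * (ρ + N)) * ‖z‖ := by gcongr
    _ = _ := by ring

lemma St.uv (S : St n k a lam R₀ G g M₀ b h x₀ ε R u U) {x : Euc n} (h1 : R₀ ≤ Qd a 0 x) (h2 : Qd a 0 x ≤ R) :
    (2 + b) * Qd a 0 x + (G R - (2 + b) * R) ≤ u x := by
  have h3 := S.low2 h1 h2
  have hR2 := S.gf.R2
  have hb := S.gf.b0
  have h4 : ∀ t ∈ Set.Icc (Qd a 0 x) R, G t ≤ G (Qd a 0 x) + (2 + b) * (t - Qd a 0 x) := by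
    apply image_le_of_deriv_right_le_deriv_boundary (f := G) (f' := g) (B := fun t => G (Qd a 0 x) + (2 + b) * (t - Qd a 0 x)) (B' := fun _ => 2 + b)
    · exact fun t ht => (S.gf.dG t (by linarith [ht.1])).continuousAt.continuousWithinAt
    · exact fun t ht => (S.gf.dG t (by linarith [ht.1])).hasDerivWithinAt
    · simp
    · fun_prop
    · intro t ht
      have : HasDerivAt (fun t => G (Qd a 0 x) + (2 + b) * (t - Qd a 0 x)) ((2 + b) * 1) t :=
        (((hasDerivAt_id t).sub_const _).const_mul (2 + b)).const_add _
      rw [mul_one] at this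
      exact this.hasDerivWithinAt
    · intro t ht
      have h5 := S.gf.gb t (by linarith [ht.1])
      have h6 := S.gf.g1 t (by linarith [ht.1])
      have : 1 ≤ t := by linarith [ht.1]
      nlinarith
  have := h4 R ⟨h2, le_rfl⟩
  linarith
end OUTMIX

open scoped Classical Topology
open Real Filter MeasureTheory

section OUTMIX2
variable {n k : ℕ} {a : Fin n → ℝ} {lam R₀ : ℝ} {G g : ℝ → ℝ} {M₀ b h : ℝ} {x₀ : Euc n} {ε R : ℝ}
    {u : Euc n → ℝ} {U : Set (Euc n)}

noncomputable def C13 (a : Fin n → ℝ) (lam b : ℝ) : ℝ :=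
  ((2 + b) * (2 * C12 a lam b / lam) + (1 + b) * (∑ i, a i)^2) / lam

lemma GF.C13pos (H : GF n k a lam R₀ G g M₀ b h) : 0 ≤ C13 a lam b := by
  have := H.sa; have := H.b0; have := H.lam0; have := H.C12pos
  unfold C13; positivity

set_option maxHeartbeats 1600000 in
lemma St.mix_out0 (S : St n k a lam R₀ G g M₀ b h x₀ ε R u U) {ρ : ℝ} (hρ1 : 1 ≤ ρ) (hρ2 : lam * ρ^2 = 2 * R)
    (hρ : ∀ x, Qd a 0 x ≤ R → ‖x‖ ≤ ρ) {y z : Euc n} (hy : Qd a 0 y = R)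
    (hz : bl a y z = 0) {σ : ℝ} (hσ : |σ| = 1) :
    -(σ * pd y (pd z u) y) ≤ C13 a lam b * (ρ + C9 a lam R₀ M₀ b * (KK n k ε * ε)) * ‖z‖ := by
  have hsm := S.sol.sm
  have hU := S.sol.hU
  have hyU := S.KU (S.outK hy)
  have hsa := S.gf.sa
  have hb := S.gf.b0
  have hl := S.gf.lam0
  have hR := S.hR
  have hR2 := S.gf.R2
  have hC12 := S.gf.C12pos
  have hN : 0 ≤ C9 a lam R₀ M₀ b * (KK n k ε * ε) := by
    have := S.gf.C9pos; have := S.K1; have := S.K2; positivity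
  set N := C9 a lam R₀ M₀ b * (KK n k ε * ε) with hNd
  set s := ∑ i, a i with hs
  have hρ0 : 0 ≤ ρ := by linarith
  set B' := C12 a lam b * (ρ + N) * ‖z‖ with hB'
  have hB'0 : 0 ≤ B' := by positivity
  set B := 2 * B' / lam with hB
  have hB0 : 0 ≤ B := by positivity
  have hBl : B * lam = 2 * B' := by rw [hB]; field_simp
  set r := G R - (2 + b) * R with hr
  set T := Tf a u y z with hT
  set K := {x : Euc n | R/3 ≤ Qd a 0 x ∧ Qd a 0 x ≤ R} with hKd
  have hKK : ∀ x ∈ K, x ∈ Ks a x₀ ε R := fun x hx =>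
    ⟨hx.2, by linarith [S.far (x := x) (by linarith [hx.1]), S.e1]⟩
  have hTc : ContinuousOn T K := by
    have hc := fun e => (S.pdcont e).mono hKK
    exact ((continuousOn_const.mul (hc z)).sub (ContinuousOn.mul (by fun_prop) (hc _))).add
      (ContinuousOn.mul (by fun_prop) (hc _))
  have hTJ : ∀ x ∈ U, ∀ e, Jet T x e
      (bl a y (av a y) * pd e (pd z u) x - (inner ℝ (av a z) e * pd (av a y) u x + inner ℝ (av a z) (x - y) * pd e (pd (av a y) u) x)
        + (inner ℝ (av a y) e * pd (av a z) u x + inner ℝ (av a y) (x - y) * pd e (pd (av a z) u) x))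
      (bl a y (av a y) * pd e (pd e (pd z u)) x
        - (0 * pd (av a y) u x + 2 * inner ℝ (av a z) e * pd e (pd (av a y) u) x + inner ℝ (av a z) (x - y) * pd e (pd e (pd (av a y) u)) x)
        + (0 * pd (av a z) u x + 2 * inner ℝ (av a y) e * pd e (pd (av a z) u) x + inner ℝ (av a y) (x - y) * pd e (pd e (pd (av a z) u)) x)) := by
    intro x hx e
    exact ((((hsm.pdd hU z).jet hU hx e).cmul _).sub ((Jet.lin (av a z) y x e).mul ((hsm.pdd hU _).jet hU hx e))).add
      ((Jet.lin (av a y) y x e).mul ((hsm.pdd hU _).jet hU hx e))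
  have hσT : ∀ x, σ * T x ≤ |T x| := by
    intro x
    have := le_abs_self (σ * T x)
    rwa [abs_mul, hσ, one_mul] at this
  have hQ1 : ∀ x : Euc n, Qd (fun _ => 1) y x = ‖x - y‖^2/2 := fun x => Qd_one y x
  have key : ∀ x ∈ K, σ * T x - (B * (u x - ((2 + b) * Qd a 0 x + r)) + 2 * B' * Qd (fun _ => 1) y x) ≤ 0 := by
    apply MP (D := {x : Euc n | R/3 < Qd a 0 x ∧ Qd a 0 x < R}) (by have := S.gf.hn; omega)
    · apply cpt_of_le S.gf.lam0 S.gf.la _ (fun x hx => (hKK x hx).1)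
      exact (isClosed_le continuous_const (Qd_cont a 0)).inter (isClosed_le (Qd_cont a 0) continuous_const)
    · exact (isOpen_lt continuous_const (Qd_cont a 0)).inter (isOpen_lt (Qd_cont a 0) continuous_const)
    · exact fun x hx => ⟨hx.1.le, hx.2.le⟩
    · have hq : ∀ (c : Fin n → ℝ) (p : Euc n), ContinuousOn (Qd c p) K := fun c p => (Qd_cont c p).continuousOn
      exact (continuousOn_const.mul hTc).sub ((continuousOn_const.mul ((S.cont.mono hKK).sub
        ((continuousOn_const.mul (hq _ _)).add continuousOn_const))).add (continuousOn_const.mul (hq _ _)))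
    · intro x hx hxn
      have huv := S.uv (x := x) (by linarith [hx.1]) hx.2
      have h0 : 0 ≤ B * (u x - ((2 + b) * Qd a 0 x + r)) := mul_nonneg hB0 (by linarith)
      have hmain : |T x| ≤ B' * ‖x - y‖^2 := by
        have q1 : 0 ≤ 30 * s^3 * (s + 1) / lam := by positivity
        have q2 : 0 ≤ 2 * (1 + b) * s^3 := by positivity
        by_cases h3 : R/3 < Qd a 0 x
        · have h4 : Qd a 0 x = R := le_antisymm hx.2 (not_lt.1 (fun h => hxn ⟨h3, h⟩))
          refine (S.Tout hρ h4 hy hz).trans ?_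
          rw [hB']
          gcongr
          · rw [C12]; linarith
          · linarith
        · have h4 : Qd a 0 x = R/3 := le_antisymm (not_lt.1 h3) hx.1
          refine (S.Tin hρ1 hρ2 hρ h4 hy).trans ?_
          rw [hB']
          gcongr
          rw [C12]; linarith
      have := hσT x
      rw [hQ1]
      linarith
    · intro x hx
      have hxO : x ∈ Om a x₀ ε R := ⟨hx.2, by linarith [S.far (x := x) (by linarith [hx.1]), S.e1]⟩
      have hxU := S.sol.mem hxO
      obtain ⟨f, w, L⟩ := pack S.gf.hk S.sol hxO
      refine ⟨f, w, _, _, L.wpos, fun i => ((hTJ x hxU (f i)).cmul σ).sub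
        ((((hsm.jet hU hxU (f i)).sub (((Jet.quad a 0 x (f i)).cmul (2 + b)).add (Jet.const x (f i) r))).cmul B).add
          ((Jet.quad (fun _ => 1) y x (f i)).cmul (2 * B'))), ?_⟩
      have h1 := quadN S.gf.hk S.ha (m := 1) one_pos
      have h2 := L.cone _ (R1_herm _ _ _) h1.1 (by rw [h1.2, S.gf.sig]; simp)
      simp only [qf_R1, zero_mul, zero_add, one_mul] at h2
      have h3 : lam * ∑ i, w i ≤ ∑ i, w i * bl a (f i) (f i) := by
        rw [Finset.mul_sum]
        apply Finset.sum_le_sum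
        intro i _
        have := bl_lower S.gf.la (f i)
        rw [f.orthonormal.1 i] at this
        nlinarith [L.wpos i]
      have h4 := L.rot (av a y) (av a z)
      have h5 := L.d1 z
      have h6 := L.d1 (av a y)
      have h6' := L.d1 (av a z)
      have h8 : ∀ i, bl (fun _ => (1:ℝ)) (f i) (f i) = 1 := fun i => by rw [one_blsq, f.orthonormal.1 i]; norm_num
      simp only [h8]
      have h7 : ∑ i, w i * (σ * (bl a y (av a y) * pd (f i) (pd (f i) (pd z u)) x
        - (0 * pd (av a y) u x + 2 * inner ℝ (av a z) (f i) * pd (f i) (pd (av a y) u) x + inner ℝ (av a z) (x - y) * pd (f i) (pd (f i) (pd (av a y) u)) x)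
        + (0 * pd (av a z) u x + 2 * inner ℝ (av a y) (f i) * pd (f i) (pd (av a z) u) x + inner ℝ (av a y) (x - y) * pd (f i) (pd (f i) (pd (av a z) u)) x))
        - (B * (pd (f i) (pd (f i) u) x - ((2 + b) * bl a (f i) (f i) + 0)) + 2 * B' * 1)) =
        σ * (bl a y (av a y) * (∑ i, w i * pd (f i) (pd (f i) (pd z u)) x)
          - 2 * (∑ i, w i * (inner ℝ (av a z) (f i) * pd (f i) (pd (av a y) u) x)) - inner ℝ (av a z) (x - y) * (∑ i, w i * pd (f i) (pd (f i) (pd (av a y) u)) x)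
          + 2 * (∑ i, w i * (inner ℝ (av a y) (f i) * pd (f i) (pd (av a z) u) x)) + inner ℝ (av a y) (x - y) * (∑ i, w i * pd (f i) (pd (f i) (pd (av a z) u)) x))
        - B * ((∑ i, w i * pd (f i) (pd (f i) u) x) - (2 + b) * ∑ i, w i * bl a (f i) (f i)) - 2 * B' * ∑ i, w i := by
        simp only [Finset.mul_sum, ← Finset.sum_sub_distrib, ← Finset.sum_add_distrib]
        apply Finset.sum_congr rfl; intro i _; ring
      rw [h7, h4, h5, h6, h6', L.tr]
      set W := ∑ i, w i * bl a (f i) (f i) with hW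
      have hk0 : (0:ℝ) ≤ k := Nat.cast_nonneg k
      have h9 : lam * ∑ i, w i ≤ (2 + b) * W - (k + 1) := by nlinarith
      have h10 := mul_le_mul_of_nonneg_left h9 hB0
      have h11 : B * (lam * ∑ i, w i) = 2 * B' * ∑ i, w i := by rw [← mul_assoc, hBl]
      linarith
  obtain ⟨d, hd, hli⟩ := S.outer_line hy
  have hT0 : T y = 0 := by
    have := S.Tout hρ hy hy hz
    rw [sub_self, norm_zero] at this
    have h1 : |T y| ≤ 0 := by rw [hT]; linarith
    exact abs_nonpos_iff.1 h1
  have hJ := (((((hsm.jet hU hyU (-y)).sub (((Jet.quad a 0 y (-y)).cmul (2 + b)).add (Jet.const y (-y) r))).cmul B).add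
          ((Jet.quad (fun _ => 1) y y (-y)).cmul (2 * B'))).sub ((hTJ y hyU (-y)).cmul σ)).right (by
    rw [hT0, S.uR y hy, hy, Qd_one, sub_self]; simp [hr]) hd (by
    intro t h1 h2
    have h3 := hli t h1 h2
    have h4 := key _ ⟨h3.2.le, h3.1.1.le⟩
    linarith)
  obtain ⟨θ, h1, h2, h3, h4, -⟩ := S.outB hy
  have hR1 : 1 ≤ R := by linarith
  have hθ : θ ≤ 1 + b := by nlinarith
  have hyy : bl a y y = 2 * R := by unfold Qd at hy; rw [sub_zero] at hy; linarith
  have hneg : pd (-y) (pd z u) y = - pd y (pd z u) y := by simp [pd]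
  have hbz : bl a z (-y) = 0 := by rw [bl_neg_right, bl_comm, hz, neg_zero]
  simp only [sub_self, sub_zero, inner_av, hneg, h4, bl_neg_right, hyy] at hJ
  rw [bl_comm a z y, hz] at hJ
  have hb0 : bl (fun _ => (1:ℝ)) (0 : Euc n) y = 0 := by rw [one_bl]; simp
  have hb1 : ∀ e : Euc n, bl a e (0 : Euc n) = 0 := by intro e; simp [bl]
  simp only [hb0, hb1] at hJ
  have hη : ‖av a y‖ ≤ s * ρ := (av_norm S.ha y).trans (mul_le_mul_of_nonneg_left (hρ y hy.le) hsa)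
  have hH : bl a y (av a y) = ‖av a y‖^2 := by rw [← inner_av, real_inner_self_eq_norm_sq]
  have hp : |bl a y (av a z)| ≤ ‖av a y‖ * (s * ‖z‖) := by
    rw [← inner_av]
    exact (abs_real_inner_le_norm _ _).trans (mul_le_mul_of_nonneg_left (av_norm S.ha z) (norm_nonneg _))
  have hHlow : lam * ρ ≤ ‖av a y‖ := by
    have q1 : 2 * R ≤ ‖av a y‖ * ρ := by
      rw [← hyy, ← inner_av]
      exact (real_inner_le_norm _ _).trans (mul_le_mul_of_nonneg_left (hρ y hy.le) (norm_nonneg _))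
    have q2 : (lam * ρ) * ρ ≤ ‖av a y‖ * ρ := by linarith
    exact le_of_mul_le_mul_right q2 (by linarith)
  have hP : |bl a y (av a z)| ≤ s^2 * ρ * ‖z‖ := hp.trans (by nlinarith [mul_le_mul_of_nonneg_right hη (mul_nonneg hsa (norm_nonneg z))])
  rw [hH] at hJ
  set H := ‖av a y‖ with hHd
  set P := bl a y (av a z) with hPd
  set V := pd y (pd z u) y with hV
  have hσP : σ * P ≤ s^2 * ρ * ‖z‖ := by
    refine (le_abs_self _).trans ?_
    rw [abs_mul, hσ, one_mul]; exact hP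
  have k1 : H^2 * (-(σ * V)) ≤ 2 * R * ((2 + b) * B + (1 + b) * (s^2 * ρ * ‖z‖)) := by
    have q1 : θ * (σ * P) ≤ (1 + b) * (s^2 * ρ * ‖z‖) := by
      have q2 : 0 ≤ s^2 * ρ * ‖z‖ := by positivity
      calc θ * (σ * P) ≤ θ * (s^2 * ρ * ‖z‖) := mul_le_mul_of_nonneg_left hσP (by linarith)
        _ ≤ _ := mul_le_mul_of_nonneg_right hθ q2
    have q3 : 0 ≤ 2 * R * (B * θ) := by
      have : 0 ≤ θ := by linarith
      have : 0 ≤ R := by linarith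
      positivity
    have q4 := mul_le_mul_of_nonneg_left q1 (show 0 ≤ 2 * R by linarith)
    nlinarith
  have hD : (2 + b) * B + (1 + b) * (s^2 * ρ * ‖z‖) ≤ lam * (C13 a lam b * (ρ + N) * ‖z‖) := by
    have q1 : lam * (C13 a lam b * (ρ + N) * ‖z‖) = (2 + b) * B + (1 + b) * (s^2 * (ρ + N) * ‖z‖) := by
      rw [C13, hB, hB', ← hs]; field_simp
    rw [q1]
    gcongr
    linarith
  have hH2 : (lam * ρ)^2 ≤ H^2 := pow_le_pow_left₀ (by positivity) hHlow 2
  have hE0 : 0 ≤ C13 a lam b * (ρ + N) * ‖z‖ := by have := S.gf.C13pos; positivity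
  have hHpos : 0 < H^2 := lt_of_lt_of_le (by positivity) hH2
  have k2 : H^2 * (-(σ * V)) ≤ H^2 * (C13 a lam b * (ρ + N) * ‖z‖) := by
    calc _ ≤ _ := k1
      _ ≤ 2 * R * (lam * (C13 a lam b * (ρ + N) * ‖z‖)) := mul_le_mul_of_nonneg_left hD (by linarith)
      _ = (lam * ρ)^2 * (C13 a lam b * (ρ + N) * ‖z‖) := by rw [← hρ2]; ring
      _ ≤ _ := mul_le_mul_of_nonneg_right hH2 hE0
  exact le_of_mul_le_mul_left k2 hHpos

noncomputable def C14 (a : Fin n → ℝ) (lam R₀ M₀ b : ℝ) : ℝ := C13 a lam b * (1 + C9 a lam R₀ M₀ b) / lam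

lemma GF.C14pos (H : GF n k a lam R₀ G g M₀ b h) : 0 ≤ C14 a lam R₀ M₀ b := by
  have := H.C13pos; have := H.C9pos; have := H.lam0
  unfold C14; positivity

/-- mixed derivatives at the outer boundary -/
lemma St.mix_out (S : St n k a lam R₀ G g M₀ b h x₀ ε R u U) {y z : Euc n} (hy : Qd a 0 y = R)
    (hz : bl a y z = 0) :
    (pd z (pd y u) y)^2 ≤ (C14 a lam R₀ M₀ b * (1 + KK n k ε * ε))^2 * (bl a y y * bl a z z) := by
  obtain ⟨ρ, h1, h2, h3⟩ := S.rho
  have hl := S.gf.lam0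
  have hC := S.gf.C13pos
  have hC9 := S.gf.C9pos
  have hK := S.K1
  have hyU := S.KU (S.outK hy)
  have hyy : bl a y y = 2 * R := by unfold Qd at hy; rw [sub_zero] at hy; linarith
  have h4 := S.mix_out0 h1 h2 h3 hy hz (σ := 1) (by simp)
  have h5 := S.mix_out0 h1 h2 h3 hy hz (σ := -1) (by simp)
  have h6 : |pd z (pd y u) y| ≤ C13 a lam b * (ρ + C9 a lam R₀ M₀ b * (KK n k ε * ε)) * ‖z‖ := by
    rw [pd_comm S.sol.sm S.sol.hU hyU, abs_le]
    constructor <;> linarith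
  set t := KK n k ε * ε with ht
  set c9 := C9 a lam R₀ M₀ b with hc9
  have h7 : ρ + c9 * t ≤ ρ * ((1 + c9) * (1 + t)) := by
    have : 0 ≤ c9 * t := by positivity
    nlinarith
  have h8 : C13 a lam b * (ρ + c9 * t) * ‖z‖ ≤ (C14 a lam R₀ M₀ b * (1 + t)) * (lam * ρ * ‖z‖) := by
    calc _ ≤ C13 a lam b * (ρ * ((1 + c9) * (1 + t))) * ‖z‖ := by gcongr
      _ = _ := by rw [C14, ← hc9]; field_simp
  rw [← sq_abs]
  calc _ ≤ ((C14 a lam R₀ M₀ b * (1 + t)) * (lam * ρ * ‖z‖))^2 := pow_le_pow_left₀ (abs_nonneg _) (h6.trans h8) 2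
    _ = (C14 a lam R₀ M₀ b * (1 + t))^2 * (lam * ρ^2 * (lam * ‖z‖^2)) := by ring
    _ ≤ _ := by
      rw [hyy, h2]
      have := bl_lower S.gf.la z
      have : 0 ≤ 2 * R := by linarith [S.hR, S.gf.R2]
      gcongr
end OUTMIX2

open scoped Classical Topology
open Real Filter MeasureTheory

section GLOBAL
variable {n k : ℕ} {a : Fin n → ℝ} {lam R₀ : ℝ} {G g : ℝ → ℝ} {M₀ b h : ℝ} {x₀ : Euc n} {ε R : ℝ}
    {u : Euc n → ℝ} {U : Set (Euc n)}

/-- a positive lower bound of `a i * sg (erase i) k a` -/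
noncomputable def mlow (k : ℕ) (a : Fin n → ℝ) : ℝ := (∑ i, (a i * sg (Finset.univ.erase i) k a)⁻¹)⁻¹

lemma GF.mpos (H : GF n k a lam R₀ G g M₀ b h) : 0 < mlow k a ∧ ∀ i, mlow k a ≤ a i * sg (Finset.univ.erase i) k a := by
  have hx : ∀ i, 0 < a i * sg (Finset.univ.erase i) k a := fun i =>
    mul_pos (H.ha i) (sg_pos (by simp; have := H.hk; omega) H.ha)
  have hi : 0 < n := by have := H.hn; omega
  have h1 : ∀ i, (a i * sg (Finset.univ.erase i) k a)⁻¹ ≤ ∑ i, (a i * sg (Finset.univ.erase i) k a)⁻¹ := fun i =>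
    Finset.single_le_sum (f := fun i => (a i * sg (Finset.univ.erase i) k a)⁻¹) (fun j _ => (inv_pos.2 (hx j)).le) (Finset.mem_univ i)
  have h2 : 0 < ∑ i, (a i * sg (Finset.univ.erase i) k a)⁻¹ := (inv_pos.2 (hx ⟨0, hi⟩)).trans_le (h1 _)
  exact ⟨inv_pos.2 h2, fun i => inv_le_of_inv_le₀ (hx i) (h1 i)⟩

noncomputable def C15 (n k : ℕ) (a : Fin n → ℝ) (lam R₀ M₀ b : ℝ) : ℝ :=
  (2 * (1 + b) + 2 * C14 a lam R₀ M₀ b + 8 * C14 a lam R₀ M₀ b ^ 2 * 4^(kap n k) + 4^k / mlow k a) * ∑ i, a i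

lemma GF.C15pos (H : GF n k a lam R₀ G g M₀ b h) : 0 ≤ C15 n k a lam R₀ M₀ b := by
  have := H.C14pos; have := H.b0; have := H.sa; have := H.mpos.1
  unfold C15; positivity

lemma St.out2 (S : St n k a lam R₀ G g M₀ b h x₀ ε R u U) {y : Euc n} (hy : Qd a 0 y = R) (e : Euc n) :
    pd e (pd e u) y ≤ C15 n k a lam R₀ M₀ b * KK n k ε * ‖e‖^2 := by
  have he := S.e0
  have he1 := S.e1
  have hK2 := S.K2
  have hK1 := S.K1
  have hKs := S.Ksq
  have hC := S.gf.C14pos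
  have hb := S.gf.b0
  have hm := S.gf.mpos
  have hsa := S.gf.sa
  have hR1 : 1 ≤ R := by linarith [S.hR, S.gf.R2]
  obtain ⟨θ, h1, h2, h3, h4, h5⟩ := S.outB hy
  have hθ : θ ≤ 1 + b := by nlinarith
  have hQ0 : 0 ≤ C14 a lam R₀ M₀ b * (1 + KK n k ε * ε) := mul_nonneg hC (by linarith)
  have hy0 : y ≠ 0 := by have := S.ne_out hy; rwa [sub_zero] at this
  have hd := dbl_normal (b := a) (lam := lam) (m := mlow k a) (θ := θ) (Q := C14 a lam R₀ M₀ b * (1 + KK n k ε * ε))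
    S.gf.hk S.sol (S.Ks_cl (S.outK hy)) S.gf.lam0 S.gf.la hm.1 hm.2 hy0 h1 hQ0 h5
    (fun z hz => S.mix_out hy hz) e
  set c := C14 a lam R₀ M₀ b with hc
  set t := KK n k ε * ε with ht
  have hbe := bl_upper S.ha e
  have hm4 : 0 ≤ 4^k / mlow k a := by have := hm.1; positivity
  have htK : t ≤ KK n k ε := by rw [ht]; nlinarith
  have ht2 : t^2 ≤ 4^(kap n k) * KK n k ε := by
    calc t^2 = (KK n k ε * ε^2) * KK n k ε := by rw [ht]; ring
      _ ≤ _ := mul_le_mul_of_nonneg_right hKs (by linarith)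
  have q1 : 2 * (c * (1 + t))^2 / θ ≤ 8 * c^2 * 4^(kap n k) * KK n k ε := by
    rw [div_le_iff₀ (by linarith)]
    have w1 : (1 + t)^2 ≤ 4 * t^2 := by nlinarith
    have w2 : 2 * (c * (1 + t))^2 ≤ 8 * c^2 * 4^(kap n k) * KK n k ε := by
      calc 2 * (c * (1 + t))^2 = 2 * c^2 * (1 + t)^2 := by ring
        _ ≤ 2 * c^2 * (4 * (4^(kap n k) * KK n k ε)) := mul_le_mul_of_nonneg_left (by linarith) (by positivity)
        _ = _ := by ring
    have w3 : 0 ≤ 8 * c^2 * 4^(kap n k) * KK n k ε := by positivity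
    nlinarith
  have q2 : c * (1 + t) ≤ 2 * c * KK n k ε := by nlinarith
  have q3 : 4^k / mlow k a ≤ 4^k / mlow k a * KK n k ε := le_mul_of_one_le_right hm4 (by linarith)
  have q4 : 2 * θ ≤ 2 * (1 + b) * KK n k ε := by nlinarith
  have q5 : 2 * θ + c * (1 + t) + 2 * (c * (1 + t))^2 / θ + 4^k / mlow k a ≤
    (2 * (1 + b) + 2 * c + 8 * c^2 * 4^(kap n k) + 4^k / mlow k a) * KK n k ε := by linarith
  have hf0 : 0 ≤ (2 * (1 + b) + 2 * c + 8 * c^2 * 4^(kap n k) + 4^k / mlow k a) * KK n k ε := by positivity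
  calc _ ≤ _ := hd
    _ ≤ ((2 * (1 + b) + 2 * c + 8 * c^2 * 4^(kap n k) + 4^k / mlow k a) * KK n k ε) * ((∑ i, a i) * ‖e‖^2) :=
      mul_le_mul q5 hbe (bl_nonneg S.ha e) hf0
    _ = _ := by rw [C15, ← hc]; ring

noncomputable def C16 (n k : ℕ) (a : Fin n → ℝ) (lam R₀ M₀ b : ℝ) : ℝ :=
  |C11 n k a lam R₀ M₀ b| + C15 n k a lam R₀ M₀ b

lemma St.glob (S : St n k a lam R₀ G g M₀ b h x₀ ε R u U) {x : Euc n} (hx : x ∈ Ks a x₀ ε R) (e : Euc n) :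
    pd e (pd e u) x ≤ C16 n k a lam R₀ M₀ b * KK n k ε * ‖e‖^2 := by
  have hK2 := S.K2
  have hC := S.gf.C15pos
  have hsm := S.sol.sm
  have hU := S.sol.hU
  have hK0 : 0 ≤ KK n k ε * ‖e‖^2 := mul_nonneg (by linarith) (by positivity)
  refine S.lharm (φ := pd e (pd e u)) ?_ ?_ ?_ ?_ x hx
  · exact ((hsm.pdd hU e).pdd hU e).continuousOn.mono (fun _ hx => S.KU hx)
  · intro y hy
    refine (S.in2 hy e).trans ?_
    have := le_abs_self (C11 n k a lam R₀ M₀ b)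
    unfold C16
    nlinarith
  · intro y hy
    refine (S.out2 hy e).trans ?_
    have := abs_nonneg (C11 n k a lam R₀ M₀ b)
    unfold C16
    nlinarith
  · intro x hx f w L
    exact ⟨_, _, fun i => ((hsm.pdd hU e).pdd hU e).jet hU (S.sol.mem hx) (f i), L.d2 e⟩

theorem St.final (S : St n k a lam R₀ G g M₀ b h x₀ ε R u U) {x : Euc n} (hx : x ∈ Om a x₀ ε R) :
    ‖iteratedFDeriv ℝ 2 u x‖ ≤ n * C16 n k a lam R₀ M₀ b * KK n k ε := by
  have hK2 := S.K2
  have hC := S.gf.C15pos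
  have hsm := S.sol.sm
  have hU := S.sol.hU
  have hxU := S.sol.mem hx
  have hC16 : 0 ≤ C16 n k a lam R₀ M₀ b := by
    unfold C16; have := abs_nonneg (C11 n k a lam R₀ M₀ b); linarith
  set D := C16 n k a lam R₀ M₀ b * KK n k ε with hD
  have hD0 : 0 ≤ D := by positivity
  have hn1 : (1:ℝ) ≤ n := by exact_mod_cast (by have := S.gf.hn; omega : 1 ≤ n)
  have hM := hess_herm hsm hU hxU
  have hup : ∀ j, hM.eigenvalues j ≤ D := by
    intro j
    have h1 := S.glob (Om_sub_Ks hx) (hM.eigenvectorBasis j)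
    rw [← qf_hess hsm hU hxU, qf_eigen, real_inner_self_eq_norm_sq, hM.eigenvectorBasis.orthonormal.1 j] at h1
    simpa using h1
  have htr : 0 < ∑ j, hM.eigenvalues j := by
    have h1 := S.sol.kc x hx 1 le_rfl (by omega)
    rw [matSk_eq_sg (by have := S.gf.hn; omega) hM] at h1
    simpa [sg, Finset.powersetCard_one] using h1
  have hlow : ∀ j, -(n * D) ≤ hM.eigenvalues j := by
    intro j
    have h1 := Finset.add_sum_erase Finset.univ hM.eigenvalues (Finset.mem_univ j)
    have h2 : ∑ i ∈ Finset.univ.erase j, hM.eigenvalues i ≤ ∑ i ∈ Finset.univ.erase j, D :=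
      Finset.sum_le_sum (fun i _ => hup i)
    have h3 : ∑ i ∈ Finset.univ.erase j, D ≤ n * D := by
      calc ∑ i ∈ Finset.univ.erase j, D ≤ ∑ i : Fin n, D :=
            Finset.sum_le_sum_of_subset_of_nonneg (Finset.erase_subset _ _) (fun _ _ _ => hD0)
        _ = _ := by simp
    linarith
  have : n * C16 n k a lam R₀ M₀ b * KK n k ε = n * D := by rw [hD]; ring
  rw [this]
  refine hess_bound hsm hU hxU (by positivity) (fun e => ?_)
  rw [abs_le]
  constructor
  · rw [← qf_hess hsm hU hxU, qf_diag hM]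
    have h4 : ‖e‖^2 = ∑ j, (inner ℝ e (hM.eigenvectorBasis j))^2 := by
      rw [← hM.eigenvectorBasis.sum_sq_norm_inner_left e]
      simp
    rw [h4, ← neg_mul, Finset.mul_sum]
    apply Finset.sum_le_sum
    intro j _
    have := hlow j
    nlinarith [sq_nonneg (inner ℝ e (hM.eigenvectorBasis j))]
  · refine (S.glob (Om_sub_Ks hx) e).trans ?_
    apply mul_le_mul_of_nonneg_right _ (by positivity)
    nlinarith
end GLOBAL

open scoped Classical Topology
open Real Filter MeasureTheory

section PROF
variable {n k : ℕ} {a : Fin n → ℝ}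

lemma esymm_upd (i : Fin n) : esymmVec n k (Function.update a i 0) = sg (Finset.univ.erase i) k a := by
  unfold esymmVec sg
  rw [← Finset.sum_subset (Finset.powersetCard_mono (Finset.erase_subset i Finset.univ))]
  · apply Finset.sum_congr rfl
    intro t ht
    apply Finset.prod_congr rfl
    intro j hj
    have : j ≠ i := Finset.ne_of_mem_erase ((Finset.mem_powersetCard.1 ht).1 hj)
    rw [Function.update_of_ne this]
  · intro t ht hnt
    have hi : i ∈ t := by
      by_contra hi
      apply hnt
      rw [Finset.mem_powersetCard] at ht ⊢
      exact ⟨fun j hj => Finset.mem_erase.2 ⟨fun h => hi (h ▸ hj), Finset.mem_univ j⟩, ht.2⟩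
    exact Finset.prod_eq_zero hi (by simp)

lemma hk_le (i : Fin n) : a i * sg (Finset.univ.erase i) k a ≤ hkfun n (k+1) a := by
  unfold hkfun
  have := le_ciSup (f := fun i : Fin n => esymmVec n (k + 1 - 1) (Function.update a i 0) * a i) (Set.finite_range _).bddAbove i
  simp only [Nat.add_sub_cancel, esymm_upd] at this ⊢
  linarith

lemma hk_pos (hn : 0 < n) (hk : k + 1 ≤ n) (ha : ∀ i, 0 < a i) : 0 < hkfun n (k+1) a :=
  lt_of_lt_of_le (mul_pos (ha ⟨0, hn⟩) (sg_pos (by simp; omega) ha)) (hk_le ⟨0, hn⟩)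

lemma hk_lt (hn : 3 ≤ n) (hk : k + 1 ≤ n) (ha : ∀ i, 0 < a i) (hsig : sg Finset.univ (k+1) a = 1)
    (h0 : k = 0 → ∀ i, a i < 1/2) : 2 * hkfun n (k+1) a < k + 1 := by
  have hne : Nonempty (Fin n) := ⟨⟨0, by omega⟩⟩
  obtain ⟨i, hi⟩ := exists_eq_ciSup_of_finite (f := fun i : Fin n => esymmVec n (k + 1 - 1) (Function.update a i 0) * a i)
  have hi' : hkfun n (k+1) a = a i * sg (Finset.univ.erase i) k a := by
    unfold hkfun
    rw [← hi]
    simp only [Nat.add_sub_cancel, esymm_upd]; ring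
  rw [hi']
  have hs : sg Finset.univ (k+1) a = a i * sg (Finset.univ.erase i) k a + sg (Finset.univ.erase i) (k+1) a :=
    sg_erase (Finset.mem_univ i) _ _
  rcases Nat.lt_or_ge 1 k with h | h
  · have h1 : 0 ≤ sg (Finset.univ.erase i) (k+1) a := sg_nonneg ha
    have h2 : (2:ℝ) ≤ k := by exact_mod_cast h
    linarith
  · interval_cases k
    · have := h0 rfl i
      rw [sg_zero]; push_cast; linarith
    · have h1 : 0 < sg (Finset.univ.erase i) (1+1) a := sg_pos (by simp; omega) ha
      push_cast; linarith

lemma gexp (hh : 0 < hkfun n (k+1) a) : genExp n (k+1) a * hkfun n (k+1) a = -((k:ℝ)+1)/2 := by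
  unfold genExp; push_cast; field_simp

lemma gexp_lt (hh : 0 < hkfun n (k+1) a) (h2 : 2 * hkfun n (k+1) a < k + 1) : genExp n (k+1) a < -1 := by
  unfold genExp; push_cast
  rw [div_lt_iff₀ (by positivity)]; linarith

variable {α : ℝ}

lemma q1 (hα : 0 < α) {t : ℝ} (ht : 0 < t) (p : ℝ) : 1 < 1 + α * t^p := by
  have : 0 < α * t^p := by positivity
  linarith

lemma g_one (hα : 0 < α) {t : ℝ} (ht : 0 < t) : 1 ≤ genInt n (k+1) a α t := by
  unfold genInt
  exact Real.one_le_rpow (q1 hα ht _).le (by positivity)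

lemma g_le (hα : 0 < α) {t : ℝ} (ht : 0 < t) : genInt n (k+1) a α t ≤ 1 + α * t^(genExp n (k+1) a) := by
  unfold genInt
  have h1 : (1:ℝ) / ((k+1:ℕ):ℝ) ≤ 1 := by
    rw [div_le_one (by positivity)]; push_cast; linarith [(Nat.cast_nonneg k : (0:ℝ) ≤ k)]
  calc _ ≤ (1 + α * t ^ genExp n (k+1) a)^(1:ℝ) := Real.rpow_le_rpow_of_exponent_le (q1 hα ht _).le h1
    _ = _ := Real.rpow_one _

lemma g_pow (hα : 0 < α) {t : ℝ} (ht : 0 < t) : genInt n (k+1) a α t ^ (k+1) = 1 + α * t^(genExp n (k+1) a) := by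
  unfold genInt
  have := q1 hα ht (genExp n (k+1) a)
  rw [← Real.rpow_natCast, ← Real.rpow_mul (by linarith), one_div_mul_cancel (by positivity), Real.rpow_one]

lemma g_der (hα : 0 < α) {t : ℝ} (ht : 0 < t) : HasDerivAt (genInt n (k+1) a α)
    ((α * (genExp n (k+1) a * t^(genExp n (k+1) a - 1))) * (1 / ((k+1:ℕ):ℝ)) * (1 + α * t^(genExp n (k+1) a))^(1 / ((k+1:ℕ):ℝ) - 1)) t := by
  have h1 := q1 hα ht (genExp n (k+1) a)
  have h2 : HasDerivAt (fun t : ℝ => 1 + α * t^(genExp n (k+1) a)) (α * (genExp n (k+1) a * t^(genExp n (k+1) a - 1))) t :=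
    ((Real.hasDerivAt_rpow_const (Or.inl ht.ne')).const_mul α).const_add 1
  exact h2.rpow_const (Or.inl (by linarith))

lemma g_dg (hα : 0 < α) (hh : 0 < hkfun n (k+1) a) {t : ℝ} (ht : 0 < t) : ∃ g', HasDerivAt (genInt n (k+1) a α) g' t ∧ g' ≤ 0 ∧
    0 < genInt n (k+1) a α t + 2 * t * g' * hkfun n (k+1) a ∧
    1 ≤ genInt n (k+1) a α t ^ k * (genInt n (k+1) a α t + 2 * t * g' * hkfun n (k+1) a) := by
  have hg := g_one (n := n) (k := k) (a := a) hα ht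
  have hpow := g_pow (n := n) (k := k) (a := a) hα ht
  refine ⟨_, g_der hα ht, ?_, ?_⟩
  · have hp : genExp n (k+1) a ≤ 0 := by
      unfold genExp
      apply div_nonpos_of_nonpos_of_nonneg
      · have := Nat.cast_nonneg (α := ℝ) (k+1); linarith
      · positivity
    have h1 := q1 hα ht (genExp n (k+1) a)
    apply mul_nonpos_of_nonpos_of_nonneg
    · apply mul_nonpos_of_nonpos_of_nonneg
      · apply mul_nonpos_of_nonneg_of_nonpos hα.le
        exact mul_nonpos_of_nonpos_of_nonneg hp (by positivity)
      · positivity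
    · apply Real.rpow_nonneg; linarith
  have hq := q1 hα ht (genExp n (k+1) a)
  have hge := gexp hh
  set p := genExp n (k+1) a with hp
  set q := 1 + α * t^p with hqd
  have hgd : genInt n (k+1) a α t = q^(1 / ((k+1:ℕ):ℝ)) := rfl
  have e1 : q^(1 / ((k+1:ℕ):ℝ) - 1) = genInt n (k+1) a α t / q := by
    rw [hgd, Real.rpow_sub (by linarith), Real.rpow_one]
  have e2 : t * t^(p-1) = t^p := by
    rw [Real.rpow_sub_one ht.ne']; field_simp
  set γ := genInt n (k+1) a α t with hγ
  have e3 : γ + 2 * t * ((α * (p * t^(p - 1))) * (1 / ((k+1:ℕ):ℝ)) * q^(1 / ((k+1:ℕ):ℝ) - 1)) * hkfun n (k+1) a = γ / q := by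
    rw [e1]
    have : 2 * t * ((α * (p * t^(p - 1))) * (1 / ((k+1:ℕ):ℝ)) * (γ/q)) * hkfun n (k+1) a =
      2 * α * (p * hkfun n (k+1) a) * (t * t^(p-1)) * (1 / ((k+1:ℕ):ℝ)) * (γ/q) := by ring
    rw [this, hge, e2]
    have h3 : α * t^p = q - 1 := by rw [hqd]; ring
    have h4 : 2 * α * (-((k:ℝ)+1)/2) * t^p * (1 / ((k+1:ℕ):ℝ)) * (γ/q) = -(α * t^p) * (γ/q) := by
      push_cast
      field_simp
    rw [h4, h3]
    have : q ≠ 0 := by linarith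
    field_simp; ring
  rw [e3]
  refine ⟨div_pos (by linarith) (by linarith), ?_⟩
  rw [← mul_div_assoc, ← pow_succ, hpow, div_self (by linarith)]

lemma G_der (hα : 0 < α) {R₀ : ℝ} (hR : 0 < R₀) {t : ℝ} (ht : 0 < t) :
    HasDerivAt (fun t => ∫ s in R₀..t, genInt n (k+1) a α s) (genInt n (k+1) a α t) t := by
  have hc : ∀ s, 0 < s → ContinuousAt (genInt n (k+1) a α) s := fun s hs => (g_der hα hs).continuousAt
  have hco : ContinuousOn (genInt n (k+1) a α) (Set.Ioi 0) := fun s hs => (hc s hs).continuousWithinAt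
  apply intervalIntegral.integral_hasDerivAt_right
  · apply ContinuousOn.intervalIntegrable
    apply hco.mono
    intro s hs
    have := hs.1
    exact lt_of_lt_of_le (lt_min hR ht) this
  · exact hco.stronglyMeasurableAtFilter isOpen_Ioi t ht
  · exact hc t ht

lemma cmp_low {G g : ℝ → ℝ} (hG : ∀ t, 0 < t → HasDerivAt G (g t) t) {s t m : ℝ} (hs : 0 < s) (hst : s ≤ t)
    (hm : ∀ r, s ≤ r → r ≤ t → m ≤ g r) : G s + m * (t - s) ≤ G t := by
  have h4 : ∀ r ∈ Set.Icc s t, G s + m * (r - s) ≤ G r := by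
    apply image_le_of_deriv_right_le_deriv_boundary (f := fun r => G s + m * (r - s)) (f' := fun _ => m) (B := G) (B' := g)
    · fun_prop
    · intro r hr
      have : HasDerivAt (fun r => G s + m * (r - s)) (m * 1) r :=
        (((hasDerivAt_id r).sub_const _).const_mul m).const_add _
      rw [mul_one] at this
      exact this.hasDerivWithinAt
    · simp
    · exact fun r hr => (hG r (by linarith [hr.1])).continuousAt.continuousWithinAt
    · exact fun r hr => (hG r (by linarith [hr.1])).hasDerivWithinAt
    · exact fun r hr => hm r hr.1 hr.2.le
  exact h4 t ⟨hst, le_rfl⟩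

theorem mkGF (hn : 3 ≤ n) (hk : k + 1 ≤ n) {lam : ℝ} (hl : 0 < lam) (hla : ∀ i, lam ≤ a i)
    (hsig : sg Finset.univ (k+1) a = 1) (h0 : k = 0 → ∀ i, a i < 1/2) {R₀ : ℝ} (hR0 : 2 * ∑ i, a i + 2 ≤ R₀)
    (hα : (3 + 8/lam)^(k+1) * (2 * R₀)^(-genExp n (k+1) a) ≤ α) :
    GF n k a lam R₀ (fun t => ∫ s in R₀..t, genInt n (k+1) a α s) (genInt n (k+1) a α)
      (α * R₀^(genExp n (k+1) a + 1) / (-genExp n (k+1) a - 1)) (α * R₀^(genExp n (k+1) a + 1)) (hkfun n (k+1) a) := by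
  have ha : ∀ i, 0 < a i := fun i => hl.trans_le (hla i)
  have hsa : 0 ≤ ∑ i, a i := Finset.sum_nonneg (fun i _ => (ha i).le)
  have hR : 0 < R₀ := by linarith
  have hα0 : 0 < α := lt_of_lt_of_le (by positivity) hα
  have hh := hk_pos (by omega) hk ha
  have hp1 := gexp_lt hh (hk_lt hn hk ha hsig h0)
  have hdG := fun t (ht : 0 < t) => G_der (n := n) (k := k) (a := a) hα0 hR ht
  set p := genExp n (k+1) a with hp
  set G : ℝ → ℝ := fun t => ∫ s in R₀..t, genInt n (k+1) a α s with hGd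
  have hG0 : G R₀ = 0 := by simp [hGd]
  have hG2 : (3 + 8/lam) * R₀ ≤ G (2 * R₀) := by
    have := cmp_low hdG hR (t := 2 * R₀) (m := 3 + 8/lam) (by linarith) (by
      intro r h1 h2
      have hr : 0 < r := by linarith
      apply le_of_pow_le_pow_left₀ (Nat.succ_ne_zero k) (by linarith [g_one (n := n) (k := k) (a := a) hα0 hr])
      rw [g_pow hα0 hr, ← hp]
      have h3 : (2 * R₀)^p ≤ r^p := Real.rpow_le_rpow_of_nonpos hr h2 (by linarith)
      have h4 : (3 + 8/lam)^(k+1) = (3 + 8/lam)^(k+1) * (2 * R₀)^(-p) * (2 * R₀)^p := by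
        rw [mul_assoc, ← Real.rpow_add (by positivity)]; simp
      have h5 : (3 + 8/lam)^(k+1) ≤ α * r^p := by
        rw [h4]
        exact mul_le_mul hα h3 (by positivity) hα0.le
      rw [Nat.succ_eq_add_one]
      linarith)
    rw [hG0] at this
    linarith
  refine ⟨hn, hk, hl, hla, hsig, hR0, fun i => hk_le i, hG0, hdG, fun t ht => g_dg hα0 hh ht, fun t ht => g_one hα0 ht, ?_, ?_, ?_, ?_⟩
  · intro t ht
    have ht0 : 0 < t := by linarith
    have h1 := g_le (n := n) (k := k) (a := a) hα0 ht0
    rw [← hp] at h1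
    have h2 : t^(p+1) ≤ R₀^(p+1) := Real.rpow_le_rpow_of_nonpos hR ht (by linarith)
    have h3 : t^(p+1) = t^p * t := Real.rpow_add_one ht0.ne' p
    calc _ ≤ (α * t^p) * t := mul_le_mul_of_nonneg_right (by linarith) ht0.le
      _ = α * t^(p+1) := by rw [h3]; ring
      _ ≤ _ := mul_le_mul_of_nonneg_left h2 hα0.le
  · refine le_trans ?_ hG2
    have : 8 * R₀ / lam = 8 / lam * R₀ := by ring
    rw [this]; nlinarith
  · intro t ht
    have := cmp_low hdG (s := 2 * R₀) (t := t) (m := 1) (by linarith) ht (fun r h1 h2 => g_one hα0 (by linarith))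
    have h2 : 0 ≤ 8/lam * R₀ := by positivity
    linarith
  · intro t ht
    have h4 : ∀ r ∈ Set.Icc R₀ t, G r ≤ (r - R₀) + α * (R₀^(p+1) - r^(p+1)) / (-p - 1) := by
      apply image_le_of_deriv_right_le_deriv_boundary (f := G) (f' := genInt n (k+1) a α)
        (B := fun r => (r - R₀) + α * (R₀^(p+1) - r^(p+1)) / (-p - 1)) (B' := fun r => 1 + α * r^p)
      · exact fun r hr => (hdG r (by linarith [hr.1])).continuousAt.continuousWithinAt
      · exact fun r hr => (hdG r (by linarith [hr.1])).hasDerivWithinAt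
      · simp [hG0]
      · intro r hr
        have : r ≠ 0 := by linarith [hr.1]
        apply ContinuousAt.continuousWithinAt
        have := Real.continuousAt_rpow_const r (p+1) (Or.inl this)
        fun_prop
      · intro r hr
        have hr0 : r ≠ 0 := by linarith [hr.1]
        have h5 : HasDerivAt (fun r : ℝ => r^(p+1)) ((p+1) * r^(p+1-1)) r := Real.hasDerivAt_rpow_const (Or.inl hr0)
        have h6 := ((hasDerivAt_id r).sub_const R₀).add (((h5.const_sub (R₀^(p+1))).const_mul α).div_const (-p-1))
        have h7 : 1 + α * -((p+1) * r^(p+1-1)) / (-p-1) = 1 + α * r^p := by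
          have : -p - 1 ≠ 0 := by linarith
          rw [add_sub_cancel_right]
          field_simp; ring
        rw [h7] at h6
        exact h6.hasDerivWithinAt
      · intro r hr
        exact g_le hα0 (by linarith [hr.1])
    have h5 := h4 t ⟨by linarith, le_rfl⟩
    have h6 : α * (R₀^(p+1) - t^(p+1)) / (-p - 1) ≤ α * R₀^(p+1) / (-p - 1) := by
      have ht0 : 0 < t := by linarith
      apply div_le_div_of_nonneg_right _ (by linarith)
      apply mul_le_mul_of_nonneg_left _ hα0.le
      have : 0 < t^(p+1) := by positivity
      linarith
    linarith
end PROF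

open scoped Classical Topology
open Real Filter MeasureTheory

section FIN
variable {n k : ℕ} {a : Fin n → ℝ}

lemma KKceps (hk : k + 1 ≤ n) : ∃ D : ℝ, 0 ≤ D ∧ ∀ ε : ℝ, 0 < ε → ε < 1/2 → ∃ sh : ℝ, 0 ≤ sh ∧ KK n k ε ≤ D * sh ∧
    ∀ C : ℝ, Ceps n (k+1) C ε * ε⁻¹ = C * sh := by
  have hK : (0:ℝ) < k + 1 := by positivity
  have hn0 : (0:ℝ) < n := by exact_mod_cast (by omega : 0 < n)
  have h2κ : (n:ℝ) / ((k+1:ℕ):ℝ) = 2 * kap n k := by unfold kap; push_cast; field_simp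
  have hκ0 : 0 < kap n k := by unfold kap; positivity
  rcases lt_trichotomy (2 * (k+1)) n with h | h | h
  · have hc : (2:ℝ) * (k+1) < n := by exact_mod_cast h
    have hκ : 1 < kap n k := by unfold kap; rw [lt_div_iff₀ (by positivity)]; linarith
    have hD : (1/4:ℝ)^(kap n k - 1) < 1 := Real.rpow_lt_one (by norm_num) (by norm_num) (by linarith)
    refine ⟨(1 - (1/4)^(kap n k - 1))⁻¹, inv_nonneg.2 (by linarith), fun ε he he1 => ⟨(2 * kap n k - 2) * ε⁻¹ * ε⁻¹, ?_, ?_, ?_⟩⟩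
    · have : 0 ≤ 2 * kap n k - 2 := by linarith
      positivity
    · have := Kf_gt hκ he he1
      rw [div_eq_mul_inv, mul_comm] at this
      exact this
    · intro C
      unfold Ceps
      rw [if_pos h, h2κ]; ring
  · have hc : (2:ℝ) * (k+1) = n := by exact_mod_cast h
    have hκ : kap n k = 1 := by unfold kap; rw [div_eq_one_iff_eq (by positivity)]; linarith
    refine ⟨1, zero_le_one, fun ε he he1 => ⟨ε⁻¹ * |Real.log ε|⁻¹ * ε⁻¹, by positivity, ?_, ?_⟩⟩
    · rw [one_mul, KK, hκ]; exact (Kf_eq he he1).le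
    · intro C
      unfold Ceps
      rw [if_neg (by omega), if_pos h]; ring
  · have hc : (n:ℝ) < 2 * (k+1) := by exact_mod_cast h
    have hκ : kap n k < 1 := by unfold kap; rw [div_lt_one (by positivity)]; linarith
    have hD : (1/4:ℝ)^(1 - kap n k) < 1 := Real.rpow_lt_one (by norm_num) (by norm_num) (by linarith)
    refine ⟨(1 - (1/4)^(1 - kap n k))⁻¹, inv_nonneg.2 (by linarith), fun ε he he1 => ⟨(2 - 2 * kap n k) * ε^(1 - 2 * kap n k) * ε⁻¹, ?_, ?_, ?_⟩⟩
    · have : 0 ≤ 2 - 2 * kap n k := by linarith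
      positivity
    · have := Kf_lt hκ0 hκ he he1
      rw [div_eq_mul_inv, mul_comm] at this
      exact this
    · intro C
      unfold Ceps
      rw [if_neg (by omega), if_neg (by omega), h2κ]; ring

lemma quadA_eq (x : Euc n) : quadA n (Matrix.diagonal a) x = Qd a 0 x := by
  unfold quadA Qd bl
  rw [sub_zero, div_eq_mul_one_div, mul_comm]
  congr 1
  rotate_left
  · norm_num
  apply Finset.sum_congr rfl
  intro i _
  rw [Finset.sum_eq_single i]
  · simp only [Matrix.diagonal_apply_eq]; ring
  · intro j _ hj; simp [Matrix.diagonal_apply_ne _ hj.symm]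
  · simp

lemma OmegaRe_eq {x₀ : Euc n} {ε R : ℝ} (he : 0 < ε) : OmegaRe n a x₀ ε R = Om a x₀ ε R := by
  ext x
  unfold OmegaRe ESet Om
  rw [closure_ball _ he.ne', Set.mem_sdiff, Set.mem_ofPred_eq, Set.mem_ofPred_eq, sub_zero, quadA_eq, Metric.mem_closedBall, not_le, dist_eq_norm]

lemma matSk_diag {j : ℕ} (hj : j + 1 ≤ n) (ha : ∀ i, 0 < a i) : matSk n (j+1) (Matrix.diagonal a) = sg Finset.univ (j+1) a := by
  have h := (quadN hj ha (m := 1) one_pos).2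
  have h1 : R1 ((1:ℝ) • a) 0 (fun i => a i * (0 : Euc n) i) = Matrix.diagonal a := by
    ext p q
    simp [R1, Matrix.diagonal_apply]
  rw [h1] at h
  rw [h]; simp

lemma mkSt {lam R₀ α : ℝ} {G g : ℝ → ℝ} {M₀ b h : ℝ} (hgf : GF n k a lam R₀ G g M₀ b h)
    (hG : ∀ t, G t = ∫ s in R₀..t, genInt n (k+1) a α s) {x₀ : Euc n} (hx0 : x₀ ∈ Metric.ball (0 : Euc n) (1/2))
    {ε R : ℝ} (he : 0 < ε) (he1 : ε < 1/2) (hR : 3 * R₀ < R) {u : Euc n → ℝ} (hu : ApproxSol n (k+1) a x₀ ε R R₀ α u) :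
    ∃ U, St n k a lam R₀ G g M₀ b h x₀ ε R u U := by
  obtain ⟨⟨U, hU, hcl, hsm⟩, hkc, heq, hu0, huR⟩ := hu
  rw [OmegaRe_eq he] at hcl hkc heq
  refine ⟨U, hgf, ?_, he, he1, hR, ⟨hU, Om_open, hcl, hsm, hkc, heq⟩, ?_, ?_⟩
  · simpa using hx0
  · intro x hx
    exact hu0 x (by rw [Metric.mem_sphere, dist_eq_norm, hx])
  · intro x hx
    rw [huR x (by rw [quadA_eq, hx]), ubar, quadA_eq, hx, hG]
end FIN

/-- Lemma 2.7: global second-order estimate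
`sup_{Ω_R^ε} |D²u^{ε,R}| ≤ C·C_ε·ε⁻¹`. -/
theorem statement10 (n k : ℕ) (hn : 3 ≤ n) (hk1 : 1 ≤ k) (hkn : k ≤ n)
    (a : Fin n → ℝ) (hA : MemA n k (Matrix.diagonal a))
    (hk1' : k = 1 → (⨆ i, a i) < 1 / 2) :
    ∃ Λ₀ : ℝ, 0 < Λ₀ ∧ ∀ R₀ : ℝ, Λ₀ ≤ R₀ →
      ∃ α₀ : ℝ, 0 < α₀ ∧ ∀ α : ℝ, α₀ ≤ α →
        ∃ C : ℝ, 0 < C ∧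
        ∀ x₀ : Euc n, x₀ ∈ Metric.ball (0 : Euc n) (1 / 2) → x₀ ≠ 0 →
        ∀ ε : ℝ, 0 < ε → ε < 1 / 2 →
        ∀ R : ℝ, 3 * R₀ < R →
        ∀ u : Euc n → ℝ, ApproxSol n k a x₀ ε R R₀ α u →
          ∀ x ∈ OmegaRe n a x₀ ε R,
            ‖iteratedFDeriv ℝ 2 u x‖ ≤ C * Ceps n k C ε * ε⁻¹ := by
  obtain ⟨k, rfl⟩ : ∃ m, k = m + 1 := ⟨k - 1, by omega⟩
  obtain ⟨-, hpd, hS⟩ := hA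
  have ha : ∀ i, 0 < a i := Matrix.posDef_diagonal_iff.1 hpd
  rw [matSk_diag hkn ha] at hS
  have hne : Nonempty (Fin n) := ⟨⟨0, by omega⟩⟩
  obtain ⟨i0, hi0⟩ := Finite.exists_min a
  have h0 : k = 0 → ∀ i, a i < 1/2 := fun hk i =>
    lt_of_le_of_lt (le_ciSup (Set.finite_range a).bddAbove i) (hk1' (by omega))
  have hsa : 0 ≤ ∑ i, a i := Finset.sum_nonneg (fun i _ => (ha i).le)
  obtain ⟨D, hD0, hD⟩ := KKceps hkn
  refine ⟨2 * ∑ i, a i + 2, by linarith, fun R₀ hR₀ => ?_⟩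
  have hR0 : 0 < R₀ := by linarith
  have hl := ha i0
  refine ⟨(3 + 8 / a i0) ^ (k+1) * (2 * R₀) ^ (-genExp n (k+1) a), by positivity, fun α hα => ?_⟩
  have hgf := mkGF hn hkn hl hi0 hS h0 hR₀ hα
  set F := n * C16 n k a (a i0) R₀ (α * R₀^(genExp n (k+1) a + 1) / (-genExp n (k+1) a - 1)) (α * R₀^(genExp n (k+1) a + 1)) with hF
  have hF0 : 0 ≤ |F| * D := by positivity
  refine ⟨|F| * D + 1, by linarith, ?_⟩
  intro x₀ hx₀ _ ε he he1 R hR u hu x hx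
  obtain ⟨U, S⟩ := mkSt hgf (fun _ => rfl) hx₀ he he1 hR hu
  rw [OmegaRe_eq he] at hx
  have h1 := S.final hx
  obtain ⟨sh, hs0, hs1, hs2⟩ := hD ε he he1
  rw [mul_assoc, hs2]
  have hK := S.K2
  calc _ ≤ F * KK n k ε := h1
    _ ≤ |F| * (D * sh) := mul_le_mul (le_abs_self F) hs1 (by linarith) (abs_nonneg F)
    _ = (|F| * D) * sh := by ring
    _ ≤ _ := by
      rw [← mul_assoc]
      apply mul_le_mul_of_nonneg_right _ hs0
      nlinarith
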